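/- Let a, b be coprime integers with |a − b| ≥ 2, let p_m denote the m-th prime, define ω(p_m) := exp(2πi m/(a−b)), and for an integer c and real z ≥ 2 set ζ_z(s, ω^c) := ∏_{p ≤ z, p prime} (1 − ω(p)^c p^{−s})^{−1}. Then for every compact set K contained in D := {s ∈ ℂ : 1/2 < Re(s) < 1} with connected complement in ℂ and every ε > 0, there exists a real z ≥ 2 such that the set of τ > 0 satisfying both sup_{s∈K} |log ζ(s+iaτ) − log ζ_z(s, ω^a)| < ε and sup_{s∈K} |log ζ(s+ibτ) − log ζ_z(s, ω^b)| < ε has positive lower density, i.e. liminf_{T→∞} (1/T)·μ{τ ∈ [0,T] : both suprema are < ε} > 0. -/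

import Mathlib

open MeasureTheory Filter Complex Finset
open scoped ENNReal Real

/-- The open strip `D = {s : 1/2 < Re s < 1}`. -/
def strip : Set ℂ := {s : ℂ | 1/2 < s.re ∧ s.re < 1}

/-- Lower density of a set of real numbers:
`liminf_{T→∞} (1/T)·μ(S ∩ [0,T])`. -/
noncomputable def lowerDens (S : Set ℝ) : ℝ :=
  liminf (fun T : ℝ => (volume (S ∩ Set.Icc 0 T)).toReal / T) atTop

/-- `sup_{s ∈ K} |f s|`, valued in `ℝ≥0∞`. -/
noncomputable def supNorm (K : Set ℂ) (f : ℂ → ℂ) : ℝ≥0∞ :=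
  ⨆ s ∈ K, (‖f s‖₊ : ℝ≥0∞)

/-- `ω(p_m) := exp(2πi m / (a - b))` where `p_m` is the `m`-th prime
(`p_1 = 2`, i.e. the prime `p` has 1-based index `Nat.count Nat.Prime p + 1`). -/
noncomputable def omegaP (a b : ℤ) (p : ℕ) : ℂ :=
  Complex.exp (2 * Real.pi * Complex.I * ((Nat.count Nat.Prime p : ℂ) + 1)
    / ((a : ℂ) - (b : ℂ)))

/-- The finite set of primes `p ≤ z`. -/
noncomputable def primesUpTo (z : ℝ) : Finset ℕ := (Finset.Iic ⌊z⌋₊).filter Nat.Prime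

/-- The finite twisted Euler product
`ζ_z(s, ω^c) := ∏_{p ≤ z prime} (1 - ω(p)^c p^{-s})⁻¹`. -/
noncomputable def zetaZ (a b : ℤ) (c : ℤ) (z : ℝ) (s : ℂ) : ℂ :=
  ∏ p ∈ primesUpTo z, (1 - (omegaP a b p) ^ c * (p : ℂ) ^ (-s))⁻¹

set_option linter.all false


namespace LZ

/-- four-function boundary integral -/
noncomputable def BI4 (a b H : ℝ) (f₁ f₂ f₃ f₄ : ℂ → ℂ) : ℂ :=
  (∫ x : ℝ in a..b, f₁ (x + ((-H : ℝ) : ℂ) * I)) - (∫ x : ℝ in a..b, f₃ (x + (H : ℂ) * I))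
   + I • (∫ y : ℝ in (-H)..H, f₂ ((b : ℂ) + y * I)) - I • ∫ y : ℝ in (-H)..H, f₄ ((a : ℂ) + y * I)

noncomputable def BI (a b H : ℝ) (f : ℂ → ℂ) : ℂ := BI4 a b H f f f f

def Rect (a b H : ℝ) : Set ℂ := {s | a ≤ s.re ∧ s.re ≤ b ∧ -H ≤ s.im ∧ s.im ≤ H}

lemma rect_eq {a b H : ℝ} : Rect a b H = Set.Icc a b ×ℂ Set.Icc (-H) H := by
  ext s; simp [Rect, Complex.mem_reProdIm]; tauto

lemma BI_zero {a b H : ℝ} (hab : a ≤ b) (hH : 0 ≤ H) {f : ℂ → ℂ}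
    (hf : DifferentiableOn ℂ f (Rect a b H)) : BI a b H f = 0 := by
  have := Complex.integral_boundary_rect_eq_zero_of_differentiableOn f
    ((a : ℂ) + ((-H : ℝ) : ℂ) * I) ((b : ℂ) + (H : ℂ) * I) (by
      simp only [add_re, ofReal_re, mul_re, I_re, mul_zero, ofReal_im, I_im, mul_one, sub_self,
        add_zero, add_im, mul_im, zero_add]
      rw [Set.uIcc_of_le hab, Set.uIcc_of_le (by linarith), ← rect_eq]; exact hf)
  simpa [BI, BI4] using this

lemma hasDeriv_logrot {u : ℂ} (hu : u ≠ 0) {z : ℂ} (hz : u * z ∈ slitPlane) :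
    HasDerivAt (fun z => Complex.log (u * z)) (z⁻¹) z := by
  have h1 : HasDerivAt (fun z : ℂ => u * z) u z := by simpa using (hasDerivAt_id z).const_mul u
  have := h1.clog hz
  convert this using 1
  have hz0 : z ≠ 0 := by rintro rfl; simp at hz
  field_simp

lemma log_rot {z : ℂ} (hre : 0 < z.re) (him : 0 < z.im) :
    Complex.log z - Complex.log (-I * z) = π / 2 * I := by
  have h : Complex.log (-I * z) = Complex.log (-I) + Complex.log z := by
    apply Complex.log_mul (by simp) (by rintro rfl; simp at hre)
    have hh1 := Complex.arg_neg_I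
    rw [hh1]
    have h1 : 0 ≤ arg z := Complex.arg_nonneg_iff.2 him.le
    have h2 : arg z < π / 2 := by
      have := Complex.abs_arg_lt_pi_div_two_iff.2 (Or.inl hre)
      exact (abs_lt.1 this).2
    constructor <;> linarith [Real.pi_pos]
  rw [h, Complex.log_neg_I]; ring

lemma BI_inv {a b H : ℝ} {s : ℂ} (ha : a < s.re) (hb : s.re < b) (h1 : -H < s.im) (h2 : s.im < H) :
    BI a b H (fun w => (w - s)⁻¹) = 2 * π * I := by
  -- bottom
  have gen : ∀ (u v p : ℂ) (c d : ℝ), u ≠ 0 → c ≤ d →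
      (∀ x ∈ Set.Icc c d, u * (p + x * v - s) ∈ slitPlane) →
      ∫ x : ℝ in c..d, v * (p + x * v - s)⁻¹ =
       Complex.log (u * (p + d * v - s)) - Complex.log (u * (p + c * v - s)) := by
    intro u v p c d hu hcd hsl
    have hd : ∀ x ∈ Set.uIcc c d, HasDerivAt (fun x : ℝ => Complex.log (u * (p + x * v - s)))
        (v * (p + x * v - s)⁻¹) x := by
      intro x hx
      rw [Set.uIcc_of_le hcd] at hx
      have e1 := hasDeriv_logrot hu (hsl x hx)
      have e2 : HasDerivAt (fun x : ℝ => p + x * v - s) v x := by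
        have := ((hasDerivAt_id x).ofReal_comp.mul_const v).const_add p |>.sub_const s
        simpa using this
      have := e1.comp x e2
      simpa [mul_comm, Function.comp_def] using this
    rw [intervalIntegral.integral_eq_sub_of_hasDerivAt hd]
    apply ContinuousOn.intervalIntegrable
    rw [Set.uIcc_of_le hcd]
    apply ContinuousOn.mul continuousOn_const
    apply ContinuousOn.inv₀ (by fun_prop)
    intro x hx h0
    have := hsl x hx
    rw [h0] at this; simp at this
  have sl : ∀ z : ℂ, 0 < z.re → z ∈ slitPlane := fun z hz => Or.inl hz
  have eB := gen I 1 (((-H : ℝ) : ℂ) * I) a b (by simp) (by linarith) (by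
    intro x _; apply sl; simp; linarith)
  have eT := gen (-I) 1 ((H : ℂ) * I) a b (by simp) (by linarith) (by
    intro x _; apply sl; simp; linarith)
  have eR := gen 1 I (b : ℂ) (-H) H (by simp) (by linarith) (by
    intro x _; apply sl; simp; linarith)
  have eL := gen (-1) I (a : ℂ) (-H) H (by simp) (by linarith) (by
    intro x _; apply sl; simp; linarith)
  have c1 := log_rot (z := (b : ℂ) + H * I - s) (by simp; linarith) (by simp; linarith)
  have c2 := log_rot (z := -I * ((a : ℂ) + H * I - s)) (by simp; linarith) (by simp; linarith)
  have c3 := log_rot (z := -1 * ((a : ℂ) + ((-H : ℝ) : ℂ) * I - s)) (by simp; linarith) (by simp; linarith)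
  have c4 := log_rot (z := I * ((b : ℂ) + ((-H : ℝ) : ℂ) * I - s)) (by simp; linarith) (by simp; linarith)
  simp only [BI, BI4, smul_eq_mul]
  rw [← intervalIntegral.integral_const_mul, ← intervalIntegral.integral_const_mul]
  rw [eR, eL]
  have r1 : ∀ q : ℂ, (∫ x : ℝ in a..b, ((x : ℂ) + q - s)⁻¹) = ∫ x : ℝ in a..b, 1 * (q + x * 1 - s)⁻¹ := by
    intro q; congr 1; ext x; ring_nf
  rw [r1, r1, eB, eT]
  have i2 : -I * (-I * ((a : ℂ) + H * I - s)) = -1 * ((a : ℂ) + H * I - s) := by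
    linear_combination ((a : ℂ) + H * I - s) * I_sq
  have i3 : -I * (-1 * ((a : ℂ) + ((-H : ℝ) : ℂ) * I - s)) = I * ((a : ℂ) + ((-H : ℝ) : ℂ) * I - s) := by ring
  have i4 : -I * (I * ((b : ℂ) + ((-H : ℝ) : ℂ) * I - s)) = 1 * ((b : ℂ) + ((-H : ℝ) : ℂ) * I - s) := by
    linear_combination -((b : ℂ) + ((-H : ℝ) : ℂ) * I - s) * I_sq
  rw [i2] at c2; rw [i3] at c3; rw [i4] at c4
  have j1 : (1:ℂ) * ((b : ℂ) + H * I - s) = (b : ℂ) + H * I - s := one_mul _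
  rw [j1]
  have k : ∀ x : ℝ, ∀ q : ℂ, q + x * 1 - s = x + q - s := by intros; ring
  simp only [k]
  linear_combination c1 + c2 + c3 + c4

lemma BI_cauchy {a b H : ℝ} {s : ℂ} (ha : a < s.re) (hb : s.re < b) (h1 : -H < s.im) (h2 : s.im < H)
    {f : ℂ → ℂ} (hf : DifferentiableOn ℂ f (Rect a b H)) :
    BI a b H (fun w => f w * (w - s)⁻¹) = 2 * π * I * f s := by
  have hH : -H < H := by linarith
  have hab : a < b := by linarith
  have hn : Rect a b H ∈ nhds s := by
    rw [rect_eq]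
    refine mem_of_superset ((isOpen_Ioo (a := a) (b := b)).reProdIm (isOpen_Ioo (a := -H) (b := H))
      |>.mem_nhds ?_) ?_
    · simp [Complex.mem_reProdIm]; exact ⟨⟨ha, hb⟩, h1, h2⟩
    · intro z hz; simp [Complex.mem_reProdIm] at hz ⊢
      exact ⟨⟨hz.1.1.le, hz.1.2.le⟩, hz.2.1.le, hz.2.2.le⟩
  have hd := (Complex.differentiableOn_dslope hn).2 hf
  have h0 := BI_zero hab.le (by linarith) hd
  have hinv := BI_inv ha hb h1 h2
  -- integrability facts
  have cD := hd.continuousOn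
  have key : ∀ (g : ℝ → ℂ) (c d : ℝ), c ≤ d → Continuous g → (∀ x ∈ Set.Icc c d, g x ∈ Rect a b H) →
     (∀ x, g x ≠ s) → (∫ x : ℝ in c..d, f (g x) * (g x - s)⁻¹) =
       (∫ x : ℝ in c..d, dslope f s (g x)) + f s * ∫ x : ℝ in c..d, (g x - s)⁻¹ := by
    intro g c d hcd hg hm hne
    rw [← intervalIntegral.integral_const_mul, ← intervalIntegral.integral_add]
    · congr 1; ext x
      rw [dslope_of_ne _ (hne x), slope_def_field]
      have := sub_ne_zero.2 (hne x)
      field_simp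
      ring
    · apply ContinuousOn.intervalIntegrable
      rw [Set.uIcc_of_le hcd]
      exact cD.comp hg.continuousOn hm
    · apply Continuous.intervalIntegrable
      apply Continuous.mul continuous_const
      exact Continuous.inv₀ (by fun_prop) (fun x => sub_ne_zero.2 (hne x))
  simp only [BI, BI4] at h0 hinv ⊢
  rw [key (fun x : ℝ => x + ((-H : ℝ) : ℂ) * I) a b hab.le (by fun_prop)
      (by intro x hx; simp [Rect]; exact ⟨hx.1, hx.2, by linarith⟩)
      (by intro x h; have := congrArg Complex.im h; simp at this; linarith),
    key (fun x : ℝ => x + (H : ℂ) * I) a b hab.le (by fun_prop)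
      (by intro x hx; simp [Rect]; exact ⟨hx.1, hx.2, by linarith⟩)
      (by intro x h; have := congrArg Complex.im h; simp at this; linarith),
    key (fun x : ℝ => (b : ℂ) + x * I) (-H) H hH.le (by fun_prop)
      (by intro x hx; simp [Rect]; exact ⟨hab.le, hx.1, hx.2⟩)
      (by intro x h; have := congrArg Complex.re h; simp at this; linarith),
    key (fun x : ℝ => (a : ℂ) + x * I) (-H) H hH.le (by fun_prop)
      (by intro x hx; simp [Rect]; exact ⟨hab.le, hx.1, hx.2⟩)
      (by intro x h; have := congrArg Complex.re h; simp at this; linarith)]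
  simp only [smul_eq_mul] at h0 hinv ⊢
  linear_combination h0 + f s * hinv

/-- the path -/
noncomputable def gam (a b H t : ℝ) : ℂ :=
  if t ≤ 1 then ((a + (b - a) * t : ℝ) : ℂ) + ((-H : ℝ) : ℂ) * I
  else if t ≤ 2 then (b : ℂ) + ((-H + 2 * H * (t - 1) : ℝ) : ℂ) * I
  else if t ≤ 3 then ((b - (b - a) * (t - 2) : ℝ) : ℂ) + (H : ℂ) * I
  else (a : ℂ) + ((H - 2 * H * (t - 3) : ℝ) : ℂ) * I

noncomputable def hh (a b H : ℝ) (f₁ f₂ f₃ f₄ : ℂ → ℂ) (t : ℝ) : ℂ :=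
  if t ≤ 1 then (b - a) * f₁ (gam a b H t)
  else if t ≤ 2 then 2 * H * I * f₂ (gam a b H t)
  else if t ≤ 3 then -(b - a) * f₃ (gam a b H t)
  else - (2 * H * I) * f₄ (gam a b H t)

lemma gam_mem {a b H t : ℝ} (hab : a ≤ b) (hH : 0 ≤ H) (ht : t ∈ Set.Icc (0:ℝ) 4) :
    gam a b H t ∈ Rect a b H := by
  obtain ⟨h0, h4⟩ := ht
  have e1 : 0 ≤ b - a := by linarith
  unfold gam
  split_ifs with h1 h2 h3 <;> simp only [Rect, Set.mem_setOf_eq, add_re, ofReal_re, mul_re, I_re, mul_zero, ofReal_im, I_im, mul_one, sub_self,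
        add_zero, add_im, mul_im, zero_add, sub_zero]
  all_goals refine ⟨?_, ?_, ?_, ?_⟩ <;> nlinarith

lemma gam_meas (a b H : ℝ) : Measurable (gam a b H) := by
  unfold gam
  refine Measurable.ite measurableSet_Iic (by fun_prop) (Measurable.ite measurableSet_Iic (by fun_prop)
    (Measurable.ite measurableSet_Iic (by fun_prop) (by fun_prop)))

lemma hh_int {a b H : ℝ} (hab : a ≤ b) (hH : 0 ≤ H) {f₁ f₂ f₃ f₄ : ℂ → ℂ}
    (c1 : ContinuousOn (fun x : ℝ => f₁ (x + ((-H : ℝ) : ℂ) * I)) (Set.Icc a b))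
    (c2 : ContinuousOn (fun y : ℝ => f₂ ((b : ℂ) + y * I)) (Set.Icc (-H) H))
    (c3 : ContinuousOn (fun x : ℝ => f₃ (x + (H : ℂ) * I)) (Set.Icc a b))
    (c4 : ContinuousOn (fun y : ℝ => f₄ ((a : ℂ) + y * I)) (Set.Icc (-H) H)) :
    IntervalIntegrable (hh a b H f₁ f₂ f₃ f₄) volume 0 4 ∧
      ∫ t in (0:ℝ)..4, hh a b H f₁ f₂ f₃ f₄ t = BI4 a b H f₁ f₂ f₃ f₄ := by
  have gen : ∀ (g : ℝ → ℂ) (k d p c' d' : ℝ) (u : ℂ), p = k * c' + d ∨ True →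
      ContinuousOn g (Set.uIcc (k * c' + d) (k * d' + d)) → c' ≤ d' →
      (∀ t ∈ Set.Ioc c' d', hh a b H f₁ f₂ f₃ f₄ t = u * k * g (k * t + d)) →
      IntervalIntegrable (hh a b H f₁ f₂ f₃ f₄) volume c' d' ∧
      ∫ t in c'..d', hh a b H f₁ f₂ f₃ f₄ t = u * ∫ x in (k * c' + d)..(k * d' + d), g x := by
    intro g k d p c' d' u _ hg hcd he
    have hii : IntervalIntegrable (fun t => u * k * g (k * t + d)) volume c' d' := by
      apply ContinuousOn.intervalIntegrable
      apply ContinuousOn.mul continuousOn_const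
      apply hg.comp (by fun_prop)
      intro t ht
      rw [Set.uIcc_of_le hcd] at ht
      simp only [Set.mem_uIcc]
      rcases le_total 0 k with hk | hk
      · left; constructor <;> nlinarith [ht.1, ht.2]
      · right; constructor <;> nlinarith [ht.1, ht.2]
    constructor
    · refine hii.congr ?_
      rw [Set.uIoc_of_le hcd]
      intro t ht; exact (he t ht).symm
    · rw [intervalIntegral.integral_congr_ae (g := fun t => u * k * g (k * t + d))]
      · rw [← intervalIntegral.smul_integral_comp_mul_add]
        rw [intervalIntegral.integral_const_mul, real_smul]; ring
      · rw [Set.uIoc_of_le hcd]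
        exact ae_of_all _ he
  have e1 := gen (fun x : ℝ => f₁ (x + ((-H : ℝ) : ℂ) * I)) (b - a) a 0 0 1 1 (by simp)
    (by simpa [Set.uIcc_of_le hab] using c1) (by norm_num) (by
      intro t ht
      simp only [hh, gam, if_pos ht.2]; push_cast; ring_nf)
  have e2 := gen (fun y : ℝ => f₂ ((b : ℂ) + y * I)) (2 * H) (-3 * H) 0 1 2 I (by simp)
    (by
      have : (2 * H * 1 + -3 * H) = -H := by ring
      have h' : (2 * H * 2 + -3 * H) = H := by ring
      rw [this, h', Set.uIcc_of_le (by linarith)]; exact c2) (by norm_num) (by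
      intro t ht
      simp only [hh, gam, if_pos ht.2, if_neg (not_le.2 ht.1)]; push_cast; ring_nf)
  have e3 := gen (fun x : ℝ => f₃ (x + (H : ℂ) * I)) (-(b - a)) (b + 2 * (b - a)) 0 2 3 1 (by simp)
    (by
      have : (-(b - a) * 2 + (b + 2 * (b - a))) = b := by ring
      have h' : (-(b - a) * 3 + (b + 2 * (b - a))) = a := by ring
      rw [this, h', Set.uIcc_of_ge (by linarith)]; exact c3) (by norm_num) (by
      intro t ht
      have : ¬ t ≤ 1 := by linarith [ht.1]
      simp only [hh, gam, if_pos ht.2, if_neg (not_le.2 ht.1), if_neg this]; push_cast; ring_nf)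
  have e4 := gen (fun y : ℝ => f₄ ((a : ℂ) + y * I)) (-(2 * H)) (7 * H) 0 3 4 I (by simp)
    (by
      have : (-(2 * H) * 3 + 7 * H) = H := by ring
      have h' : (-(2 * H) * 4 + 7 * H) = -H := by ring
      rw [this, h', Set.uIcc_of_ge (by linarith)]; exact c4) (by norm_num) (by
      intro t ht
      have h1 : ¬ t ≤ 1 := by linarith [ht.1]
      have h2 : ¬ t ≤ 2 := by linarith [ht.1]
      simp only [hh, gam, if_neg (not_le.2 ht.1), if_neg h1, if_neg h2]; push_cast; ring_nf)
  refine ⟨((e1.1.trans e2.1).trans e3.1).trans e4.1, ?_⟩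
  rw [← intervalIntegral.integral_add_adjacent_intervals ((e1.1.trans e2.1).trans e3.1) e4.1,
    ← intervalIntegral.integral_add_adjacent_intervals (e1.1.trans e2.1) e3.1,
    ← intervalIntegral.integral_add_adjacent_intervals e1.1 e2.1, e1.2, e2.2, e3.2, e4.2]
  have t1 : (2 * H * 1 + -3 * H) = -H := by ring
  have t2 : (2 * H * 2 + -3 * H) = H := by ring
  have t3 : (-(b - a) * 2 + (b + 2 * (b - a))) = b := by ring
  have t4 : (-(b - a) * 3 + (b + 2 * (b - a))) = a := by ring
  have t5 : (-(2 * H) * 3 + 7 * H) = H := by ring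
  have t6 : (-(2 * H) * 4 + 7 * H) = -H := by ring
  rw [t1, t2, t3, t4, t5, t6, intervalIntegral.integral_symm a b, intervalIntegral.integral_symm (-H) H]
  simp only [BI4, smul_eq_mul]
  simp
  ring

lemma gam_cont (a b H : ℝ) : Continuous (gam a b H) := by
  unfold gam
  refine Continuous.if_le (by fun_prop) ?_ continuous_id continuous_const ?_
  · refine Continuous.if_le (by fun_prop) ?_ continuous_id continuous_const ?_
    · refine Continuous.if_le (by fun_prop) (by fun_prop) continuous_id continuous_const ?_
      intro t ht; subst ht; push_cast; ring
    · intro t ht; subst ht; norm_num; ring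
  · intro t ht; subst ht; norm_num

lemma cs_four {u : ℝ → ℝ} (hu : ContinuousOn u (Set.Icc 0 4)) :
    (∫ t in (0:ℝ)..4, u t) ^ 2 ≤ 4 * ∫ t in (0:ℝ)..4, u t ^ 2 := by
  set m := (∫ t in (0:ℝ)..4, u t) / 4 with hm
  have hu' : ContinuousOn u (Set.uIcc 0 4) := by rwa [Set.uIcc_of_le (by norm_num)]
  have i1 : IntervalIntegrable u volume 0 4 := hu'.intervalIntegrable
  have i2 : IntervalIntegrable (fun t => u t ^ 2) volume 0 4 := (hu'.pow 2).intervalIntegrable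
  have h0 : 0 ≤ ∫ t in (0:ℝ)..4, (u t - m) ^ 2 :=
    intervalIntegral.integral_nonneg (by norm_num) (fun t _ => sq_nonneg _)
  have he : ∫ t in (0:ℝ)..4, (u t - m) ^ 2 =
      (∫ t in (0:ℝ)..4, u t ^ 2) - 2 * m * (∫ t in (0:ℝ)..4, u t) + 4 * m ^ 2 := by
    have : (fun t => (u t - m) ^ 2) = fun t => (u t ^ 2 - 2 * m * u t) + m ^ 2 := by ext t; ring
    rw [this, intervalIntegral.integral_add (i2.sub (i1.const_mul _)) (by simp),
      intervalIntegral.integral_sub i2 (i1.const_mul _), intervalIntegral.integral_const_mul]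
    simp
  rw [he] at h0
  have hm4 : (∫ t in (0:ℝ)..4, u t) = 4 * m := by rw [hm]; ring
  rw [hm4] at h0 ⊢
  nlinarith

/-- sup bound: values inside controlled by L² norm on the boundary path -/
lemma sup_bound {a b H a' b' H' : ℝ} (ha : a < a') (hb : b' < b) (hH : H' < H) (hab : a ≤ b) (hH0 : 0 ≤ H)
     : ∃ C : ℝ, 0 < C ∧ ∀ f : ℂ → ℂ, DifferentiableOn ℂ f (Rect a b H) → ∀ s ∈ Rect a' b' H',
      ‖f s‖ ^ 2 ≤ C * ∫ t in (0:ℝ)..4, ‖f (gam a b H t)‖ ^ 2 := by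
  set d := min (min (a' - a) (b - b')) (H - H') with hd
  have hd0 : 0 < d := by simp [hd]; exact ⟨⟨ha, hb⟩, hH⟩
  have d1 : d ≤ a' - a := (min_le_left _ _).trans (min_le_left _ _)
  have d2 : d ≤ b - b' := (min_le_left _ _).trans (min_le_right _ _)
  have d3 : d ≤ H - H' := min_le_right _ _
  set L := (b - a) + 2 * H with hL
  have hL0 : 0 ≤ L := by rw [hL]; linarith
  refine ⟨(L / d) ^ 2 * 4 + 1, by positivity, ?_⟩
  rintro f hf s ⟨s1, s2, s3, s4⟩
  set F : ℂ → ℂ := fun w => f w * (w - s)⁻¹ with hF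
  have hc := BI_cauchy (a := a) (b := b) (H := H) (s := s) (by linarith) (by linarith) (by linarith) (by linarith) hf
  have hdist : ∀ t ∈ Set.Icc (0:ℝ) 4, d ≤ ‖gam a b H t - s‖ := by
    intro t ht
    have r1 := Complex.abs_re_le_norm (gam a b H t - s)
    have r2 := Complex.abs_im_le_norm (gam a b H t - s)
    have r3 := neg_abs_le (gam a b H t - s).re
    have r4 := neg_abs_le (gam a b H t - s).im
    have r5 := le_abs_self (gam a b H t - s).re
    have r6 := le_abs_self (gam a b H t - s).im
    simp only [sub_re, sub_im] at r1 r2 r3 r4 r5 r6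
    unfold gam at *
    split_ifs at * <;> simp at * <;> linarith
  have hne : ∀ w ∈ Rect a b H, w ≠ s → True := fun _ _ _ => trivial
  have cf := hf.continuousOn
  have cF : ∀ (g : ℝ → ℂ) (c d : ℝ), Continuous g → (∀ x ∈ Set.Icc c d, g x ∈ Rect a b H) →
     (∀ x, g x ≠ s) → ContinuousOn (fun x => F (g x)) (Set.Icc c d) := by
    intro g c d hg hm hne
    apply ContinuousOn.mul (cf.comp hg.continuousOn hm)
    exact (Continuous.inv₀ (by fun_prop) (fun x => sub_ne_zero.2 (hne x))).continuousOn
  have hi := hh_int (a := a) (b := b) (H := H) hab hH0 (f₁ := F) (f₂ := F) (f₃ := F) (f₄ := F)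
    (cF (fun x : ℝ => x + ((-H : ℝ) : ℂ) * I) a b (by fun_prop)
      (by intro x hx; simp [Rect]; exact ⟨hx.1, hx.2, by linarith⟩)
      (by intro x h; have := congrArg Complex.im h; simp at this; linarith))
    (cF (fun x : ℝ => (b : ℂ) + x * I) (-H) H (by fun_prop)
      (by intro x hx; simp [Rect]; exact ⟨hab, hx.1, hx.2⟩)
      (by intro x h; have := congrArg Complex.re h; simp at this; linarith))
    (cF (fun x : ℝ => x + (H : ℂ) * I) a b (by fun_prop)
      (by intro x hx; simp [Rect]; exact ⟨hx.1, hx.2, by linarith⟩)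
      (by intro x h; have := congrArg Complex.im h; simp at this; linarith))
    (cF (fun x : ℝ => (a : ℂ) + x * I) (-H) H (by fun_prop)
      (by intro x hx; simp [Rect]; exact ⟨hab, hx.1, hx.2⟩)
      (by intro x h; have := congrArg Complex.re h; simp at this; linarith))
  have hu : ContinuousOn (fun t => ‖f (gam a b H t)‖) (Set.Icc 0 4) :=
    (cf.comp (gam_cont a b H).continuousOn (fun t ht => gam_mem hab hH0 ht)).norm
  have hb1 : ‖BI a b H F‖ ≤ L / d * ∫ t in (0:ℝ)..4, ‖f (gam a b H t)‖ := by
    rw [BI, ← hi.2, ← intervalIntegral.integral_const_mul]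
    apply intervalIntegral.norm_integral_le_of_norm_le (by norm_num)
    · refine ae_of_all _ fun t ht => ?_
      have hdt := hdist t ⟨ht.1.le, ht.2⟩
      have hFt : ‖F (gam a b H t)‖ ≤ ‖f (gam a b H t)‖ / d := by
        rw [hF]; simp only [norm_mul, norm_inv]
        rw [div_eq_mul_inv]; gcongr
      have n1 : ‖((b:ℂ) - a)‖ ≤ L := by
        rw [← ofReal_sub, norm_real, Real.norm_of_nonneg (by linarith)]; linarith
      have n2 : ‖(2 * (H:ℂ) * I)‖ ≤ L := by
        simp [abs_of_nonneg hH0]; linarith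
      have : ‖hh a b H F F F F t‖ ≤ L * ‖F (gam a b H t)‖ := by
        unfold hh
        split_ifs <;> rw [norm_mul] <;> try rw [norm_neg]
        all_goals gcongr
      calc _ ≤ _ := this
        _ ≤ L * (‖f (gam a b H t)‖ / d) := by gcongr
        _ = _ := by ring
    · apply ContinuousOn.intervalIntegrable
      rw [Set.uIcc_of_le (by norm_num)]
      exact continuousOn_const.mul hu
  rw [hc] at hb1
  have hpi : ‖2 * (π:ℂ) * I * f s‖ = 2 * π * ‖f s‖ := by
    simp [abs_of_nonneg Real.pi_pos.le]
  rw [hpi] at hb1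
  have hfs : ‖f s‖ ≤ L / d * ∫ t in (0:ℝ)..4, ‖f (gam a b H t)‖ := by
    refine le_trans ?_ hb1
    nlinarith [Real.pi_gt_three, norm_nonneg (f s)]
  have hcs := cs_four hu
  have h0 : 0 ≤ ∫ t in (0:ℝ)..4, ‖f (gam a b H t)‖ ^ 2 :=
    intervalIntegral.integral_nonneg (by norm_num) (fun t _ => by positivity)
  calc ‖f s‖ ^ 2 ≤ (L / d * ∫ t in (0:ℝ)..4, ‖f (gam a b H t)‖) ^ 2 := by gcongr
    _ = (L / d) ^ 2 * (∫ t in (0:ℝ)..4, ‖f (gam a b H t)‖) ^ 2 := by ring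
    _ ≤ (L / d) ^ 2 * (4 * ∫ t in (0:ℝ)..4, ‖f (gam a b H t)‖ ^ 2) := by gcongr
    _ ≤ _ := by nlinarith

end LZ

namespace LZ
lemma exists_A (B : ℝ) : ∃ δ : ℝ, 0 < δ ∧ δ ≤ 1 / 2 ∧ ∃ A : ℂ → ℂ,
    DifferentiableOn ℂ A {z | 1 - δ < z.re ∧ |z.im| < B} ∧
    ∀ z : ℂ, 1 < z.re → |z.im| < B →
      LSeries (fun n => (ArithmeticFunction.vonMangoldt n : ℂ)) z = (z - 1)⁻¹ + A z := by
  set S : Set ℂ := (Set.Icc (1/2:ℝ) 1 ×ℂ Set.Icc (-B) B) with hS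
  have hSc : IsCompact S := isCompact_Icc.reProdIm isCompact_Icc
  have hfin := hSc.inter_riemannZetaZeros_finite
  obtain ⟨δ, hδ0, hδ1, hδ⟩ : ∃ δ : ℝ, 0 < δ ∧ δ ≤ 1/2 ∧ ∀ z ∈ S, 1 - δ < z.re → riemannZeta z ≠ 0 := by
    rcases (S ∩ riemannZetaZeros).eq_empty_or_nonempty with he | hne
    · refine ⟨1/2, by norm_num, le_rfl, fun z hz _ h0 => ?_⟩
      have : z ∈ S ∩ riemannZetaZeros := ⟨hz, mem_riemannZetaZeros.2 h0⟩
      rw [he] at this; exact this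
    · obtain ⟨w, hw, hmax⟩ := Set.exists_max_image _ Complex.re hfin hne
      have hw1 : w.re < 1 := by
        by_contra hcon
        exact riemannZeta_ne_zero_of_one_le_re (not_lt.1 hcon) (mem_riemannZetaZeros.1 hw.2)
      refine ⟨min (1/2) (1 - w.re), by simp [hw1], min_le_left _ _, fun z hz h1 h0 => ?_⟩
      have := hmax z ⟨hz, mem_riemannZetaZeros.2 h0⟩
      have h3 := min_le_right (1/2) (1 - w.re)
      linarith
  have hnz : ∀ z : ℂ, 1 - δ < z.re → |z.im| < B → riemannZeta z ≠ 0 := by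
    intro z h1 h2
    rcases le_or_gt 1 z.re with h | h
    · exact riemannZeta_ne_zero_of_one_le_re h
    · refine hδ z ?_ h1
      rw [hS, Complex.mem_reProdIm]
      rw [abs_lt] at h2
      exact ⟨⟨by linarith, h.le⟩, h2.1.le, h2.2.le⟩
  refine ⟨δ, hδ0, hδ1, fun z => - deriv (DirichletCharacter.LFunctionTrivChar₁ 1) z / DirichletCharacter.LFunctionTrivChar₁ 1 z, ?_, ?_⟩
  · have hd := DirichletCharacter.differentiable_LFunctionTrivChar₁ 1
    intro z hz
    apply DifferentiableAt.differentiableWithinAt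
    refine DifferentiableAt.div ?_ (hd z) ?_
    · have : AnalyticAt ℂ (DirichletCharacter.LFunctionTrivChar₁ 1) z := hd.analyticAt z
      exact this.deriv.differentiableAt.neg
    · by_cases h1 : z = 1
      · rw [h1]; exact DirichletCharacter.LFunctionTrivChar₁_apply_one_ne_zero 1
      · rw [DirichletCharacter.LFunctionTrivChar₁, Function.update_of_ne h1]
        refine mul_ne_zero (sub_ne_zero.2 h1) ?_
        rw [DirichletCharacter.LFunctionTrivChar, DirichletCharacter.LFunction_modOne_eq]
        exact hnz z hz.1 hz.2
  · intro z h1 h2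
    have hz1 : z ≠ 1 := by rintro rfl; simp at h1
    have hz0 := hnz z (by linarith) h2
    rw [ArithmeticFunction.LSeries_vonMangoldt_eq_deriv_riemannZeta_div h1]
    beta_reduce
    rw [DirichletCharacter.deriv_LFunctionTrivChar₁_apply_of_ne_one 1 hz1]
    rw [DirichletCharacter.LFunctionTrivChar₁, Function.update_of_ne hz1]
    have e : DirichletCharacter.LFunctionTrivChar 1 = riemannZeta := by
      ext w; rw [DirichletCharacter.LFunctionTrivChar, DirichletCharacter.LFunction_modOne_eq]
    rw [e]
    have := sub_ne_zero.2 hz1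
    field_simp
    ring


lemma summ_pp (a : ℝ) (ha : 1/2 < a) :
    Summable (fun n : ℕ => if n.Prime then 0 else ArithmeticFunction.vonMangoldt n * (n:ℝ)^(-a)) := by
  have hF : Summable (fun q : ℕ × ℕ => if 2 ≤ q.1 then Real.log q.1 * ((q.1:ℝ)^(-a))^(q.2+2) else 0) := by
    have hnn : ∀ q : ℕ × ℕ, 0 ≤ (if 2 ≤ q.1 then Real.log q.1 * ((q.1:ℝ)^(-a))^(q.2+2) else 0) := by
      intro q; split_ifs
      · exact mul_nonneg (Real.log_natCast_nonneg _) (by positivity)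
      · exact le_rfl
    have hlt : ∀ m : ℕ, 2 ≤ m → (m:ℝ)^(-a) ≤ (2:ℝ)^(-a) := by
      intro m hm
      exact Real.rpow_le_rpow_of_nonpos (by norm_num) (by exact_mod_cast hm) (by linarith)
    have h2 : (2:ℝ)^(-a) < 1 := Real.rpow_lt_one_of_one_lt_of_neg (by norm_num) (by linarith)
    have hgs : ∀ m : ℕ, 2 ≤ m → HasSum (fun k : ℕ => Real.log m * ((m:ℝ)^(-a))^(k+2))
        (Real.log m * ((m:ℝ)^(-a))^2 * (1 - (m:ℝ)^(-a))⁻¹) := by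
      intro m hm
      have h := (hasSum_geometric_of_lt_one (r := (m:ℝ)^(-a)) (by positivity) ((hlt m hm).trans_lt h2)).mul_left (Real.log m * ((m:ℝ)^(-a))^2)
      have e : (fun k : ℕ => Real.log m * ((m:ℝ)^(-a))^(k+2)) = fun k : ℕ => Real.log m * ((m:ℝ)^(-a))^2 * ((m:ℝ)^(-a))^k := by
        funext k; ring
      rw [e]; exact h
    rw [summable_prod_of_nonneg hnn]
    constructor
    · intro m
      by_cases hm : 2 ≤ m
      · simpa [hm] using (hgs m hm).summable
      · simp [hm, summable_zero]
    · set η : ℝ := (2*a - 1)/2 with hη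
      have hη0 : 0 < η := by rw [hη]; linarith
      have hs : Summable (fun m : ℕ => (1 - (2:ℝ)^(-a))⁻¹ * η⁻¹ * (m:ℝ)^(-(1+η))) :=
        (Real.summable_nat_rpow.2 (by linarith)).mul_left _
      refine Summable.of_nonneg_of_le (fun m => tsum_nonneg fun k => hnn _) (fun m => ?_) hs
      by_cases hm : 2 ≤ m
      · simp only [hm, if_true]
        rw [(hgs m hm).tsum_eq]
        have hm0 : (0:ℝ) < m := by exact_mod_cast (by omega : 0 < m)
        have hl : Real.log m ≤ (m:ℝ)^η / η := Real.log_le_rpow_div hm0.le hη0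
        have h3 : (1 - (m:ℝ)^(-a))⁻¹ ≤ (1 - (2:ℝ)^(-a))⁻¹ :=
          inv_anti₀ (by linarith) (by linarith [hlt m hm])
        have h4 : ((m:ℝ)^(-a))^2 = (m:ℝ)^(-(2*a)) := by
          rw [← Real.rpow_natCast, ← Real.rpow_mul hm0.le]; congr 1; push_cast; ring
        have h5 : (m:ℝ)^η / η * ((m:ℝ)^(-a))^2 = η⁻¹ * (m:ℝ)^(-(1+η)) := by
          rw [h4, div_mul_eq_mul_div, ← Real.rpow_add hm0, div_eq_inv_mul]
          congr 2; rw [hη]; ring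
        calc _ ≤ ((m:ℝ)^η / η * ((m:ℝ)^(-a))^2) * (1 - (2:ℝ)^(-a))⁻¹ := by
              gcongr
              have := (hlt m hm).trans_lt h2
              exact inv_nonneg.2 (by linarith)
          _ = _ := by rw [h5]; ring
      · simp only [hm, if_false, tsum_zero]
        have : (0:ℝ) < 1 - (2:ℝ)^(-a) := by linarith
        positivity
  let S : Set ℕ := {n | IsPrimePow n ∧ ¬ n.Prime}
  have key : Summable (fun n : S => ArithmeticFunction.vonMangoldt (n:ℕ) * ((n:ℕ):ℝ)^(-a)) := by
    have hex : ∀ n : S, ∃ q : ℕ × ℕ, q.1.Prime ∧ q.1 ^ (q.2+2) = (n:ℕ) := by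
      rintro ⟨n, hn, hn'⟩
      obtain ⟨p, k, hp, hk, rfl⟩ := (isPrimePow_nat_iff _).1 hn
      refine ⟨(p, k-2), hp, ?_⟩
      have : k ≠ 1 := by rintro rfl; exact hn' (by simpa using hp)
      show p ^ (k-2+2) = p^k
      congr 1; omega
    choose f hf1 hf2 using hex
    have hinj : Function.Injective f := by
      intro x y h
      apply Subtype.ext
      rw [← hf2 x, ← hf2 y, h]
    have := hF.comp_injective hinj
    refine this.congr fun n => ?_
    simp only [Function.comp, (hf1 n).two_le, if_true]
    rw [← hf2 n, ArithmeticFunction.vonMangoldt_apply_pow (by omega), ArithmeticFunction.vonMangoldt_apply_prime (hf1 n)]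
    congr 1
    push_cast
    rw [← Real.rpow_natCast, ← Real.rpow_natCast, ← Real.rpow_mul (by positivity), ← Real.rpow_mul (by positivity)]
    congr 1; ring
  rw [← Function.Injective.summable_iff (g := ((↑) : S → ℕ)) Subtype.val_injective] at *
  · refine key.congr fun n => ?_
    simp [n.2.2]
  · intro n hn
    simp only [Subtype.range_coe_subtype, Set.mem_setOf_eq, S] at hn
    split_ifs with h
    · rfl
    · have : ¬ IsPrimePow n := fun h' => hn ⟨h', h⟩
      rw [ArithmeticFunction.vonMangoldt_eq_zero_iff.2 this, zero_mul]

lemma summ_Phi (a C : ℝ) (ha : 1/2 < a) (Φ : ℝ → ℂ) (hC : ∀ x, 0 ≤ x → ‖Φ x‖ ≤ C * Real.exp (-a * x))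
    (hs : Summable (fun n : ℕ => if n.Prime then ‖Φ (Real.log n)‖ else 0)) (z : ℂ) (hz : 0 < z.re) :
    LSeriesSummable (fun n => (ArithmeticFunction.vonMangoldt n : ℂ) * Φ (Real.log n)) z := by
  unfold LSeriesSummable
  have h1 := (hs.mul_left (z.re)⁻¹).add ((summ_pp a ha).mul_left C)
  refine Summable.of_norm_bounded h1 fun n => ?_
  rcases Nat.eq_zero_or_pos n with rfl | hn
  · simp [Nat.not_prime_zero]
  have hn0 : (0:ℝ) < n := by exact_mod_cast hn
  have hn1 : (1:ℝ) ≤ n := by exact_mod_cast hn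
  rw [LSeries.norm_term_eq, if_neg hn.ne', norm_mul]
  have hL : ‖(ArithmeticFunction.vonMangoldt n : ℂ)‖ = ArithmeticFunction.vonMangoldt n := by
    rw [Complex.norm_real, Real.norm_of_nonneg ArithmeticFunction.vonMangoldt_nonneg]
  rw [hL]
  have hp : 0 < (n:ℝ)^z.re := by positivity
  by_cases hpr : n.Prime
  · simp only [hpr, if_true, mul_zero, add_zero]
    rw [ArithmeticFunction.vonMangoldt_apply_prime hpr, div_le_iff₀ hp]
    have := Real.log_le_rpow_div hn0.le hz
    calc Real.log n * ‖Φ (Real.log n)‖ ≤ (n:ℝ)^z.re / z.re * ‖Φ (Real.log n)‖ := by gcongr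
      _ = _ := by ring
  · simp only [hpr, if_false, mul_zero, zero_add]
    have h3 := hC (Real.log n) (Real.log_nonneg hn1)
    have h4 : Real.exp (-a * Real.log n) = (n:ℝ)^(-a) := by
      rw [Real.rpow_def_of_pos hn0]; ring_nf
    rw [h4] at h3
    have h5 : 1 ≤ (n:ℝ)^z.re := Real.one_le_rpow hn1 hz.le
    calc _ ≤ ArithmeticFunction.vonMangoldt n * ‖Φ (Real.log n)‖ := 
          div_le_self (mul_nonneg ArithmeticFunction.vonMangoldt_nonneg (norm_nonneg _)) h5
      _ ≤ ArithmeticFunction.vonMangoldt n * (C * (n:ℝ)^(-a)) := by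
          gcongr
      _ = _ := by ring

end LZ

namespace LZ

lemma rect_compact (a b H : ℝ) : IsCompact (Rect a b H) := by
  have : Rect a b H = Set.Icc a b ×ℂ Set.Icc (-H) H := by
    ext s; simp only [Rect, Set.mem_setOf_eq, Complex.mem_reProdIm, Set.mem_Icc]; tauto
  rw [this]; exact isCompact_Icc.reProdIm isCompact_Icc

lemma hol_meas {O : Set ℂ} (hO : IsOpen O) {k : ℂ → ℂ} (hk : ContinuousOn k O) {σ : ℝ → ℂ}
    (hσ : Measurable σ) (w : ℂ) (hm : ∀ t, σ t - w ∈ O) : Measurable (fun t => k (σ t - w)) := by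
  classical
  have h1 : Measurable (O.piecewise k (fun _ => (0:ℂ))) :=
    hk.measurable_piecewise continuousOn_const hO.measurableSet
  have h2 := h1.comp (hσ.sub_const w)
  convert h2 using 1
  ext t
  simp [Set.piecewise, hm t]

lemma hol_param {O : Set ℂ} (hO : IsOpen O) {k : ℂ → ℂ} (hk : DifferentiableOn ℂ k O)
    {R : Set ℂ} (hR : IsCompact R) {σ h : ℝ → ℂ} (hσ : Measurable σ) (hσR : ∀ t, σ t ∈ R)
    (hh : Integrable h) {W : Set ℂ} (hW : IsOpen W) (hWO : ∀ w ∈ W, ∀ s ∈ R, s - w ∈ O) :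
    (∀ w ∈ W, Integrable (fun t => h t * k (σ t - w))) ∧
    DifferentiableOn ℂ (fun w => ∫ t, h t * k (σ t - w)) W := by
  have hint : ∀ w ∈ W, Integrable (fun t => h t * k (σ t - w)) := by
    intro w hw
    have hc : IsCompact ((fun s => s - w) '' R) := hR.image (by fun_prop)
    have hsub : (fun s => s - w) '' R ⊆ O := by
      rintro _ ⟨s, hs, rfl⟩; exact hWO w hw s hs
    obtain ⟨C, hC⟩ := hc.exists_bound_of_continuousOn (hk.continuousOn.mono hsub)
    have hm := hol_meas hO hk.continuousOn hσ w (fun t => hWO w hw _ (hσR t))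
    exact hh.mul_bdd (c := C) hm.aestronglyMeasurable (ae_of_all _ fun t => hC _ ⟨σ t, hσR t, rfl⟩)
  refine ⟨hint, ?_⟩
  intro w0 hw0
  obtain ⟨r, hr, hball⟩ := Metric.nhds_basis_closedBall.mem_iff.1 (hW.mem_nhds hw0)
  have hc : IsCompact ((fun q : ℂ × ℂ => q.1 - q.2) '' (R ×ˢ Metric.closedBall w0 r)) :=
    (hR.prod (isCompact_closedBall _ _)).image (by fun_prop)
  have hsub : (fun q : ℂ × ℂ => q.1 - q.2) '' (R ×ˢ Metric.closedBall w0 r) ⊆ O := by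
    rintro _ ⟨⟨s, w⟩, ⟨hs, hw⟩, rfl⟩; exact hWO w (hball hw) s hs
  have hd : ContinuousOn (deriv k) O := (hk.deriv hO).continuousOn
  obtain ⟨C, hC⟩ := hc.exists_bound_of_continuousOn (hd.mono hsub)
  have hm := hol_meas hO hd hσ w0 (fun t => hWO w0 hw0 _ (hσR t))
  have := hasDerivAt_integral_of_dominated_loc_of_deriv_le (μ := volume) (𝕜 := ℂ)
    (F := fun w t => h t * k (σ t - w)) (F' := fun w t => h t * (- deriv k (σ t - w)))
    (x₀ := w0) (s := Metric.ball w0 r) (bound := fun t => ‖h t‖ * C) (Metric.ball_mem_nhds _ hr)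
    (by filter_upwards [hW.mem_nhds hw0] with w hw using (hint w hw).aestronglyMeasurable)
    (hint w0 hw0)
    (hh.aestronglyMeasurable.mul hm.neg.aestronglyMeasurable)
    (ae_of_all _ fun t w hw => by
      rw [norm_mul, norm_neg]
      gcongr
      exact hC _ ⟨(σ t, w), ⟨hσR t, Metric.ball_subset_closedBall hw⟩, rfl⟩)
    (hh.norm.mul_const C)
    (ae_of_all _ fun t w hw => by
      have hin : σ t - w ∈ O := hWO w (hball (Metric.ball_subset_closedBall hw)) _ (hσR t)
      have h1 : HasDerivAt k (deriv k (σ t - w)) (σ t - w) :=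
        (hk.differentiableAt (hO.mem_nhds hin)).hasDerivAt
      have h2 : HasDerivAt (fun w => σ t - w) (-1) w := by
        simpa using (hasDerivAt_id w).const_sub (σ t)
      have := (h1.comp w h2).const_mul (h t)
      simpa using this)
  exact this.2.differentiableAt.differentiableWithinAt

def Car (Φ : ℝ → ℂ) (a b H : ℝ) : Prop := ∃ σ h : ℝ → ℂ, Measurable σ ∧ (∀ t, σ t ∈ Rect a b H) ∧
  Integrable h ∧ ∀ x : ℝ, Φ x = ∫ t, h t * cexp (-(x * σ t))

lemma bd_Phi {Φ : ℝ → ℂ} {σ h : ℝ → ℂ} {a b H : ℝ} (hσR : ∀ t, σ t ∈ Rect a b H) (hh : Integrable h)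
    (hΦ : ∀ x : ℝ, Φ x = ∫ t, h t * cexp (-(x * σ t))) (x : ℝ) (hx : 0 ≤ x) :
    ‖Φ x‖ ≤ (∫ t, ‖h t‖) * Real.exp (-a * x) := by
  rw [hΦ, ← integral_mul_const]
  refine norm_integral_le_of_norm_le (hh.norm.mul_const _) (ae_of_all _ fun t => ?_)
  rw [norm_mul, Complex.norm_exp]
  gcongr
  have := (hσR t).1
  simp
  nlinarith

/-- the swapped series -/
lemma G_eq {Φ : ℝ → ℂ} {σ h : ℝ → ℂ} {a b H : ℝ} (hσ : Measurable σ) (hσR : ∀ t, σ t ∈ Rect a b H) (hh : Integrable h)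
    (hΦ : ∀ x : ℝ, Φ x = ∫ t, h t * cexp (-(x * σ t))) (w : ℂ) (hw : w.re < a - 1) :
    LSeries (fun n => (ArithmeticFunction.vonMangoldt n : ℂ) * Φ (Real.log n)) (-w) =
      ∫ t, h t * LSeries (fun n => (ArithmeticFunction.vonMangoldt n : ℂ)) (σ t - w) := by
  have hterm : ∀ n t, h t * LSeries.term (fun n => (ArithmeticFunction.vonMangoldt n : ℂ)) (σ t - w) n
      = LSeries.term (fun n => (ArithmeticFunction.vonMangoldt n : ℂ)) (-w) n * (h t * cexp (-((Real.log n : ℝ) * σ t))) := by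
    intro n t
    rcases Nat.eq_zero_or_pos n with rfl | hn
    · simp
    have hn0 : (n:ℂ) ≠ 0 := by exact_mod_cast hn.ne'
    rw [LSeries.term_of_ne_zero hn.ne', LSeries.term_of_ne_zero hn.ne', sub_eq_add_neg, Complex.cpow_add _ _ hn0,
      Complex.exp_neg, Complex.cpow_def_of_ne_zero hn0 (σ t), Complex.natCast_log]
    field_simp
  have hi0 : ∀ n : ℕ, Integrable (fun t => h t * cexp (-((Real.log n : ℝ) * σ t))) := by
    intro n
    refine hh.mul_bdd (c := Real.exp (-Real.log n * a)) (by fun_prop) (ae_of_all _ fun t => ?_)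
    rw [Complex.norm_exp]
    gcongr
    have := (hσR t).1
    have := Real.log_natCast_nonneg n
    rw [Complex.neg_re, Complex.re_ofReal_mul]
    nlinarith
  have hint : ∀ n, Integrable (fun t => h t * LSeries.term (fun n => (ArithmeticFunction.vonMangoldt n : ℂ)) (σ t - w) n) := by
    intro n
    simp only [hterm]
    exact (hi0 n).const_mul _
  have hLS : ∀ z : ℂ, 1 < z.re → LSeriesSummable (fun n => (ArithmeticFunction.vonMangoldt n : ℂ)) z :=
    fun z hz => ArithmeticFunction.LSeriesSummable_vonMangoldt hz
  have hsum : Summable (fun n => ∫ t, ‖h t * LSeries.term (fun n => (ArithmeticFunction.vonMangoldt n : ℂ)) (σ t - w) n‖) := by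
    have h1 := (hLS (a - w) (by simp; linarith)).norm.mul_left (∫ t, ‖h t‖)
    refine Summable.of_nonneg_of_le (fun n => by positivity) (fun n => ?_) h1
    rw [← integral_mul_const]
    refine integral_mono_of_nonneg (ae_of_all _ fun t => by positivity) (hh.norm.mul_const _) (ae_of_all _ fun t => ?_)
    simp only [norm_mul]
    gcongr
    refine LSeries.norm_term_le_of_re_le_re _ ?_ n
    simpa using (hσR t).1
  have := (hasSum_integral_of_summable_integral_norm hint hsum).tsum_eq
  have e1 : ∀ t, ∑' n, h t * LSeries.term (fun n => (ArithmeticFunction.vonMangoldt n : ℂ)) (σ t - w) n =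
     h t * LSeries (fun n => (ArithmeticFunction.vonMangoldt n : ℂ)) (σ t - w) := by
    intro t; rw [tsum_mul_left]; rfl
  simp only [e1] at this
  rw [← this, LSeries]
  refine tsum_congr fun n => ?_
  simp only [hterm, integral_const_mul]
  rw [← hΦ]
  rcases Nat.eq_zero_or_pos n with rfl | hn
  · simp
  rw [LSeries.term_of_ne_zero hn.ne', LSeries.term_of_ne_zero hn.ne']
  ring

lemma e_exists {Φ : ℝ → ℂ} {σ h : ℝ → ℂ} {a b H H2 B δ : ℝ} {A : ℂ → ℂ} (ha : 1/2 < a) (hb1 : b < 1)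
    (hσ : Measurable σ) (hσR : ∀ t, σ t ∈ Rect a b H) (hh : Integrable h)
    (hΦ : ∀ x : ℝ, Φ x = ∫ t, h t * cexp (-(x * σ t)))
    (hs : Summable (fun n : ℕ => if n.Prime then ‖Φ (Real.log n)‖ else 0))
    (hH2 : H < H2) (hB : H + H2 < B) (hδ : 0 < δ)
    (hA : DifferentiableOn ℂ A {z | 1 - δ < z.re ∧ |z.im| < B})
    (hAL : ∀ z : ℂ, 1 < z.re → |z.im| < B →
      LSeries (fun n => (ArithmeticFunction.vonMangoldt n : ℂ)) z = (z - 1)⁻¹ + A z) :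
    ∃ e : ℂ → ℂ, DifferentiableOn ℂ e {w | w.re < 1 ∧ w.re < a + δ ∧ -H2 < w.im ∧ w.im < H2} ∧
      ∀ w : ℂ, (w.re < 1 ∧ w.re < a + δ ∧ -H2 < w.im ∧ w.im < H2) → (w.re < a ∨ b < w.re ∨ H < w.im ∨ w.im < -H) →
        ∫ t, h t * (σ t - w)⁻¹ = e w := by
  have hab : a ≤ b := (hσR 0).1.trans (hσR 0).2.1
  have hH0 : 0 ≤ H := by have := (hσR 0).2.2; linarith
  set O : Set ℂ := {z | 1 - δ < z.re ∧ |z.im| < B} with hO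
  have hOo : IsOpen O := by
    apply IsOpen.inter
    · exact isOpen_lt continuous_const Complex.continuous_re
    · exact isOpen_lt (Complex.continuous_im.abs) continuous_const
  set V : Set ℂ := {w | w.re < 1 ∧ w.re < a + δ ∧ -H2 < w.im ∧ w.im < H2} with hV
  have c1 : ∀ c : ℝ, Convex ℝ {w : ℂ | w.re < c} := fun c => convex_halfSpace_re_lt c
  have c2 : ∀ c : ℝ, Convex ℝ {w : ℂ | w.im < c} := fun c => convex_halfSpace_im_lt c
  have c3 : ∀ c : ℝ, Convex ℝ {w : ℂ | c < w.im} := fun c => convex_halfSpace_im_gt c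
  have c4 : ∀ c : ℝ, Convex ℝ {w : ℂ | c < w.re} := fun c => convex_halfSpace_re_gt c
  have o1 : ∀ c : ℝ, IsOpen {w : ℂ | w.re < c} := fun c => isOpen_lt Complex.continuous_re continuous_const
  have o2 : ∀ c : ℝ, IsOpen {w : ℂ | w.im < c} := fun c => isOpen_lt Complex.continuous_im continuous_const
  have o3 : ∀ c : ℝ, IsOpen {w : ℂ | c < w.im} := fun c => isOpen_lt continuous_const Complex.continuous_im
  have o4 : ∀ c : ℝ, IsOpen {w : ℂ | c < w.re} := fun c => isOpen_lt continuous_const Complex.continuous_re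
  have hVc : Convex ℝ V := (c1 1).inter ((c1 (a+δ)).inter ((c3 (-H2)).inter (c2 H2)))
  have hVo : IsOpen V := (o1 1).inter ((o1 (a+δ)).inter ((o3 (-H2)).inter (o2 H2)))
  -- J
  have hVO : ∀ w ∈ V, ∀ s ∈ Rect a b H, s - (w - 1) ∈ O := by
    rintro w ⟨h1, h2, h3, h4⟩ s ⟨h5, h6, h7, h8⟩
    refine ⟨by simp; linarith, ?_⟩
    rw [abs_lt]; simp; constructor <;> linarith
  have hJ := hol_param hOo hA (rect_compact a b H) hσ hσR hh
    (W := (fun w => w + 1) ⁻¹' V) (hVo.preimage (by fun_prop))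
    (fun w hw s hs => by simpa using hVO (w+1) hw s hs)
  set f : ℕ → ℂ := fun n => (ArithmeticFunction.vonMangoldt n : ℂ) * Φ (Real.log n) with hf
  have hG : DifferentiableOn ℂ (fun w => LSeries f (-(w - 1))) V := by
    have h1 := LSeries_differentiableOn f
    refine h1.comp (by fun_prop) ?_
    rintro w ⟨hw, -⟩
    have h0 : LSeries.abscissaOfAbsConv f ≤ (0:ℝ) := by
      apply LSeries.abscissaOfAbsConv_le_of_forall_lt_LSeriesSummable
      intro y hy
      exact summ_Phi a _ ha Φ (bd_Phi hσR hh hΦ) hs y (by simpa using hy)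
    refine lt_of_le_of_lt h0 ?_
    have : (0:ℝ) < (-(w-1)).re := by simp; linarith
    exact_mod_cast this
  have he : DifferentiableOn ℂ (fun w => LSeries f (-(w - 1)) - ∫ t, h t * A (σ t - (w - 1))) V := by
    refine hG.sub ?_
    exact hJ.2.comp (f := fun w : ℂ => w - 1) (by fun_prop) (fun w hw => by simpa using hw)
  -- c is differentiable off the rectangle
  have hc : ∀ W : Set ℂ, IsOpen W → (∀ w ∈ W, w.re < a ∨ b < w.re ∨ H < w.im ∨ w.im < -H) →
      DifferentiableOn ℂ (fun w => ∫ t, h t * (σ t - w)⁻¹) W ∧ ∀ w ∈ W, Integrable (fun t => h t * (σ t - w)⁻¹) := by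
    intro W hW hWW
    have := hol_param (O := {z : ℂ | z ≠ 0}) isOpen_ne (k := fun z => z⁻¹)
      (fun z hz => (differentiableAt_inv hz).differentiableWithinAt) (rect_compact a b H) hσ hσR hh hW
      (fun w hw s hs h0 => by
        have : s = w := sub_eq_zero.1 h0
        subst this
        obtain ⟨h5, h6, h7, h8⟩ := hs
        rcases hWW s hw with h | h | h | h <;> linarith)
    exact ⟨this.2, this.1⟩
  have base : ∀ w ∈ V, w.re < a → ∫ t, h t * (σ t - w)⁻¹ = LSeries f (-(w - 1)) - ∫ t, h t * A (σ t - (w - 1)) := by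
    intro w hw hwa
    rw [G_eq hσ hσR hh hΦ (w-1) (by simp; linarith), eq_sub_iff_add_eq]
    have i1 := (hc {w | w.re < a} (o1 a) (fun w hw => Or.inl hw)).2 w hwa
    have i2 := hJ.1 (w - 1) (by simpa using hw)
    rw [← integral_add i1 i2]
    refine integral_congr_ae (ae_of_all _ fun t => ?_)
    have hst := hσR t
    obtain ⟨h5, h6, h7, h8⟩ := hst
    obtain ⟨h1, h2, h3, h4⟩ := hw
    simp only
    rw [hAL (σ t - (w-1)) (by simp; linarith) (by rw [abs_lt]; simp; constructor <;> linarith)]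
    rw [show σ t - (w-1) - 1 = σ t - w by ring]
    ring
  have ident : ∀ W : Set ℂ, IsOpen W → Convex ℝ W → W ⊆ V → (∀ w ∈ W, w.re < a ∨ b < w.re ∨ H < w.im ∨ w.im < -H) →
      (∃ z ∈ W, ∀ᶠ w in nhds z, ∫ t, h t * (σ t - w)⁻¹ = LSeries f (-(w - 1)) - ∫ t, h t * A (σ t - (w - 1))) →
      ∀ w ∈ W, ∫ t, h t * (σ t - w)⁻¹ = LSeries f (-(w - 1)) - ∫ t, h t * A (σ t - (w - 1)) := by
    rintro W hWo hWc hWV hWW ⟨z, hz, hev⟩ w hw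
    have a1 := (hc W hWo hWW).1.analyticOnNhd hWo
    have a2 := (he.mono hWV).analyticOnNhd hWo
    exact a1.eqOn_of_preconnected_of_eventuallyEq a2 hWc.isPreconnected hz hev hw
  have hz0 : ∀ y : ℝ, -H2 < y → y < H2 → ∀ᶠ w in nhds ((a - 1 : ℝ) + y * I : ℂ), ∫ t, h t * (σ t - w)⁻¹ = LSeries f (-(w - 1)) - ∫ t, h t * A (σ t - (w - 1)) := by
    intro y h1 h2
    have hm : ((a - 1 : ℝ) + y * I : ℂ) ∈ V ∩ {w | w.re < a} := by
      refine ⟨⟨?_, ?_, ?_, ?_⟩, ?_⟩ <;> simp <;> linarith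
    filter_upwards [(hVo.inter (o1 a)).mem_nhds hm] with w hw using base w hw.1 hw.2
  have up : ∀ w ∈ V, H < w.im → ∫ t, h t * (σ t - w)⁻¹ = LSeries f (-(w - 1)) - ∫ t, h t * A (σ t - (w - 1)) := by
    intro w hw hwH
    refine ident (V ∩ {w | H < w.im}) (hVo.inter (o3 H)) (hVc.inter (c3 H)) Set.inter_subset_left
      (fun w hw => Or.inr (Or.inr (Or.inl hw.2))) ⟨_, ⟨⟨?_, ?_, ?_, ?_⟩, ?_⟩, hz0 ((H+H2)/2) (by linarith) (by linarith)⟩ w ⟨hw, hwH⟩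
      <;> simp <;> linarith
  have dn : ∀ w ∈ V, w.im < -H → ∫ t, h t * (σ t - w)⁻¹ = LSeries f (-(w - 1)) - ∫ t, h t * A (σ t - (w - 1)) := by
    intro w hw hwH
    refine ident (V ∩ {w | w.im < -H}) (hVo.inter (o2 (-H))) (hVc.inter (c2 (-H))) Set.inter_subset_left
      (fun w hw => Or.inr (Or.inr (Or.inr hw.2))) ⟨_, ⟨⟨?_, ?_, ?_, ?_⟩, ?_⟩, hz0 (-((H+H2)/2)) (by linarith) (by linarith)⟩ w ⟨hw, hwH⟩
      <;> simp <;> linarith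
  refine ⟨_, he, ?_⟩
  rintro w hw (h1 | h1 | h1 | h1)
  · exact base w hw h1
  · have hm : ((w.re:ℂ) + ((H+H2)/2 : ℝ) * I : ℂ) ∈ (V ∩ {w | b < w.re}) ∩ {w | H < w.im} := by
      obtain ⟨h2, h3, h4, h5⟩ := hw
      refine ⟨⟨⟨?_, ?_, ?_, ?_⟩, ?_⟩, ?_⟩ <;> simp <;> linarith
    refine ident (V ∩ {w | b < w.re}) (hVo.inter (o4 b)) (hVc.inter (c4 b)) Set.inter_subset_left
      (fun w hw => Or.inr (Or.inl hw.2)) ⟨_, hm.1, ?_⟩ w ⟨hw, h1⟩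
    filter_upwards [(hVo.inter (o3 H)).mem_nhds ⟨hm.1.1, hm.2⟩] with w hw using up w hw.1 hw.2
  · exact up w hw h1
  · exact dn w hw h1

end LZ

namespace LZ

lemma edge_swap {σ h : ℝ → ℂ} {a b H : ℝ} (hσ : Measurable σ) (hσR : ∀ t, σ t ∈ Rect a b H) (hh : Integrable h)
    {l : ℝ → ℂ} (hl : Continuous l) {E : ℂ → ℂ} (hE : Continuous E) {c d r : ℝ} (hr : 0 < r) (hcd : c ≤ d)
    (hlr : ∀ y ∈ Set.Icc c d, ∀ s ∈ Rect a b H, r ≤ ‖s - l y‖) :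
    Integrable (fun t => h t * ∫ y in c..d, (σ t - l y)⁻¹ * E (l y)) ∧
    ∫ y in c..d, (∫ t, h t * (σ t - l y)⁻¹) * E (l y) = ∫ t, h t * ∫ y in c..d, (σ t - l y)⁻¹ * E (l y) := by
  obtain ⟨C, hC⟩ := (isCompact_Icc (a := c) (b := d)).exists_bound_of_continuousOn (hE.comp hl).continuousOn
  have hm : Measurable (fun q : ℝ × ℝ => (σ q.2 - l q.1)⁻¹ * E (l q.1)) := by
    have := hE.measurable; have := hl.measurable
    fun_prop
  haveI : IsFiniteMeasure (volume.restrict (Set.uIoc c d)) := by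
    rw [Set.uIoc_of_le hcd]; infer_instance
  have hI : Integrable (Function.uncurry (fun y t => h t * ((σ t - l y)⁻¹ * E (l y))))
      ((volume.restrict (Set.uIoc c d)).prod volume) := by
    have h1 : Integrable (fun q : ℝ × ℝ => h q.2) ((volume.restrict (Set.uIoc c d)).prod volume) :=
      hh.comp_snd _
    have : Function.uncurry (fun y t => h t * ((σ t - l y)⁻¹ * E (l y))) =
       fun q : ℝ × ℝ => h q.2 * ((σ q.2 - l q.1)⁻¹ * E (l q.1)) := by ext ⟨y, t⟩; rfl
    rw [this]
    refine h1.mul_bdd (c := r⁻¹ * C) hm.aestronglyMeasurable ?_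
    have : ∀ᵐ q : ℝ × ℝ ∂((volume.restrict (Set.uIoc c d)).prod volume), q.1 ∈ Set.uIoc c d := by
      have h0 : ∀ᵐ y ∂(volume.restrict (Set.uIoc c d)), y ∈ Set.uIoc c d := ae_restrict_mem measurableSet_uIoc
      exact Measure.quasiMeasurePreserving_fst.ae h0
    filter_upwards [this] with q hq
    rw [Set.uIoc_of_le hcd] at hq
    have hq' := Set.Ioc_subset_Icc_self hq
    rw [norm_mul, norm_inv]
    have := hlr _ hq' _ (hσR q.2)
    have h3 := hC _ hq'
    simp only [Function.comp] at h3
    gcongr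
  have hsw := intervalIntegral_integral_swap hI
  have e1 : ∀ t, ∫ y in c..d, h t * ((σ t - l y)⁻¹ * E (l y)) = h t * ∫ y in c..d, (σ t - l y)⁻¹ * E (l y) :=
    fun t => intervalIntegral.integral_const_mul _ _
  constructor
  · have := hI.integral_prod_right
    simp only [Function.uncurry] at this
    refine this.congr (ae_of_all _ fun t => ?_)
    simp only
    rw [← e1, intervalIntegral.integral_of_le hcd, Set.uIoc_of_le hcd]
  · simp only [e1] at hsw
    rw [← hsw]
    refine intervalIntegral.integral_congr fun y _ => ?_
    simp only [← mul_assoc]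
    exact (integral_mul_const _ _).symm

lemma int4 {f₁ f₂ f₃ f₄ : ℝ → ℂ} (h1 : Integrable f₁) (h2 : Integrable f₂) (h3 : Integrable f₃) (h4 : Integrable f₄) :
    (∫ t, f₁ t) - (∫ t, f₂ t) + I * (∫ t, f₃ t) - I * ∫ t, f₄ t = ∫ t, (f₁ t - f₂ t + I * f₃ t - I * f₄ t) := by
  have e1 : ∫ t, (f₁ t - f₂ t + I * f₃ t - I * f₄ t) = (∫ t, (f₁ t - f₂ t + I * f₃ t)) - ∫ t, I * f₄ t :=
    integral_sub ((h1.sub h2).add (h3.const_mul _)) (h4.const_mul _)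
  have e2 : ∫ t, (f₁ t - f₂ t + I * f₃ t) = (∫ t, (f₁ t - f₂ t)) + ∫ t, I * f₃ t :=
    integral_add (h1.sub h2) (h3.const_mul _)
  rw [e1, e2, integral_sub h1 h2, integral_const_mul, integral_const_mul]

lemma rep {σ h : ℝ → ℂ} {a b H a' b' H' : ℝ} (hσ : Measurable σ) (hσR : ∀ t, σ t ∈ Rect a b H) (hh : Integrable h)
    (ha : a' < a) (hb : b < b') (hH : H < H') {E : ℂ → ℂ} (hE : Differentiable ℂ E) :
    BI a' b' H' (fun w => (∫ t, h t * (σ t - w)⁻¹) * E w) = -(2 * π * I) * ∫ t, h t * E (σ t) := by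
  have hab : a ≤ b := (hσR 0).1.trans (hσR 0).2.1
  have hH0 : 0 ≤ H := by have := (hσR 0).2.2; linarith
  have h1 := edge_swap hσ hσR hh (l := fun x : ℝ => x + ((-H' : ℝ) : ℂ) * I) (by fun_prop) hE.continuous
    (c := a') (d := b') (r := H' - H) (by linarith) (by linarith) (by
      rintro y - s ⟨h1, h2, h3, h4⟩
      refine le_trans ?_ (Complex.abs_im_le_norm _)
      refine le_trans ?_ (le_abs_self _)
      simp; linarith)
  have h2 := edge_swap hσ hσR hh (l := fun x : ℝ => x + (H' : ℂ) * I) (by fun_prop) hE.continuous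
    (c := a') (d := b') (r := H' - H) (by linarith) (by linarith) (by
      rintro y - s ⟨h1, h2, h3, h4⟩
      refine le_trans ?_ (Complex.abs_im_le_norm _)
      refine le_trans ?_ (neg_le_abs _)
      simp; linarith)
  have h3 := edge_swap hσ hσR hh (l := fun y : ℝ => (b' : ℂ) + y * I) (by fun_prop) hE.continuous
    (c := -H') (d := H') (r := b' - b) (by linarith) (by linarith) (by
      rintro y - s ⟨h1, h2, h3, h4⟩
      refine le_trans ?_ (Complex.abs_re_le_norm _)
      refine le_trans ?_ (neg_le_abs _)
      simp; linarith)
  have h4 := edge_swap hσ hσR hh (l := fun y : ℝ => (a' : ℂ) + y * I) (by fun_prop) hE.continuous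
    (c := -H') (d := H') (r := a - a') (by linarith) (by linarith) (by
      rintro y - s ⟨h1, h2, h3, h4⟩
      refine le_trans ?_ (Complex.abs_re_le_norm _)
      refine le_trans ?_ (le_abs_self _)
      simp; linarith)
  have hB : ∀ t, BI a' b' H' (fun w => (σ t - w)⁻¹ * E w) = -(2 * π * I) * E (σ t) := by
    intro t
    obtain ⟨g1, g2, g3, g4⟩ := hσR t
    have := BI_cauchy (a := a') (b := b') (H := H') (s := σ t) (by linarith) (by linarith) (by linarith) (by linarith)
      (f := fun w => - E w) hE.neg.differentiableOn
    rw [show (fun w => (σ t - w)⁻¹ * E w) = (fun w => - E w * (w - σ t)⁻¹) from ?_, this]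
    · ring
    · ext w; rw [← neg_sub w, inv_neg]; ring
  rw [BI, BI4, h1.2, h2.2, h3.2, h4.2, ← integral_const_mul]
  simp only [smul_eq_mul]
  rw [int4 h1.1 h2.1 h3.1 h4.1]
  refine integral_congr_ae (ae_of_all _ fun t => ?_)
  have := hB t
  simp only [BI, BI4, smul_eq_mul] at this
  simp only
  linear_combination (h t) * this

lemma c_diff {σ h : ℝ → ℂ} {a b H : ℝ} (hσ : Measurable σ) (hσR : ∀ t, σ t ∈ Rect a b H) (hh : Integrable h) :
    ContinuousOn (fun w => ∫ t, h t * (σ t - w)⁻¹) {w | w.re < a ∨ b < w.re ∨ H < w.im ∨ w.im < -H} := by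
  have hW : IsOpen {w : ℂ | w.re < a ∨ b < w.re ∨ H < w.im ∨ w.im < -H} := by
    refine IsOpen.union ?_ (IsOpen.union ?_ (IsOpen.union ?_ ?_))
    · exact isOpen_lt Complex.continuous_re continuous_const
    · exact isOpen_lt continuous_const Complex.continuous_re
    · exact isOpen_lt continuous_const Complex.continuous_im
    · exact isOpen_lt Complex.continuous_im continuous_const
  refine (hol_param (O := {z : ℂ | z ≠ 0}) isOpen_ne (k := fun z => z⁻¹)
      (fun z hz => (differentiableAt_inv hz).differentiableWithinAt) (rect_compact a b H) hσ hσR hh hW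
      (fun w hw s hs h0 => by
        have : s = w := sub_eq_zero.1 h0
        subst this
        obtain ⟨h5, h6, h7, h8⟩ := hs
        rcases hw with h | h | h | h <;> linarith)).2.continuousOn

lemma step {Φ : ℝ → ℂ} {a b H H2 B δ a' b' H' : ℝ} {A : ℂ → ℂ} (ha : 1/2 < a) (hb1 : b < 1)
    (hΦ : Car Φ a b H)
    (hs : Summable (fun n : ℕ => if n.Prime then ‖Φ (Real.log n)‖ else 0))
    (hH2 : H < H2) (hB : H + H2 < B) (hδ : 0 < δ)
    (hA : DifferentiableOn ℂ A {z | 1 - δ < z.re ∧ |z.im| < B})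
    (hAL : ∀ z : ℂ, 1 < z.re → |z.im| < B →
      LSeries (fun n => (ArithmeticFunction.vonMangoldt n : ℂ)) z = (z - 1)⁻¹ + A z)
    (haa : a < a') (haδ : a' < a + δ) (ha1 : a' < 1) (hbb : b < b') (hab' : a' ≤ b') (hHH : H < H') (hHH2 : H' < H2) :
    Car Φ a' b' H' := by
  obtain ⟨σ, h, hσ, hσR, hh, hΦ⟩ := hΦ
  obtain ⟨e, he, hce⟩ := e_exists ha hb1 hσ hσR hh hΦ hs hH2 hB hδ hA hAL
  have hab : a ≤ b := (hσR 0).1.trans (hσR 0).2.1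
  have hH0 : 0 ≤ H := by have := (hσR 0).2.2; linarith
  set c : ℂ → ℂ := fun w => ∫ t, h t * (σ t - w)⁻¹ with hc
  have hcc : ContinuousOn c {w | w.re < a ∨ b < w.re ∨ H < w.im ∨ w.im < -H} := c_diff hσ hσR hh
  have hce' : ∀ w : ℂ, (w.re < 1 ∧ w.re < a + δ ∧ -H2 < w.im ∧ w.im < H2) → (w.re < a ∨ b < w.re ∨ H < w.im ∨ w.im < -H) →
    c w = e w := hce
  have key : ∀ E : ℂ → ℂ, Differentiable ℂ E → ∫ t, h t * E (σ t) =
      -(2 * π * I)⁻¹ * ∫ t in (0:ℝ)..4, LZ.hh a' b' H' c c c e t * E (gam a' b' H' t) ∧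
      IntervalIntegrable (fun t => LZ.hh a' b' H' c c c e t * E (gam a' b' H' t)) volume 0 4 := by
    intro E hE
    have k1 : BI (a-1) b' H' (fun w => c w * E w) = -(2 * π * I) * ∫ t, h t * E (σ t) := rep hσ hσR hh (a' := a - 1) (b' := b') (H' := H') (by linarith) hbb hHH hE
    have k2 := BI_zero (a := a - 1) (b := a') (H := H') (f := fun w => e w * E w) (by linarith) (by linarith)
      (DifferentiableOn.mul (he.mono (by
        rintro w ⟨h1, h2, h3, h4⟩
        refine ⟨?_, ?_, ?_, ?_⟩ <;> linarith)) hE.differentiableOn)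
    have cE := hE.continuous
    -- bottom continuity
    have cb : ∀ p q : ℝ, ContinuousOn (fun x : ℝ => c (x + ((-H' : ℝ) : ℂ) * I) * E (x + ((-H' : ℝ) : ℂ) * I)) (Set.Icc p q) := by
      intro p q
      refine ContinuousOn.mul (hcc.comp (by fun_prop) ?_) (by fun_prop)
      intro x hx; right; right; right; simp; linarith
    have ct : ∀ p q : ℝ, ContinuousOn (fun x : ℝ => c (x + (H' : ℂ) * I) * E (x + (H' : ℂ) * I)) (Set.Icc p q) := by
      intro p q
      refine ContinuousOn.mul (hcc.comp (by fun_prop) ?_) (by fun_prop)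
      intro x hx; right; right; left; simp; linarith
    have cr : ContinuousOn (fun y : ℝ => c ((b' : ℂ) + y * I) * E ((b' : ℂ) + y * I)) (Set.Icc (-H') H') := by
      refine ContinuousOn.mul (hcc.comp (by fun_prop) ?_) (by fun_prop)
      intro x hx; right; left; simp; linarith
    have cl : ContinuousOn (fun y : ℝ => e ((a' : ℂ) + y * I) * E ((a' : ℂ) + y * I)) (Set.Icc (-H') H') := by
      refine ContinuousOn.mul (he.continuousOn.comp (by fun_prop) ?_) (by fun_prop)
      intro x hx; refine ⟨?_, ?_, ?_, ?_⟩ <;> simp <;> linarith [hx.1, hx.2]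
    have k3 := hh_int (a := a') (b := b') (H := H') hab' (by linarith) (f₁ := fun w => c w * E w) (f₂ := fun w => c w * E w)
      (f₃ := fun w => c w * E w) (f₄ := fun w => e w * E w) (cb _ _) cr (ct _ _) cl
    have k4 : LZ.hh a' b' H' (fun w => c w * E w) (fun w => c w * E w) (fun w => c w * E w) (fun w => e w * E w)
        = fun t => LZ.hh a' b' H' c c c e t * E (gam a' b' H' t) := by
      ext t
      unfold LZ.hh
      split_ifs <;> ring
    rw [k4] at k3
    refine ⟨?_, k3.1⟩
    have eb : ∫ x : ℝ in (a-1)..a', e (x + ((-H' : ℝ) : ℂ) * I) * E (x + ((-H' : ℝ) : ℂ) * I) =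
        ∫ x : ℝ in (a-1)..a', c (x + ((-H' : ℝ) : ℂ) * I) * E (x + ((-H' : ℝ) : ℂ) * I) := by
      refine intervalIntegral.integral_congr fun x hx => ?_
      rw [Set.uIcc_of_le (by linarith)] at hx
      beta_reduce
      rw [hce']
      · refine ⟨?_, ?_, ?_, ?_⟩ <;> simp <;> linarith [hx.1, hx.2]
      · right; right; right; simp; linarith
    have et : ∫ x : ℝ in (a-1)..a', e (x + (H' : ℂ) * I) * E (x + (H' : ℂ) * I) =
        ∫ x : ℝ in (a-1)..a', c (x + (H' : ℂ) * I) * E (x + (H' : ℂ) * I) := by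
      refine intervalIntegral.integral_congr fun x hx => ?_
      rw [Set.uIcc_of_le (by linarith)] at hx
      beta_reduce
      rw [hce']
      · refine ⟨?_, ?_, ?_, ?_⟩ <;> simp <;> linarith [hx.1, hx.2]
      · right; right; left; simp; linarith
    have el : ∫ y : ℝ in (-H')..H', e (((a-1:ℝ):ℂ) + y * I) * E (((a-1:ℝ):ℂ) + y * I) =
        ∫ y : ℝ in (-H')..H', c (((a-1:ℝ):ℂ) + y * I) * E (((a-1:ℝ):ℂ) + y * I) := by
      refine intervalIntegral.integral_congr fun x hx => ?_
      rw [Set.uIcc_of_le (by linarith)] at hx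
      beta_reduce
      rw [hce']
      · refine ⟨?_, ?_, ?_, ?_⟩ <;> simp <;> linarith [hx.1, hx.2]
      · left; simp
    have sb := intervalIntegral.integral_add_adjacent_intervals (μ := volume)
      ((cb (a-1) a').intervalIntegrable_of_Icc (by linarith)) ((cb a' b').intervalIntegrable_of_Icc hab')
    have st := intervalIntegral.integral_add_adjacent_intervals (μ := volume)
      ((ct (a-1) a').intervalIntegrable_of_Icc (by linarith)) ((ct a' b').intervalIntegrable_of_Icc hab')
    rw [BI, BI4] at k1 k2
    rw [eb, et, el] at k2
    rw [k3.2, BI4]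
    have hpi : (2 * π * I : ℂ) ≠ 0 := by simp [Real.pi_ne_zero]
    rw [← sb, ← st] at k1
    have hX := congrArg₂ (fun p q => p - q) k1 k2
    simp only [sub_zero] at hX
    rw [neg_mul, eq_neg_iff_add_eq_zero, add_comm, ← eq_neg_iff_add_eq_zero, inv_mul_eq_iff_eq_mul₀ hpi, mul_neg, ← neg_mul, ← hX]
    simp only [smul_eq_mul]
    ring
  refine ⟨fun t => gam a' b' H' (max 0 (min 4 t)), (Set.Ioc (0:ℝ) 4).indicator (fun t => -(2 * π * I)⁻¹ * LZ.hh a' b' H' c c c e t),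
    (gam_meas _ _ _).comp (by fun_prop), fun t => gam_mem hab' (by linarith) ⟨le_max_left _ _, ?_⟩, ?_, fun x => ?_⟩
  · exact max_le (by norm_num) (min_le_left _ _)
  · rw [integrable_indicator_iff measurableSet_Ioc]
    have := (key (fun _ => 1) (differentiable_const _)).2
    simp only [mul_one] at this
    exact ((intervalIntegrable_iff_integrableOn_Ioc_of_le (by norm_num)).1 this).const_mul _
  · rw [hΦ, (key (fun w => cexp (-(x * w))) (by fun_prop)).1, intervalIntegral.integral_of_le (by norm_num),
      ← integral_const_mul, ← integral_indicator measurableSet_Ioc]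
    refine integral_congr_ae (ae_of_all _ fun t => ?_)
    by_cases ht : t ∈ Set.Ioc (0:ℝ) 4
    · simp only [Set.indicator_of_mem ht]
      rw [min_eq_right ht.2, max_eq_right ht.1.le]
      ring
    · simp [Set.indicator_of_notMem ht]

lemma fin_step {Φ : ℝ → ℂ} {a b H H2 B δ : ℝ} {A : ℂ → ℂ} (ha : 1/2 < a) (hb1 : b < 1)
    (hΦ : Car Φ a b H)
    (hs : Summable (fun n : ℕ => if n.Prime then ‖Φ (Real.log n)‖ else 0))
    (hH2 : H < H2) (hB : H + H2 < B) (hδ : 0 < δ)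
    (hA : DifferentiableOn ℂ A {z | 1 - δ < z.re ∧ |z.im| < B})
    (hAL : ∀ z : ℂ, 1 < z.re → |z.im| < B →
      LSeries (fun n => (ArithmeticFunction.vonMangoldt n : ℂ)) z = (z - 1)⁻¹ + A z)
    (hbδ : b < a + δ) (x : ℝ) : Φ x = 0 := by
  obtain ⟨σ, h, hσ, hσR, hh, hΦ⟩ := hΦ
  obtain ⟨e, he, hce⟩ := e_exists ha hb1 hσ hσR hh hΦ hs hH2 hB hδ hA hAL
  have hab : a ≤ b := (hσR 0).1.trans (hσR 0).2.1
  have hH0 : 0 ≤ H := by have := (hσR 0).2.2; linarith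
  obtain ⟨b', hb1', hb2'⟩ := exists_between (lt_min hb1 hbδ)
  have hb3 := lt_of_lt_of_le hb2' (min_le_left _ _)
  have hb4 := lt_of_lt_of_le hb2' (min_le_right _ _)
  obtain ⟨H', hH1', hH2'⟩ := exists_between hH2
  set E : ℂ → ℂ := fun w => cexp (-(x * w)) with hE
  have k1 := rep hσ hσR hh (a' := a - 1) (b' := b') (H' := H') (by linarith) hb1' hH1' (E := E) (by rw [hE]; fun_prop)
  have k2 := BI_zero (a := a - 1) (b := b') (H := H') (f := fun w => e w * E w) (by linarith) (by linarith)
      (DifferentiableOn.mul (he.mono (by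
        rintro w ⟨h1, h2, h3, h4⟩
        refine ⟨?_, ?_, ?_, ?_⟩ <;> linarith)) (by rw [hE]; fun_prop))
  have k3 : BI (a-1) b' H' (fun w => (∫ t, h t * (σ t - w)⁻¹) * E w) = BI (a-1) b' H' (fun w => e w * E w) := by
    unfold BI BI4
    congr 1
    · congr 1
      · congr 1
        · refine intervalIntegral.integral_congr fun x hx => ?_
          rw [Set.uIcc_of_le (by linarith)] at hx
          simp only
          rw [hce]
          · refine ⟨?_, ?_, ?_, ?_⟩ <;> simp <;> linarith [hx.1, hx.2]
          · right; right; right; simp; linarith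
        · refine intervalIntegral.integral_congr fun x hx => ?_
          rw [Set.uIcc_of_le (by linarith)] at hx
          simp only
          rw [hce]
          · refine ⟨?_, ?_, ?_, ?_⟩ <;> simp <;> linarith [hx.1, hx.2]
          · right; right; left; simp; linarith
      · congr 1
        refine intervalIntegral.integral_congr fun x hx => ?_
        rw [Set.uIcc_of_le (by linarith)] at hx
        simp only
        rw [hce]
        · refine ⟨?_, ?_, ?_, ?_⟩ <;> simp <;> linarith [hx.1, hx.2]
        · right; left; simp; linarith
    · congr 1
      refine intervalIntegral.integral_congr fun x hx => ?_
      rw [Set.uIcc_of_le (by linarith)] at hx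
      simp only
      rw [hce]
      · refine ⟨?_, ?_, ?_, ?_⟩ <;> simp <;> linarith [hx.1, hx.2]
      · left; simp
  rw [k3, k2] at k1
  rw [hΦ]
  have hpi : (-(2 * π * I) : ℂ) ≠ 0 := by simp [Real.pi_ne_zero]
  exact (mul_eq_zero.1 k1.symm).resolve_left hpi

theorem thmD {Φ : ℝ → ℂ} {a b H : ℝ} (ha : 1/2 < a) (hb1 : b < 1) (hΦ : Car Φ a b H)
    (hs : Summable (fun n : ℕ => if n.Prime then ‖Φ (Real.log n)‖ else 0)) (x : ℝ) : Φ x = 0 := by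
  obtain ⟨δ, hδ, -, A, hA, hAL⟩ := exists_A (2 * H + 5)
  set bm := (b + 1) / 2 with hbm
  have main : ∀ j : ℕ, ∀ a b' H' : ℝ, 1/2 < a → b' < bm → H' < H + 1 → bm ≤ a + j * (δ / 2) → Car Φ a b' H' → Φ x = 0 := by
    intro j
    induction j with
    | zero =>
      intro a b' H' h1 h2 h3 h4 h5
      exact fin_step (H2 := H + 2) h1 (by linarith) h5 hs (by linarith) (by linarith) hδ hA hAL (by push_cast at h4; linarith) x
    | succ j ih =>
      intro a b' H' h1 h2 h3 h4 h5
      rcases lt_or_ge b' (a + δ) with h | h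
      · exact fin_step (H2 := H + 2) h1 (by linarith) h5 hs (by linarith) (by linarith) hδ hA hAL h x
      · refine ih (a + δ/2) ((b' + bm)/2) ((H' + (H+1))/2) (by linarith) (by linarith) (by linarith) (by push_cast at h4; linarith) ?_
        exact step (H2 := H + 2) h1 (by linarith) h5 hs (by linarith) (by linarith) hδ hA hAL (by linarith) (by linarith) (by linarith)
          (by linarith) (by linarith) (by linarith) (by linarith)
  obtain ⟨j, hj⟩ := exists_nat_gt ((bm - a) / (δ / 2))
  refine main j a b H ha (by linarith) (by linarith) ?_ hΦ
  rw [div_lt_iff₀ (by positivity)] at hj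
  linarith

end LZ

namespace LZ

lemma root_le {n : ℕ} (hn : 2 ≤ n) (L : ℂ →ₗ[ℝ] ℝ) {c : ℝ} (hc : |c| ≤ 1 / (n - 1)) :
    ∃ ζ : ℂ, ζ ^ n = 1 ∧ L ζ ≤ L c := by
  by_contra hcon
  push Not at hcon
  have hn' : (2:ℝ) ≤ n := by exact_mod_cast hn
  have hp := Complex.isPrimitiveRoot_exp n (by omega)
  set ω := cexp (2 * π * I / n) with hω
  have hLc : L (c : ℂ) = c * L 1 := by
    have := L.map_smul c 1
    simpa using this
  have h0 : ∑ j ∈ range n, L (ω ^ j) = 0 := by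
    rw [← map_sum, hp.geom_sum_eq_zero (by omega), map_zero]
  have hj : ∀ j, c * L 1 < L (ω ^ j) := by
    intro j
    rw [← hLc]
    exact hcon _ (by rw [← pow_mul, mul_comm, pow_mul, hp.pow_eq_one, one_pow])
  obtain ⟨m, rfl⟩ : ∃ m, n = m + 1 := ⟨n - 1, by omega⟩
  rw [Finset.sum_range_succ'] at h0
  have h1 : (m:ℝ) * (c * L 1) ≤ ∑ k ∈ range m, L (ω ^ (k+1)) := by
    have := Finset.card_nsmul_le_sum (range m) (fun k => L (ω ^ (k+1))) (c * L 1) (fun k _ => (hj (k+1)).le)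
    simpa using this
  have h2 := hj 0
  have h3 := hj 1
  have hm : 1 ≤ m := by omega
  have h1' : (m:ℝ) * (c * L 1) < ∑ k ∈ range m, L (ω ^ (k+1)) := by
    have := Finset.sum_lt_sum_of_nonempty (s := range m) (by simp; omega) (fun k _ => hj (k+1))
    simpa using this
  simp only [pow_zero] at h0 h2
  have hm' : (1:ℝ) ≤ m := by exact_mod_cast hm
  push_cast at hc hn'
  rw [show (m:ℝ) + 1 - 1 = m by ring, le_div_iff₀ (by linarith)] at hc
  have h4 : (m:ℝ) * (c * L 1) < - L 1 := by linarith
  have h5 : |c| ≤ 1 := by nlinarith [abs_nonneg c]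
  have h6 := abs_le.1 h5
  have h7 : -1 ≤ c * m := by nlinarith [neg_abs_le c]
  rcases lt_trichotomy (L 1) 0 with h | h | h
  · nlinarith
  · rw [h] at h2; linarith
  · nlinarith

variable {E : Type*} [NormedAddCommGroup E] [InnerProductSpace ℂ E]

lemma round_lem {n : ℕ} (hn : 2 ≤ n) (u : ℕ → E) (c : ℕ → ℝ) (hc : ∀ m, |c m| ≤ 1 / (n - 1)) (e0 : E) (N k : ℕ) :
    ∃ ζ : ℕ → ℂ, (∀ m, ζ m ^ n = 1) ∧
     ‖e0 + ∑ m ∈ Ico N (N+k), (ζ m - c m) • u m‖ ^ 2 ≤ ‖e0‖ ^ 2 + 4 * ∑ m ∈ Ico N (N+k), ‖u m‖ ^ 2 := by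
  induction k with
  | zero => exact ⟨fun _ => 1, by simp, by simp⟩
  | succ k ih =>
    obtain ⟨ζ, h1, h2⟩ := ih
    set e := e0 + ∑ m ∈ Ico N (N+k), (ζ m - c m) • u m with he
    let L : ℂ →ₗ[ℝ] ℝ := 
      { toFun := fun z => (z * inner ℂ e (u (N+k))).re
        map_add' := fun x y => by simp [add_mul]
        map_smul' := fun r x => by simp [mul_assoc] }
    obtain ⟨ζ', g1, g2⟩ := root_le hn L (hc (N+k))
    refine ⟨Function.update ζ (N+k) ζ', ?_, ?_⟩
    · intro m
      by_cases hm : m = N + k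
      · subst hm; simpa using g1
      · rw [Function.update_of_ne hm]; exact h1 m
    · rw [← add_assoc, Finset.sum_Ico_succ_top (by omega), Finset.sum_Ico_succ_top (by omega)]
      have : ∑ m ∈ Ico N (N+k), (Function.update ζ (N+k) ζ' m - c m) • u m = ∑ m ∈ Ico N (N+k), (ζ m - c m) • u m := by
        refine Finset.sum_congr rfl fun m hm => ?_
        rw [Function.update_of_ne (by simp at hm; omega)]
      rw [this, Function.update_self, ← add_assoc, ← he, norm_add_sq (𝕜 := ℂ), inner_smul_right, norm_smul]
      have g3 : ((ζ' - c (N+k)) * inner ℂ e (u (N+k))).re ≤ 0 := by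
        have : L ζ' ≤ L (c (N+k)) := g2
        simp only [L, LinearMap.coe_mk, AddHom.coe_mk] at this
        rw [sub_mul, Complex.sub_re]; linarith
      have g4 : ‖ζ' - c (N+k)‖ ≤ 2 := by
        have e1 : ‖ζ'‖ = 1 := Complex.norm_eq_one_of_pow_eq_one g1 (by omega)
        have e2 : |c (N+k)| ≤ 1 := by
          refine (hc _).trans ?_
          have hn' : (2:ℝ) ≤ n := by exact_mod_cast hn
          rw [div_le_one (by linarith)]; linarith
        calc _ ≤ ‖ζ'‖ + ‖(c (N+k) : ℂ)‖ := norm_sub_le _ _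
          _ ≤ 2 := by rw [e1, Complex.norm_real, Real.norm_eq_abs]; linarith
      have g5 : (‖ζ' - c (N+k)‖ * ‖u (N+k)‖) ^ 2 ≤ 4 * ‖u (N+k)‖ ^ 2 := by
        rw [mul_pow]; gcongr
        nlinarith [norm_nonneg (ζ' - c (N+k))]
      have g6 : RCLike.re ((ζ' - c (N+k)) * inner ℂ e (u (N+k))) = ((ζ' - c (N+k)) * inner ℂ e (u (N+k))).re := rfl
      rw [g6]
      nlinarith

lemma dens_abs [NormedSpace ℝ E] [IsScalarTower ℝ ℂ E] {n : ℕ} (hn : 2 ≤ n) (u : ℕ → E) (h : E)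
    (hyp : ∀ f : StrongDual ℂ E, Summable (fun m => |(f (u m)).re|) → (f h).re = 0) (N : ℕ) (η : ℝ) (hη : 0 < η) (M : ℕ) :
    ∃ Y, M ≤ Y ∧ ∃ ζ : ℕ → ℂ, (∀ m, ζ m ^ n = 1) ∧
      ‖h - ∑ m ∈ Ico N Y, ζ m • u m‖ ^ 2 ≤ η + 4 * ∑ m ∈ Ico N Y, ‖u m‖ ^ 2 := by
  set κ : ℝ := 1 / (n - 1) with hκ
  have hn' : (2:ℝ) ≤ n := by exact_mod_cast hn
  have hκ0 : 0 < κ := by rw [hκ]; apply one_div_pos.2; linarith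
  let S : Set E := {x | ∃ c : ℕ → ℝ, (∀ m, |c m| ≤ κ) ∧ ∃ Y, (∀ m, Y ≤ m → c m = 0) ∧ x = ∑ m ∈ Ico N Y, (c m : ℂ) • u m}
  have hext : ∀ (c : ℕ → ℝ) (Y Z : ℕ), (∀ m, Y ≤ m → c m = 0) → Y ≤ Z → ∑ m ∈ Ico N Y, (c m : ℂ) • u m = ∑ m ∈ Ico N Z, (c m : ℂ) • u m := by
    intro c Y Z hc hYZ
    refine Finset.sum_subset (Finset.Ico_subset_Ico_right hYZ) fun m hm hm' => ?_
    rw [hc m (by simp at hm hm'; omega)]; simp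
  have hS : Convex ℝ S := by
    rintro x ⟨c, hc, Y, hY, rfl⟩ y ⟨d, hd, Z, hZ, rfl⟩ p q hp hq hpq
    refine ⟨fun m => p * c m + q * d m, fun m => ?_, max Y Z, fun m hm => ?_, ?_⟩
    · calc |p * c m + q * d m| ≤ |p * c m| + |q * d m| := abs_add_le _ _
        _ = p * |c m| + q * |d m| := by rw [abs_mul, abs_mul, abs_of_nonneg hp, abs_of_nonneg hq]
        _ ≤ p * κ + q * κ := by gcongr; exact hc m; exact hd m
        _ = κ := by rw [← add_mul, hpq, one_mul]
    · show p * c m + q * d m = 0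
      rw [hY m ((le_max_left _ _).trans hm), hZ m ((le_max_right _ _).trans hm)]; simp
    · rw [hext c Y (max Y Z) hY (le_max_left _ _), hext d Z (max Y Z) hZ (le_max_right _ _), Finset.smul_sum, Finset.smul_sum,
        ← Finset.sum_add_distrib]
      refine Finset.sum_congr rfl fun m _ => ?_
      rw [← algebraMap_smul ℂ p, ← algebraMap_smul ℂ q, smul_smul, smul_smul, ← add_smul]
      simp
  have hmem : h ∈ closure S := by
    by_contra hcon
    obtain ⟨f, v, hf1, hf2⟩ := RCLike.geometric_hahn_banach_closed_point (𝕜 := ℂ) hS.closure isClosed_closure hcon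
    have h0 : (0:E) ∈ S := ⟨fun _ => 0, by simp [hκ0.le], 0, by simp, by simp⟩
    have hv : 0 < v := by simpa using hf1 0 (subset_closure h0)
    have hsum : Summable (fun m => |(f (u m)).re|) := by
      rw [← summable_nat_add_iff N]
      refine summable_of_sum_range_le (c := v / κ) (fun _ => abs_nonneg _) fun k => ?_
      let c : ℕ → ℝ := fun m => if m < N + k then κ * SignType.sign (f (u m)).re else 0
      have hc : ∀ m, |c m| ≤ κ := by
        intro m; simp only [c]; split_ifs
        · rw [abs_mul, abs_of_pos hκ0]
          have : |((SignType.sign (f (u m)).re : SignType) : ℝ)| ≤ 1 := by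
            rcases SignType.trichotomy (SignType.sign (f (u m)).re) with h | h | h <;> rw [h] <;> simp
          nlinarith
        · simp [hκ0.le]
      have hm : (∑ m ∈ Ico N (N+k), (c m : ℂ) • u m) ∈ S := ⟨c, hc, N + k, fun m hm => by simp [c]; omega, rfl⟩
      have := hf1 _ (subset_closure hm)
      have e1 : RCLike.re (f (∑ m ∈ Ico N (N+k), (c m : ℂ) • u m)) = κ * ∑ i ∈ range k, |(f (u (i + N))).re| := by
        rw [map_sum, map_sum, Finset.sum_Ico_eq_sum_range, Finset.mul_sum]
        simp only [add_tsub_cancel_left]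
        refine Finset.sum_congr rfl fun i hi => ?_
        simp only [Finset.mem_range] at hi
        rw [map_smul, smul_eq_mul, add_comm N i]
        have : RCLike.re ((c (i+N) : ℂ) * f (u (i+N))) = c (i+N) * (f (u (i+N))).re := by
          show ((c (i+N) : ℂ) * f (u (i+N))).re = _
          rw [Complex.re_ofReal_mul]
        rw [this]
        simp only [c]
        rw [if_pos (by omega), mul_assoc, sign_mul_self]
      rw [e1] at this
      rw [le_div_iff₀ hκ0]; linarith
    have := hyp f hsum
    have h3 : v < (f h).re := hf2
    linarith
  obtain ⟨x, ⟨c, hc, Y, hY, rfl⟩, hx⟩ := Metric.mem_closure_iff.1 hmem (Real.sqrt η) (Real.sqrt_pos.2 hη)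
  set Z := max N (max Y M) with hZ
  have hYZ : Y ≤ Z := (le_max_left _ _).trans (le_max_right _ _)
  have hNZ : N ≤ Z := le_max_left _ _
  rw [hext c Y Z hY hYZ] at hx
  obtain ⟨ζ, hζ, hb⟩ := round_lem hn u c hc (∑ m ∈ Ico N Z, (c m : ℂ) • u m - h) N (Z - N)
  rw [show N + (Z - N) = Z by omega] at hb
  refine ⟨Z, (le_max_right _ _).trans (le_max_right _ _), ζ, hζ, ?_⟩
  have e1 : (∑ m ∈ Ico N Z, (c m : ℂ) • u m - h) + ∑ m ∈ Ico N Z, (ζ m - c m) • u m = - (h - ∑ m ∈ Ico N Z, ζ m • u m) := by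
    simp only [sub_smul, Finset.sum_sub_distrib]
    abel
  rw [e1, norm_neg] at hb
  refine hb.trans ?_
  gcongr
  rw [dist_eq_norm, ← norm_neg, neg_sub] at hx
  calc _ ≤ (Real.sqrt η) ^ 2 := by gcongr
    _ = η := Real.sq_sqrt hη.le

end LZ

namespace LZ

lemma carRe {α β H : ℝ} (hab : α ≤ β) (hH : 0 ≤ H) {G : ℝ → ℂ} (hG : IntegrableOn G (Set.Ioc 0 4)) :
    Car (fun x => (((∫ t in Set.Ioc (0:ℝ) 4, G t * cexp (-(x * gam α β H t))).re : ℝ) : ℂ)) α β H := by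
  set cl : ℝ → ℝ := fun t => max 0 (min 4 t) with hcl
  have hclm : Measurable cl := by rw [hcl]; fun_prop
  have hcl1 : ∀ t, cl t ∈ Set.Icc (0:ℝ) 4 := fun t => ⟨le_max_left _ _, max_le (by norm_num) (min_le_left _ _)⟩
  have hcl2 : ∀ t ∈ Set.Ioc (0:ℝ) 4, cl t = t := fun t ht => by
    rw [hcl]; simp only; rw [min_eq_right ht.2, max_eq_right ht.1.le]
  set G1 : ℝ → ℂ := (Set.Ioc (0:ℝ) 4).indicator G with hG1
  have iG1 : Integrable G1 := (integrable_indicator_iff measurableSet_Ioc).2 hG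
  have iG2 : Integrable (fun t => (starRingEnd ℂ) (G1 (-t))) := by
    have := iG1.comp_neg
    exact (Complex.conjCLE.toContinuousLinearMap.integrable_comp this)
  have hG0 : ∀ t, t ≤ 0 → G1 t = 0 := fun t ht => by
    rw [hG1, Set.indicator_of_notMem]; simp; intro h; linarith
  refine ⟨fun t => if 0 < t then gam α β H (cl t) else (starRingEnd ℂ) (gam α β H (cl (-t))),
    fun t => (1/2:ℂ) * G1 t + (1/2:ℂ) * (starRingEnd ℂ) (G1 (-t)), ?_, ?_, (iG1.const_mul _).add (iG2.const_mul _), ?_⟩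
  · refine Measurable.ite measurableSet_Ioi ((gam_meas _ _ _).comp hclm) ?_
    exact Complex.continuous_conj.measurable.comp ((gam_meas _ _ _).comp (hclm.comp measurable_neg))
  · intro t
    beta_reduce
    split_ifs
    · exact gam_mem hab hH (hcl1 t)
    · obtain ⟨h1, h2, h3, h4⟩ := gam_mem hab hH (hcl1 (-t))
      refine ⟨?_, ?_, ?_, ?_⟩ <;> simp <;> linarith
  · intro x
    beta_reduce
    have hE : Continuous (fun t => cexp (-(x * gam α β H t))) := by
      have := gam_cont α β H; fun_prop
    have hEm : Measurable (fun t => cexp (-(x * gam α β H (cl t)))) := (hE.measurable.comp hclm)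
    obtain ⟨C, hC⟩ := (isCompact_Icc (a := (0:ℝ)) (b := 4)).exists_bound_of_continuousOn hE.continuousOn
    have iP : Integrable (fun t => G1 t * cexp (-(x * gam α β H (cl t)))) :=
      iG1.mul_bdd (c := C) hEm.aestronglyMeasurable (ae_of_all _ fun t => hC _ (hcl1 t))
    set P : ℝ → ℂ := fun t => G1 t * cexp (-(x * gam α β H (cl t))) with hP
    have e0 : ∫ t in Set.Ioc (0:ℝ) 4, G t * cexp (-(x * gam α β H t)) = ∫ t, P t := by
      rw [← integral_indicator measurableSet_Ioc]
      refine integral_congr_ae (ae_of_all _ fun t => ?_)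
      by_cases ht : t ∈ Set.Ioc (0:ℝ) 4
      · simp only [Set.indicator_of_mem ht, hP, hG1, hcl2 t ht]
      · simp [Set.indicator_of_notMem ht, hP, hG1]
    rw [e0]
    have e1 : ((∫ t, P t).re : ℂ) = (1/2:ℂ) * (∫ t, P t) + (1/2:ℂ) * ∫ t, (starRingEnd ℂ) (P (-t)) := by
      have := integral_neg_eq_self (μ := volume) (fun t => (starRingEnd ℂ) (P t))
      rw [this, integral_conj, Complex.re_eq_add_conj]; ring
    have iP2 : Integrable (fun t => (starRingEnd ℂ) (P (-t))) :=
      (Complex.conjCLE.toContinuousLinearMap.integrable_comp iP.comp_neg)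
    rw [e1, ← integral_const_mul, ← integral_const_mul, ← integral_add (iP.const_mul _) (iP2.const_mul _)]
    refine integral_congr_ae (ae_of_all _ fun t => ?_)
    simp only [hP]
    rcases lt_or_ge 0 t with ht | ht
    · rw [if_pos ht, hG0 (-t) (by linarith)]; simp; ring
    · rw [if_neg (by linarith), hG0 t ht, map_mul, ← Complex.exp_conj]; simp; ring

/-- `p^{-s}` -/
noncomputable def pw (m : ℕ) (s : ℂ) : ℂ := cexp (-((Real.log m : ℝ) * s))

lemma pw_norm {m : ℕ} (hm : 1 ≤ m) (s : ℂ) : ‖pw m s‖ = (m:ℝ) ^ (-s.re) := by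
  have h0 : (0:ℝ) < m := by exact_mod_cast hm
  rw [pw, Complex.norm_exp, Complex.neg_re, Complex.re_ofReal_mul, Real.rpow_def_of_pos h0]
  ring_nf

lemma pw_norm_le {m : ℕ} (hm : 1 ≤ m) {s : ℂ} {α : ℝ} (h : α ≤ s.re) : ‖pw m s‖ ≤ (m:ℝ) ^ (-α) := by
  rw [pw_norm hm]
  exact Real.rpow_le_rpow_of_exponent_le (by exact_mod_cast hm) (by linarith)

lemma pw_lt {m : ℕ} (hm : 2 ≤ m) {s : ℂ} (h : 1/2 ≤ s.re) : ‖pw m s‖ ≤ 3/4 := by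
  have h1 := pw_norm_le (show 1 ≤ m by omega) h
  have h2 : (m:ℝ)^(-(1/2):ℝ) ≤ (2:ℝ)^(-(1/2):ℝ) :=
    Real.rpow_le_rpow_of_nonpos (by norm_num) (by exact_mod_cast hm) (by norm_num)
  have h3 : (2:ℝ)^(-(1/2):ℝ) ≤ 3/4 := by
    rw [Real.rpow_neg (by norm_num), ← Real.sqrt_eq_rpow]
    rw [inv_le_comm₀ (by positivity) (by norm_num)]
    apply Real.le_sqrt_of_sq_le; norm_num
  linarith

lemma pw_diff (m : ℕ) : Differentiable ℂ (pw m) := by unfold pw; fun_prop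

lemma pw_cont (m : ℕ) : Continuous (pw m) := (pw_diff m).continuous

lemma slit_of {c z : ℂ} (hc : ‖c‖ = 1) (hz : ‖z‖ ≤ 3/4) : 1 - c * z ∈ slitPlane := by
  left
  have : (c*z).re ≤ 3/4 := (Complex.re_le_norm _).trans (by rw [norm_mul, hc, one_mul]; exact hz)
  simp at this ⊢; linarith

end LZ

namespace LZ

noncomputable abbrev mu4 : Measure ℝ := volume.restrict (Set.Ioc (0:ℝ) 4)
noncomputable abbrev L2E := Lp ℂ 2 mu4

lemma memLp_cont {φ : ℝ → ℂ} (h : ContinuousOn φ (Set.Icc 0 4)) : MemLp φ 2 mu4 := by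
  obtain ⟨C, hC⟩ := isCompact_Icc.exists_bound_of_continuousOn h
  refine MemLp.of_bound ?_ C ?_
  · exact (h.mono Set.Ioc_subset_Icc_self).aestronglyMeasurable measurableSet_Ioc
  · exact (ae_restrict_mem measurableSet_Ioc).mono fun t ht => hC t (Set.Ioc_subset_Icc_self ht)

noncomputable def tl {φ : ℝ → ℂ} (h : ContinuousOn φ (Set.Icc 0 4)) : L2E := (memLp_cont h).toLp φ

lemma tl_norm {φ : ℝ → ℂ} (h : ContinuousOn φ (Set.Icc 0 4)) : ‖tl h‖ ^ 2 = ∫ t in (0:ℝ)..4, ‖φ t‖ ^ 2 := by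
  have h1 : ‖tl h‖ ^ 2 = (inner ℂ (tl h) (tl h)).re := by
    rw [inner_self_eq_norm_sq_to_K]; norm_cast
  rw [h1, L2.inner_def, intervalIntegral.integral_of_le (by norm_num)]
  have h2 : ∫ a, inner ℂ ((tl h) a) ((tl h) a) ∂mu4 = ∫ a in Set.Ioc (0:ℝ) 4, ((‖φ a‖^2 : ℝ) : ℂ) := by
    refine integral_congr_ae ?_
    filter_upwards [(memLp_cont h).coeFn_toLp] with t ht
    rw [tl, ht, inner_self_eq_norm_sq_to_K]; norm_cast
  rw [h2, integral_complex_ofReal, Complex.ofReal_re]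

lemma dual_tl (f : StrongDual ℂ L2E) : ∃ G : ℝ → ℂ, IntegrableOn G (Set.Ioc 0 4) ∧
    ∀ (φ : ℝ → ℂ) (h : ContinuousOn φ (Set.Icc 0 4)), f (tl h) = ∫ t in Set.Ioc (0:ℝ) 4, G t * φ t := by
  set g : L2E := (InnerProductSpace.toDual ℂ L2E).symm f with hg
  refine ⟨fun t => (starRingEnd ℂ) (g t), ?_, ?_⟩
  · have : MemLp g 1 mu4 := (Lp.memLp g).mono_exponent (by norm_num)
    have := memLp_one_iff_integrable.1 this
    exact (Complex.conjCLE.toContinuousLinearMap.integrable_comp this)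
  · intro φ h
    rw [← InnerProductSpace.toDual_symm_apply, L2.inner_def]
    refine integral_congr_ae ?_
    filter_upwards [(memLp_cont h).coeFn_toLp] with t ht
    rw [tl, ht]
    simp only [RCLike.inner_apply]
    rw [mul_comm]

lemma int_log_zero {α β H : ℝ} (ha : 1/2 < α) (hab : α ≤ β) (hH : 0 ≤ H) {G : ℝ → ℂ} (hG : IntegrableOn G (Set.Ioc 0 4))
    (h0 : ∀ x : ℝ, (∫ t in Set.Ioc (0:ℝ) 4, G t * cexp (-(x * gam α β H t))).re = 0) (p : ℕ) (hp : 2 ≤ p) :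
    (∫ t in Set.Ioc (0:ℝ) 4, G t * (Complex.log (1 - pw p (gam α β H t)))).re = 0 := by
  have hgc := gam_cont α β H
  have hpc : Continuous (fun t => pw p (gam α β H t)) := (pw_cont p).comp hgc
  have hb : ∀ t ∈ Set.Ioc (0:ℝ) 4, ‖pw p (gam α β H t)‖ ≤ 3/4 := fun t ht =>
    pw_lt hp (by have := (gam_mem hab hH (Set.Ioc_subset_Icc_self ht)).1; linarith)
  have hbn : ∀ (n : ℕ), ∀ t ∈ Set.Ioc (0:ℝ) 4, ‖pw p (gam α β H t) ^ n / n‖ ≤ (3/4) ^ n := by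
    intro n t ht
    rcases Nat.eq_zero_or_pos n with rfl | hn
    · simp
    rw [norm_div, norm_pow, Complex.norm_natCast]
    have : (1:ℝ) ≤ n := by exact_mod_cast hn
    calc _ ≤ ‖pw p (gam α β H t)‖ ^ n := div_le_self (by positivity) this
      _ ≤ _ := by gcongr; exact hb t ht
  have hint : ∀ n : ℕ, Integrable (fun t => G t * (pw p (gam α β H t) ^ n / n)) mu4 := by
    intro n
    refine Integrable.mul_bdd (c := (3/4:ℝ)^n) hG ((hpc.pow n).div_const _).aestronglyMeasurable ?_
    exact (ae_restrict_mem measurableSet_Ioc).mono fun t ht => hbn n t ht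
  have hsum : Summable (fun n : ℕ => ∫ t, ‖G t * (pw p (gam α β H t) ^ n / n)‖ ∂mu4) := by
    have h1 := (summable_geometric_of_lt_one (r := (3/4:ℝ)) (by norm_num) (by norm_num)).mul_left (∫ t, ‖G t‖ ∂mu4)
    refine Summable.of_nonneg_of_le (fun n => by positivity) (fun n => ?_) h1
    rw [← integral_mul_const]
    refine integral_mono_ae (hint n).norm (hG.norm.mul_const _) ?_
    refine (ae_restrict_mem measurableSet_Ioc).mono fun t ht => ?_
    simp only [norm_mul]
    gcongr
    exact hbn n t ht
  have hs := hasSum_integral_of_summable_integral_norm hint hsum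
  have e1 : ∫ t, ∑' n : ℕ, G t * (pw p (gam α β H t) ^ n / n) ∂mu4 = ∫ t in Set.Ioc (0:ℝ) 4, -(G t * (Complex.log (1 - pw p (gam α β H t)))) := by
    refine setIntegral_congr_fun measurableSet_Ioc fun t ht => ?_
    beta_reduce
    rw [tsum_mul_left, (Complex.hasSum_taylorSeries_neg_log (lt_of_le_of_lt (hb t ht) (by norm_num))).tsum_eq, mul_neg]
  rw [e1, integral_neg] at hs
  have hz : ∀ n : ℕ, (∫ t, G t * (pw p (gam α β H t) ^ n / n) ∂mu4).re = 0 := by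
    intro n
    have : ∫ t, G t * (pw p (gam α β H t) ^ n / n) ∂mu4 = ((1/n : ℝ) : ℂ) * ∫ t in Set.Ioc (0:ℝ) 4, G t * cexp (-((n * Real.log p : ℝ) * gam α β H t)) := by
      rw [← integral_const_mul]
      refine integral_congr_ae (ae_of_all _ fun t => ?_)
      simp only [pw, ← Complex.exp_nat_mul]
      push_cast
      rw [show (n:ℂ) * -(log (p:ℂ) * gam α β H t) = -(n * log (p:ℂ) * gam α β H t) by ring]
      ring
    rw [this, Complex.re_ofReal_mul, h0, mul_zero]
  have hr := Complex.hasSum_re hs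
  simp only [hz] at hr
  have := hr.unique hasSum_zero
  simpa using this

theorem dens_A {n : ℕ} (hn : 2 ≤ n) {α β H α' β' H' : ℝ} (ha : 1/2 < α) (hb : β < 1) (h1 : α < α') (h2 : β' < β) (h3 : H' < H)
    (hab : α ≤ β) (hH : 0 ≤ H) (ε : ℝ) (hε : 0 < ε) (M : ℕ) :
    ∃ Y, M ≤ Y ∧ ∃ ζ : ℕ → ℂ, (∀ m, ζ m ^ n = 1) ∧ ∀ s ∈ Rect α' β' H',
      ‖∑ p ∈ (Ico 3 Y).filter Nat.Prime, -Complex.log (1 - ζ p * pw p s)‖ ≤ ε := by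
  obtain ⟨C, hC, hsup⟩ := sup_bound h1 h2 h3 hab hH
  have hgc := gam_cont α β H
  have hsm : Summable (fun m : ℕ => (m:ℝ)^(-(2*α))) := Real.summable_nat_rpow.2 (by linarith)
  -- tail
  have htail := tendsto_sum_nat_add (fun m : ℕ => (m:ℝ)^(-(2*α)))
  have hev : ∀ᶠ N : ℕ in atTop, ∑' k : ℕ, ((k + N : ℕ):ℝ)^(-(2*α)) < min (ε/4) (ε^2/(4 * (C * 32))) := by
    exact htail.eventually (gt_mem_nhds (by positivity))
  obtain ⟨N, hN, hN3⟩ := (hev.and (eventually_ge_atTop 3)).exists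
  have hN1 := hN.trans_le (min_le_left _ _)
  have hN2 := hN.trans_le (min_le_right _ _)
  have htl : ∀ Y, ∑ m ∈ Ico N Y, (m:ℝ)^(-(2*α)) ≤ ∑' k : ℕ, ((k + N : ℕ):ℝ)^(-(2*α)) := by
    intro Y
    rw [Finset.sum_Ico_eq_sum_range]
    have := ((summable_nat_add_iff N).2 hsm).sum_le_tsum (range (Y - N)) (fun _ _ => by positivity)
    refine le_trans (le_of_eq ?_) this
    refine Finset.sum_congr rfl fun i _ => ?_
    rw [add_comm N i]
  have hucont : ∀ m : ℕ, ContinuousOn (fun t => if m.Prime then pw m (gam α β H t) else 0) (Set.Icc 0 4) := by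
    intro m
    split_ifs
    · exact ((pw_cont m).comp hgc).continuousOn
    · exact continuousOn_const
  have hlogd : ∀ (ζ : ℂ), ‖ζ‖ = 1 → ∀ m : ℕ, 2 ≤ m → DifferentiableOn ℂ (fun s => Complex.log (1 - ζ * pw m s)) (Rect α β H) := by
    intro ζ hζ m hm s hs
    have : 1 - ζ * pw m s ∈ slitPlane := slit_of hζ (pw_lt hm (by have := hs.1; linarith))
    have hd := pw_diff m s
    exact (DifferentiableAt.clog (f := fun s => 1 - ζ * pw m s) ((hd.const_mul ζ).const_sub 1) this).differentiableWithinAt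
  have hlog1 : ∀ m ∈ (Ico 3 N).filter Nat.Prime, DifferentiableOn ℂ (fun s => Complex.log (1 - pw m s)) (Rect α β H) := by
    intro m hm
    have := hlogd 1 (by simp) m (by simp at hm; omega)
    simpa using this
  have hhd : DifferentiableOn ℂ (fun s => ∑ p ∈ (Ico 3 N).filter Nat.Prime, Complex.log (1 - pw p s)) (Rect α β H) :=
    DifferentiableOn.fun_sum hlog1
  have hgmem : Set.MapsTo (gam α β H) (Set.Icc 0 4) (Rect α β H) := fun t ht => gam_mem hab hH ht
  have hhc : ContinuousOn (fun t => ∑ p ∈ (Ico 3 N).filter Nat.Prime, Complex.log (1 - pw p (gam α β H t))) (Set.Icc 0 4) :=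
    hhd.continuousOn.comp hgc.continuousOn hgmem
  have hyp : ∀ f : StrongDual ℂ L2E, Summable (fun m => |(f (tl (hucont m))).re|) → (f (tl hhc)).re = 0 := by
    intro f hf
    obtain ⟨G, hG, hfG⟩ := dual_tl f
    have hcar := carRe (α := α) (β := β) (H := H) hab hH hG
    have hz : ∀ x : ℝ, (((∫ t in Set.Ioc (0:ℝ) 4, G t * cexp (-(x * gam α β H t))).re : ℝ) : ℂ) = 0 := by
      intro x
      refine thmD ha hb hcar ?_ x
      refine hf.congr fun m => ?_
      rw [hfG]
      by_cases hm : m.Prime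
      · simp only [hm, if_true, pw, Complex.norm_real, Real.norm_eq_abs]
      · simp [hm]
    have hz' : ∀ x : ℝ, (∫ t in Set.Ioc (0:ℝ) 4, G t * cexp (-(x * gam α β H t))).re = 0 := fun x => by
      exact_mod_cast hz x
    rw [hfG]
    simp only [Finset.mul_sum]
    rw [integral_finset_sum, Complex.re_sum]
    · refine Finset.sum_eq_zero fun p hp => int_log_zero ha hab hH hG hz' p (by simp at hp; omega)
    · intro p hp
      obtain ⟨D, hD⟩ := isCompact_Icc.exists_bound_of_continuousOn ((hlog1 p hp).continuousOn.comp hgc.continuousOn hgmem)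
      refine Integrable.mul_bdd (c := D) hG ?_ ?_
      · exact (((hlog1 p hp).continuousOn.comp hgc.continuousOn hgmem).mono Set.Ioc_subset_Icc_self).aestronglyMeasurable measurableSet_Ioc
      · exact (ae_restrict_mem measurableSet_Ioc).mono fun t ht => hD t (Set.Ioc_subset_Icc_self ht)
  have hun : ∀ m, 1 ≤ m → ‖tl (hucont m)‖ ^ 2 ≤ 4 * (m:ℝ)^(-(2*α)) := by
    intro m hm
    rw [tl_norm]
    have : ∫ t in (0:ℝ)..4, ‖(if m.Prime then pw m (gam α β H t) else 0)‖ ^ 2 ≤ ∫ t in (0:ℝ)..4, (m:ℝ)^(-(2*α)) := by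
      refine intervalIntegral.integral_mono_on (by norm_num) ?_ (by simp) fun t ht => ?_
      · exact ((hucont m).norm.pow 2).intervalIntegrable_of_Icc (by norm_num)
      · split_ifs
        · have := pw_norm_le hm (gam_mem hab hH ht).1
          calc _ ≤ ((m:ℝ)^(-α)) ^ 2 := by gcongr
            _ = _ := by rw [← Real.rpow_natCast, ← Real.rpow_mul (by positivity)]; congr 1; push_cast; ring
        · simp; positivity
    refine this.trans ?_
    rw [intervalIntegral.integral_const]; simp
  obtain ⟨Y, hYM, ζ, hζ, hbd⟩ := dens_abs hn (fun m => tl (hucont m)) (tl hhc) hyp N (ε^2/(8*C)) (by positivity) (max M N)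
  have hYN : N ≤ Y := (le_max_right _ _).trans hYM
  have hζn : ∀ m, ‖ζ m‖ = 1 := fun m => Complex.norm_eq_one_of_pow_eq_one (hζ m) (by omega)
  set ζ' : ℕ → ℂ := fun m => if m < N then 1 else ζ m with hζ'
  refine ⟨Y, (le_max_left _ _).trans hYM, ζ', ?_, ?_⟩
  · intro m; simp only [hζ']; split_ifs; simp; exact hζ m
  -- function F
  set F : ℂ → ℂ := fun s => (∑ p ∈ (Ico 3 N).filter Nat.Prime, Complex.log (1 - pw p s)) - ∑ m ∈ (Ico N Y).filter Nat.Prime, ζ m * pw m s with hF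
  have hFd : DifferentiableOn ℂ F (Rect α β H) := by
    refine hhd.sub (DifferentiableOn.fun_sum fun m _ => ?_)
    exact ((pw_diff m).const_mul _).differentiableOn
  have hsumc : ContinuousOn (fun t => F (gam α β H t)) (Set.Icc 0 4) := hFd.continuousOn.comp hgc.continuousOn hgmem
  have hFe : tl hhc - ∑ m ∈ Ico N Y, ζ m • tl (hucont m) = tl hsumc := by
    have e1 : ∀ m, ContinuousOn (fun t => ζ m * (if m.Prime then pw m (gam α β H t) else 0)) (Set.Icc 0 4) := fun m => (hucont m).const_smul (ζ m)
    have e2 : ∀ m, ζ m • tl (hucont m) = tl (e1 m) := fun m => (MemLp.toLp_const_smul (ζ m) (memLp_cont (hucont m))).symm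
    have e3 : ∀ S : Finset ℕ, ∃ hc : ContinuousOn (fun t => ∑ m ∈ S, ζ m * (if m.Prime then pw m (gam α β H t) else 0)) (Set.Icc 0 4),
        ∑ m ∈ S, ζ m • tl (hucont m) = tl hc := by
      intro S
      refine ⟨continuousOn_finset_sum _ fun m _ => e1 m, ?_⟩
      apply Lp.ext
      have h5 := Lp.coeFn_finsetSum S (fun m => ζ m • tl (hucont m))
      have h6 : ∀ᵐ t ∂mu4, ∀ m ∈ S, (ζ m • tl (hucont m)) t = ζ m * (if m.Prime then pw m (gam α β H t) else 0) := by
        rw [Finset.eventually_all]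
        intro m _
        rw [e2]
        exact (memLp_cont (e1 m)).coeFn_toLp
      filter_upwards [h5, h6, (memLp_cont (continuousOn_finset_sum S fun m _ => e1 m)).coeFn_toLp] with t g1 g2 g3
      rw [g1, tl, g3]
      simp only [Finset.sum_apply]
      exact Finset.sum_congr rfl fun m hm => g2 m hm
    obtain ⟨hc, hc'⟩ := e3 (Ico N Y)
    rw [hc', tl, tl, ← MemLp.toLp_sub]
    unfold tl
    congr 1
    ext t
    simp only [Pi.sub_apply, hF, Finset.sum_filter]
    congr 1
    refine Finset.sum_congr rfl fun m _ => ?_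
    split_ifs <;> simp
  rw [hFe, tl_norm] at hbd
  have hbd2 : C * ∫ t in (0:ℝ)..4, ‖F (gam α β H t)‖ ^ 2 ≤ (ε/2)^2 := by
    have q1 : ∑ m ∈ Ico N Y, ‖tl (hucont m)‖ ^ 2 ≤ 4 * (ε^2/(4 * (C * 32))) := by
      calc _ ≤ ∑ m ∈ Ico N Y, 4 * (m:ℝ)^(-(2*α)) := Finset.sum_le_sum fun m hm => hun m (by simp at hm; omega)
        _ = 4 * ∑ m ∈ Ico N Y, (m:ℝ)^(-(2*α)) := by rw [Finset.mul_sum]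
        _ ≤ _ := by gcongr; exact (htl Y).trans hN2.le
    calc _ ≤ C * (ε^2/(8*C) + 4 * (4 * (ε^2/(4 * (C * 32))))) := by gcongr; linarith
      _ = (ε/2)^2 := by field_simp; norm_num
  intro s hs
  have hFs : ‖F s‖ ≤ ε/2 := abs_le_of_sq_le_sq' ((hsup F hFd s hs).trans hbd2) (by positivity) |>.2
  have hsα : α ≤ s.re := by have := hs.1; linarith
  have hsplit : ∑ p ∈ (Ico 3 Y).filter Nat.Prime, -Complex.log (1 - ζ' p * pw p s) =
      - F s + ∑ p ∈ (Ico N Y).filter Nat.Prime, (-Complex.log (1 - ζ p * pw p s) - ζ p * pw p s) := by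
    rw [Finset.sum_filter, ← Finset.sum_Ico_consecutive _ hN3 hYN, ← Finset.sum_filter, ← Finset.sum_filter]
    have g1 : ∑ p ∈ (Ico 3 N).filter Nat.Prime, -Complex.log (1 - ζ' p * pw p s) = - ∑ p ∈ (Ico 3 N).filter Nat.Prime, Complex.log (1 - pw p s) := by
      rw [← Finset.sum_neg_distrib]
      refine Finset.sum_congr rfl fun p hp => ?_
      simp only [Finset.mem_filter, Finset.mem_Ico] at hp
      simp only [hζ', if_pos hp.1.2, one_mul]
    have g2 : ∑ p ∈ (Ico N Y).filter Nat.Prime, -Complex.log (1 - ζ' p * pw p s) = ∑ p ∈ (Ico N Y).filter Nat.Prime, -Complex.log (1 - ζ p * pw p s) := by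
      refine Finset.sum_congr rfl fun p hp => ?_
      simp only [Finset.mem_filter, Finset.mem_Ico] at hp
      simp only [hζ', if_neg (show ¬ p < N by omega)]
    rw [g1, g2, hF, Finset.sum_sub_distrib]
    ring
  rw [hsplit]
  have hquad : ‖∑ p ∈ (Ico N Y).filter Nat.Prime, (-Complex.log (1 - ζ p * pw p s) - ζ p * pw p s)‖ ≤ ε/2 := by
    calc _ ≤ ∑ p ∈ (Ico N Y).filter Nat.Prime, 2 * (p:ℝ)^(-(2*α)) := by
          refine norm_sum_le_of_le _ fun p hp => ?_
          simp only [Finset.mem_filter, Finset.mem_Ico] at hp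
          have hp2 := hp.2.two_le
          set z := -(ζ p * pw p s) with hz
          have hz1 : ‖z‖ = ‖pw p s‖ := by rw [hz, norm_neg, norm_mul, hζn, one_mul]
          have hz2 : ‖z‖ ≤ 3/4 := by rw [hz1]; exact pw_lt hp2 (by linarith)
          have := Complex.norm_log_one_add_sub_self_le (lt_of_le_of_lt hz2 (by norm_num))
          rw [show -Complex.log (1 - ζ p * pw p s) - ζ p * pw p s = -(Complex.log (1 + z) - z) by rw [hz]; ring_nf, norm_neg]
          refine this.trans ?_
          have h5 : (1 - ‖z‖)⁻¹ ≤ 4 := by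
            rw [inv_le_comm₀ (by linarith) (by norm_num)]; linarith
          have h6 : ‖z‖ ^ 2 ≤ (p:ℝ)^(-(2*α)) := by
            rw [hz1]
            calc _ ≤ ((p:ℝ)^(-α)) ^ 2 := by gcongr; exact pw_norm_le (by omega) hsα
              _ = _ := by rw [← Real.rpow_natCast, ← Real.rpow_mul (by positivity)]; congr 1; push_cast; ring
          calc _ ≤ (p:ℝ)^(-(2*α)) * 4 / 2 := by gcongr; exact inv_nonneg.2 (by linarith)
            _ = _ := by ring
      _ ≤ ∑ p ∈ (Ico N Y), 2 * (p:ℝ)^(-(2*α)) := 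
          Finset.sum_le_sum_of_subset_of_nonneg (Finset.filter_subset _ _) fun _ _ _ => by positivity
      _ = 2 * ∑ p ∈ (Ico N Y), (p:ℝ)^(-(2*α)) := by rw [Finset.mul_sum]
      _ ≤ 2 * (ε/4) := by gcongr; exact (htl Y).trans hN1.le
      _ = ε/2 := by ring
  calc _ ≤ ‖-F s‖ + _ := norm_add_le _ _
    _ ≤ ε := by rw [norm_neg]; linarith

end LZ

namespace LZ
open scoped FourierTransform

noncomputable def gk (d : ℝ) (x : ℝ) : ℝ := (Real.sqrt d)⁻¹ * rexp (-(π / d) * x ^ 2)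

lemma gk_nonneg (d x : ℝ) : 0 ≤ gk d x := by unfold gk; positivity

lemma gk_integrable {d : ℝ} (hd : 0 < d) : Integrable (gk d) := by
  unfold gk
  exact (integrable_exp_neg_mul_sq (by positivity)).const_mul _

lemma gk_integral {d : ℝ} (hd : 0 < d) : ∫ x, gk d x = 1 := by
  unfold gk
  rw [integral_const_mul, integral_gaussian, show π / (π / d) = d by field_simp]
  exact inv_mul_cancel₀ (by positivity)

lemma gk_fourier {d : ℝ} (hd : 0 < d) (x : ℝ) :
    ∫ ξ : ℝ, cexp (-(2 * π * x * ξ : ℝ) * I) * (rexp (-(π * d) * ξ ^ 2) : ℝ) = (gk d x : ℝ) := by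
  have h := congrFun (fourier_gaussian_pi (b := (d:ℂ)) (by simpa using hd)) x
  rw [Real.fourier_eq'] at h
  simp only [gk]
  have e1 : ((Real.sqrt d : ℝ) : ℂ) = (d:ℂ) ^ (1/2:ℂ) := by
    rw [Real.sqrt_eq_rpow, Complex.ofReal_cpow hd.le]; norm_num
  rw [Complex.ofReal_mul, Complex.ofReal_inv, e1]
  rw [show ((d:ℂ) ^ (1/2:ℂ))⁻¹ * ((rexp (-(π / d) * x ^ 2) : ℝ) : ℂ) = 1 / (d:ℂ) ^ (1/2:ℂ) * cexp (-π / d * x ^ 2) by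
    rw [one_div]; push_cast; rw [neg_div, one_div], ← h]
  refine integral_congr_ae (ae_of_all _ fun ξ => ?_)
  simp only [smul_eq_mul, RCLike.inner_apply, conj_trivial]
  push_cast
  congr 2 <;> ring

lemma planch_w {f : ℝ → ℂ} (hf : Integrable f) (h2 : Integrable (fun x => ‖f x‖ ^ 2)) {d : ℝ} (hd : 0 < d) :
    ∫ ξ, rexp (-(π * d) * ξ ^ 2) * ‖𝓕 f ξ‖ ^ 2 ≤ ∫ x, ‖f x‖ ^ 2 := by
  set Φ : ℝ × ℝ → ℂ := fun p => f p.1 * (starRingEnd ℂ) (f p.2) with hΦ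
  have hfc : Integrable (fun x => (starRingEnd ℂ) (f x)) := (Complex.conjCLE.toContinuousLinearMap.integrable_comp hf)
  have hΦi : Integrable Φ (volume.prod volume) := hf.mul_prod hfc
  have hw : Integrable (fun ξ : ℝ => ((rexp (-(π * d) * ξ ^ 2) : ℝ) : ℂ)) :=
    (integrable_exp_neg_mul_sq (by positivity)).ofReal
  have hfe : ∀ ξ, 𝓕 f ξ = ∫ x, cexp (-(2 * π * x * ξ : ℝ) * I) * f x := by
    intro ξ
    rw [Real.fourier_eq']
    refine integral_congr_ae (ae_of_all _ fun x => ?_)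
    simp only [smul_eq_mul, RCLike.inner_apply, conj_trivial]
    push_cast
    congr 2; ring
  have hsq : ∀ ξ : ℝ, ((‖𝓕 f ξ‖ ^ 2 : ℝ) : ℂ) = ∫ p : ℝ × ℝ, cexp (-(2 * π * (p.1 - p.2) * ξ : ℝ) * I) * Φ p ∂(volume.prod volume) := by
    intro ξ
    rw [← Complex.normSq_eq_norm_sq, ← Complex.mul_conj, hfe, ← integral_conj, ← integral_prod_mul]
    refine integral_congr_ae (ae_of_all _ fun p => ?_)
    simp only [hΦ, map_mul, ← Complex.exp_conj, map_neg, Complex.conj_I, Complex.conj_ofReal]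
    rw [show cexp (-(2 * π * (p.1 - p.2) * ξ : ℝ) * I) = cexp (-(2 * π * p.1 * ξ : ℝ) * I) * cexp (-(2 * π * p.2 * ξ : ℝ) * -I) by
      rw [← Complex.exp_add]; congr 1; push_cast; ring]
    ring
  have hmain : ((∫ ξ, rexp (-(π * d) * ξ ^ 2) * ‖𝓕 f ξ‖ ^ 2 : ℝ) : ℂ) = ∫ p : ℝ × ℝ, Φ p * (gk d (p.1 - p.2) : ℝ) ∂(volume.prod volume) := by
    rw [← integral_complex_ofReal]
    have e1 : ∀ ξ : ℝ, ((rexp (-(π * d) * ξ ^ 2) * ‖𝓕 f ξ‖ ^ 2 : ℝ) : ℂ) = ∫ p : ℝ × ℝ, ((rexp (-(π * d) * ξ ^ 2) : ℝ):ℂ) * (cexp (-(2 * π * (p.1 - p.2) * ξ : ℝ) * I) * Φ p) ∂(volume.prod volume) := by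
      intro ξ
      rw [integral_const_mul, ← hsq]; push_cast; rfl
    simp_rw [e1]
    rw [integral_integral_swap]
    · refine integral_congr_ae (ae_of_all _ fun p => ?_)
      beta_reduce
      rw [← gk_fourier hd, ← integral_const_mul]
      refine integral_congr_ae (ae_of_all _ fun ξ => ?_)
      beta_reduce
      push_cast
      ring
    · have h3 : Integrable (fun q : ℝ × (ℝ × ℝ) => ((rexp (-(π * d) * q.1 ^ 2) : ℝ):ℂ) * Φ q.2) (volume.prod (volume.prod volume)) := hw.mul_prod hΦi
      have h4 : Integrable (fun q : ℝ × (ℝ × ℝ) => cexp (-(2 * π * (q.2.1 - q.2.2) * q.1 : ℝ) * I) * (((rexp (-(π * d) * q.1 ^ 2) : ℝ):ℂ) * Φ q.2)) (volume.prod (volume.prod volume)) := by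
        refine h3.bdd_mul (c := 1) (Continuous.aestronglyMeasurable (by fun_prop)) (ae_of_all _ fun q => ?_)
        rw [← Complex.ofReal_neg, Complex.norm_exp_ofReal_mul_I]
      refine h4.congr (ae_of_all _ fun q => ?_)
      simp only [Function.uncurry]
      ring
  have hA : Integrable (fun p : ℝ × ℝ => ‖f p.2‖ ^ 2 * gk d (p.1 - p.2)) (volume.prod volume) := by
    have := Integrable.convolution_integrand (ContinuousLinearMap.mul ℝ ℝ) h2 (gk_integrable hd)
    simpa using this
  have hsym : ∀ x y, gk d (x - y) = gk d (y - x) := by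
    intro x y; unfold gk; congr 2; ring
  have hB : Integrable (fun p : ℝ × ℝ => ‖f p.1‖ ^ 2 * gk d (p.1 - p.2)) (volume.prod volume) := by
    have := hA.swap
    refine this.congr (ae_of_all _ fun p => ?_)
    simp only [Function.comp, Prod.swap, hsym p.2 p.1]
  have hAI : ∫ p : ℝ × ℝ, ‖f p.2‖ ^ 2 * gk d (p.1 - p.2) ∂(volume.prod volume) = ∫ x, ‖f x‖ ^ 2 := by
    rw [integral_prod_symm _ hA]
    refine integral_congr_ae (ae_of_all _ fun y => ?_)
    beta_reduce
    simp only
    rw [integral_const_mul, integral_sub_right_eq_self (gk d), gk_integral hd, mul_one]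
  have hBI : ∫ p : ℝ × ℝ, ‖f p.1‖ ^ 2 * gk d (p.1 - p.2) ∂(volume.prod volume) = ∫ x, ‖f x‖ ^ 2 := by
    rw [integral_prod _ hB]
    refine integral_congr_ae (ae_of_all _ fun y => ?_)
    beta_reduce
    simp only
    rw [integral_const_mul, integral_sub_left_eq_self (gk d), gk_integral hd, mul_one]
  have h0 : 0 ≤ ∫ ξ, rexp (-(π * d) * ξ ^ 2) * ‖𝓕 f ξ‖ ^ 2 := integral_nonneg fun ξ => by positivity
  calc ∫ ξ, rexp (-(π * d) * ξ ^ 2) * ‖𝓕 f ξ‖ ^ 2 = ‖((∫ ξ, rexp (-(π * d) * ξ ^ 2) * ‖𝓕 f ξ‖ ^ 2 : ℝ) : ℂ)‖ := by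
        rw [Complex.norm_real, Real.norm_of_nonneg h0]
    _ ≤ ∫ p : ℝ × ℝ, (1/2) * (‖f p.1‖ ^ 2 * gk d (p.1 - p.2)) + (1/2) * (‖f p.2‖ ^ 2 * gk d (p.1 - p.2)) ∂(volume.prod volume) := by
        rw [hmain]
        refine norm_integral_le_of_norm_le ((hB.const_mul _).add (hA.const_mul _)) (ae_of_all _ fun p => ?_)
        simp only [hΦ, norm_mul, Complex.norm_real, RCLike.norm_conj, Real.norm_of_nonneg (gk_nonneg _ _)]
        have := gk_nonneg d (p.1 - p.2)
        nlinarith [mul_nonneg (sq_nonneg (‖f p.1‖ - ‖f p.2‖)) this]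
    _ = ∫ x, ‖f x‖ ^ 2 := by
        rw [integral_add (hB.const_mul _) (hA.const_mul _), integral_const_mul, integral_const_mul, hAI, hBI]; ring

lemma planch {f : ℝ → ℂ} (hf : Integrable f) (h2 : Integrable (fun x => ‖f x‖ ^ 2)) {R : ℝ} (hR : 0 < R) :
    ∫ ξ in (-R)..R, ‖𝓕 f ξ‖ ^ 2 ≤ rexp π * ∫ x, ‖f x‖ ^ 2 := by
  have hc : Continuous (𝓕 f) := VectorFourier.fourierIntegral_continuous Real.continuous_fourierChar (by fun_prop) hf
  have hd : 0 < 1 / R ^ 2 := by positivity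
  have hb : ∀ ξ, ‖𝓕 f ξ‖ ≤ ∫ x, ‖f x‖ := fun ξ => VectorFourier.norm_fourierIntegral_le_integral_norm _ _ _ _ _
  have hi : Integrable (fun ξ => rexp (-(π * (1/R^2)) * ξ ^ 2) * ‖𝓕 f ξ‖ ^ 2) := by
    refine (integrable_exp_neg_mul_sq (by positivity)).mul_bdd (c := (∫ x, ‖f x‖) ^ 2) (hc.norm.pow 2).aestronglyMeasurable (ae_of_all _ fun ξ => ?_)
    rw [norm_pow, norm_norm]
    gcongr; exact hb ξ
  have h1 := planch_w hf h2 hd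
  rw [intervalIntegral.integral_of_le (by linarith)]
  calc ∫ ξ in Set.Ioc (-R) R, ‖𝓕 f ξ‖ ^ 2 ≤ ∫ ξ in Set.Ioc (-R) R, rexp π * (rexp (-(π * (1/R^2)) * ξ ^ 2) * ‖𝓕 f ξ‖ ^ 2) := by
        refine setIntegral_mono_on ?_ (hi.const_mul _).integrableOn measurableSet_Ioc fun ξ hξ => ?_
        · exact (hc.norm.pow 2).integrableOn_Ioc
        · rw [← mul_assoc, ← Real.exp_add]
          refine le_mul_of_one_le_left (by positivity) (Real.one_le_exp ?_)
          have : ξ ^ 2 ≤ R ^ 2 := sq_le_sq' hξ.1.le hξ.2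
          have : (1/R^2) * ξ^2 ≤ 1 := by rw [one_div, inv_mul_le_iff₀ (by positivity)]; linarith
          nlinarith [Real.pi_pos]
    _ ≤ ∫ ξ, rexp π * (rexp (-(π * (1/R^2)) * ξ ^ 2) * ‖𝓕 f ξ‖ ^ 2) :=
        setIntegral_le_integral (hi.const_mul _) (ae_of_all _ fun ξ => by positivity)
    _ ≤ _ := by rw [integral_const_mul]; gcongr

end LZ

namespace LZ

lemma pw_eq {m : ℕ} (hm : 1 ≤ m) (s : ℂ) : pw m s = (m:ℂ) ^ (-s) := by
  have : (m:ℂ) ≠ 0 := by exact_mod_cast (by omega : m ≠ 0)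
  rw [pw, Complex.cpow_def_of_ne_zero this, Complex.natCast_log]
  congr 1; ring

noncomputable def fM (M : ℕ) (x : ℝ) : ℂ := if (M:ℝ) ≤ x then ((Int.fract x : ℝ) : ℂ) else 0

lemma fM_meas (M : ℕ) : Measurable (fM M) := by
  unfold fM
  exact Measurable.ite measurableSet_Ici (Complex.measurable_ofReal.comp measurable_fract) measurable_const

lemma fM_norm (M : ℕ) (x : ℝ) : ‖fM M x‖ ≤ 1 := by
  unfold fM
  split_ifs
  · rw [Complex.norm_real, Real.norm_of_nonneg (Int.fract_nonneg _)]; exact (Int.fract_lt_one _).le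
  · simp

lemma fM_locint (M : ℕ) : LocallyIntegrableOn (fM M) (Set.Ioi 0) := by
  refine LocallyIntegrable.locallyIntegrableOn ?_ _
  refine (locallyIntegrable_const (1:ℝ)).mono (fM_meas M).aestronglyMeasurable (ae_of_all _ fun x => ?_)
  simpa using fM_norm M x

lemma fM_top (M : ℕ) : fM M =O[atTop] (fun x : ℝ => x ^ (-(0:ℝ))) := by
  refine Asymptotics.IsBigO.of_bound 1 (Eventually.of_forall fun x => ?_)
  simpa using fM_norm M x

lemma fM_bot {M : ℕ} (hM : 1 ≤ M) (b : ℝ) : fM M =O[nhdsWithin 0 (Set.Ioi 0)] (fun x : ℝ => x ^ (-b)) := by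
  refine Asymptotics.IsBigO.of_bound 1 ?_
  have : ∀ᶠ x : ℝ in nhdsWithin 0 (Set.Ioi 0), x < 1 := nhdsWithin_le_nhds (gt_mem_nhds one_pos)
  filter_upwards [this] with x hx
  have hM' : (1:ℝ) ≤ M := by exact_mod_cast hM
  rw [fM, if_neg (by linarith)]
  simp

lemma fM_conv {M : ℕ} (hM : 1 ≤ M) {s : ℂ} (hs : 0 < s.re) : MellinConvergent (fM M) (-s) :=
  mellinConvergent_of_isBigO_rpow (a := 0) (b := -s.re - 1) (fM_locint M) (fM_top M) (by simpa using hs) (fM_bot hM _) (by simp)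

lemma fM_diff {M : ℕ} (hM : 1 ≤ M) {s : ℂ} (hs : 0 < s.re) : DifferentiableAt ℂ (fun s => mellin (fM M) (-s)) s := by
  have := mellin_differentiableAt_of_isBigO_rpow (a := 0) (b := -s.re - 1) (s := -s) (fM_locint M) (fM_top M) (by simpa using hs) (fM_bot hM _) (by simp)
  exact this.comp s differentiableAt_id.neg

lemma zid1 {M : ℕ} (hM : 1 ≤ M) {s : ℂ} (hs : 1 < s.re) :
    riemannZeta s - ∑ n ∈ Icc 1 M, pw n s = (M:ℂ) ^ (1 - s) / (s - 1) - s * mellin (fM M) (-s) := by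
  have hM0 : (0:ℝ) < M := by exact_mod_cast hM
  have hM1 : (1:ℝ) ≤ M := by exact_mod_cast hM
  have hs0 : s ≠ 0 := by rintro rfl; simp at hs; linarith
  have hs1 : s - 1 ≠ 0 := by
    intro h; rw [sub_eq_zero] at h; rw [h] at hs; simp at hs
  set f : ℕ → ℂ := fun n => if M < n then 1 else 0 with hf
  have hO : (fun n : ℕ ↦ ∑ k ∈ Icc 1 n, ‖f k‖) =O[atTop] fun n : ℕ ↦ (n : ℝ) ^ (1:ℝ) := by
    refine Asymptotics.IsBigO.of_bound 1 (Eventually.of_forall fun n => ?_)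
    rw [Real.rpow_one, one_mul, Real.norm_of_nonneg (Finset.sum_nonneg fun _ _ => norm_nonneg _), Real.norm_natCast]
    calc _ ≤ ∑ k ∈ Icc 1 n, (1:ℝ) := Finset.sum_le_sum fun k _ => by simp only [hf]; split_ifs <;> simp
      _ = n := by simp
  have h1 := LSeries_eq_mul_integral' f zero_le_one hs hO
  have hsum : LSeriesSummable f s := LSeriesSummable_of_sum_norm_bigO hO zero_le_one hs
  have h2 : riemannZeta s - ∑ n ∈ Icc 1 M, pw n s = LSeries f s := by
    have hz : Summable (fun n : ℕ => 1 / (n:ℂ) ^ s) := Complex.summable_one_div_nat_cpow.2 hs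
    rw [zeta_eq_tsum_one_div_nat_cpow hs, LSeries, sub_eq_iff_eq_add, ← sub_eq_iff_eq_add', ← hz.tsum_sub hsum]
    rw [tsum_eq_sum (s := Icc 1 M)]
    · refine Finset.sum_congr rfl fun n hn => ?_
      rw [Finset.mem_Icc] at hn
      rw [LSeries.term_of_ne_zero (by omega)]
      simp only [hf, if_neg (show ¬ M < n by omega)]
      rw [pw_eq hn.1, Complex.cpow_neg]; simp
    · intro n hn
      rw [Finset.mem_Icc] at hn
      rcases Nat.eq_zero_or_pos n with rfl | h
      · simp [hs0]
      · rw [LSeries.term_of_ne_zero (by omega)]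
        simp only [hf, if_pos (show M < n by omega)]
        simp
  rw [h2, h1]
  have hsne : (-(s+1)).re < -1 := by simp; linarith
  have i1 : IntegrableOn (fun t : ℝ => (t:ℂ) ^ (-s)) (Set.Ioi (M:ℝ)) := integrableOn_Ioi_cpow_of_lt (by simpa using hs) hM0
  have i2 : IntegrableOn (fun t : ℝ => (t:ℂ) ^ (-(s+1))) (Set.Ioi (M:ℝ)) := integrableOn_Ioi_cpow_of_lt hsne hM0
  have i3 : IntegrableOn (fun t : ℝ => (t:ℂ) ^ (-s - 1) • fM M t) (Set.Ioi (M:ℝ)) :=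
    (fM_conv hM (by linarith : 0 < s.re)).mono_set (Set.Ioi_subset_Ioi hM0.le)
  have h3 : ∫ t in Set.Ioi (1 : ℝ), (∑ k ∈ Icc 1 ⌊t⌋₊, f k) * (t:ℂ) ^ (-(s + 1)) =
      ∫ t in Set.Ioi (M : ℝ), ((t:ℂ) ^ (-s) - M * (t:ℂ) ^ (-(s+1)) - (t:ℂ) ^ (-s - 1) • fM M t) := by
    rw [setIntegral_eq_of_subset_of_forall_diff_eq_zero (f := fun t : ℝ => (∑ k ∈ Icc 1 ⌊t⌋₊, f k) * (t:ℂ) ^ (-(s + 1))) (s := Set.Ioi (M:ℝ)) (t := Set.Ioi 1) measurableSet_Ioi (Set.Ioi_subset_Ioi hM1)]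
    · refine setIntegral_congr_fun measurableSet_Ioi fun t ht => ?_
      simp only [Set.mem_Ioi] at ht
      have ht0 : 0 < t := by linarith
      have hfl : M ≤ ⌊t⌋₊ := Nat.le_floor ht.le
      have : ∑ k ∈ Icc 1 ⌊t⌋₊, f k = (⌊t⌋₊ : ℂ) - M := by
        rw [hf, Finset.sum_ite]
        have : filter (fun k => M < k) (Icc 1 ⌊t⌋₊) = Ioc M ⌊t⌋₊ := by
          ext k; simp; omega
        rw [this]; simp [Nat.cast_sub hfl]
      beta_reduce
      rw [this, fM, if_pos ht.le, smul_eq_mul]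
      have e1 : ((⌊t⌋₊ : ℕ) : ℂ) = t - (Int.fract t : ℝ) := by
        rw [← Complex.ofReal_natCast, natCast_floor_eq_intCast_floor ht0.le, ← Complex.ofReal_sub]
        congr 1; exact (Int.self_sub_fract t).symm
      have e2 : (t:ℂ) ^ (-s) = t * (t:ℂ) ^ (-(s+1)) := by
        rw [show -s = 1 + -(s+1) by ring, Complex.cpow_add _ _ (by exact_mod_cast ht0.ne'), Complex.cpow_one]
      rw [e1, e2, show -s - 1 = -(s+1) by ring]; ring
    · intro t ht
      simp only [Set.mem_diff, Set.mem_Ioi, not_lt] at ht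
      have : ∑ k ∈ Icc 1 ⌊t⌋₊, f k = 0 := by
        refine Finset.sum_eq_zero fun k hk => ?_
        rw [Finset.mem_Icc] at hk
        have : ⌊t⌋₊ ≤ M := by
          rw [← Nat.floor_natCast (R := ℝ) M]; exact Nat.floor_le_floor ht.2
        simp only [hf, if_neg (show ¬ M < k by omega)]
      beta_reduce
      rw [this, zero_mul]
  have i12 : IntegrableOn (fun t : ℝ => (t:ℂ) ^ (-s) - M * (t:ℂ) ^ (-(s+1))) (Set.Ioi (M:ℝ)) := i1.sub (i2.const_mul _)
  rw [h3, integral_sub i12 i3, integral_sub i1 (i2.const_mul _), integral_const_mul,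
    integral_Ioi_cpow_of_lt (by simpa using hs) hM0, integral_Ioi_cpow_of_lt hsne hM0]
  have h4 : ∫ t in Set.Ioi (M:ℝ), (t:ℂ) ^ (-s - 1) • fM M t = mellin (fM M) (-s) := by
    rw [mellin]
    have : ∫ t in Set.Ici (M:ℝ), (t:ℂ) ^ (-s - 1) • fM M t = ∫ t in Set.Ioi (0:ℝ), (t:ℂ) ^ (-s - 1) • fM M t := by
      refine (setIntegral_eq_of_subset_of_forall_diff_eq_zero (s := Set.Ici (M:ℝ)) (t := Set.Ioi 0) measurableSet_Ioi (fun t ht => hM0.trans_le ht) ?_).symm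
      intro t ht
      simp only [Set.mem_diff, Set.mem_Ici, not_le] at ht
      rw [fM, if_neg (by linarith [ht.2]), smul_zero]
    rw [← this, integral_Ici_eq_integral_Ioi]
  rw [h4]
  have e3 : (M:ℂ) * (M:ℂ) ^ (-s) = (M:ℂ) ^ (1-s) := by
    rw [show 1 - s = 1 + -s by ring, Complex.cpow_add _ _ (by exact_mod_cast hM0.ne'), Complex.cpow_one]
  rw [show -(s+1)+1 = -s by ring, show -s + 1 = 1 - s by ring]
  simp only [Complex.ofReal_natCast]
  rw [← e3]
  have : (1 - s) ≠ 0 := by rw [← neg_sub]; exact neg_ne_zero.2 hs1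
  field_simp
  ring

lemma zid {M : ℕ} (hM : 1 ≤ M) {s : ℂ} (hs : 0 < s.re) (h1 : s ≠ 1) :
    riemannZeta s - ∑ n ∈ Icc 1 M, pw n s = (M:ℂ) ^ (1 - s) / (s - 1) - s * mellin (fM M) (-s) := by
  have hM0 : (M:ℂ) ≠ 0 := by exact_mod_cast (by omega : M ≠ 0)
  set A : ℂ → ℂ := fun s => riemannZeta₁ s - (s - 1) * ∑ n ∈ Icc 1 M, pw n s with hA
  set B : ℂ → ℂ := fun s => (M:ℂ) ^ (1 - s) - s * (s - 1) * mellin (fM M) (-s) with hB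
  set U : Set ℂ := {s : ℂ | 0 < s.re} with hU
  have hUo : IsOpen U := isOpen_lt continuous_const Complex.continuous_re
  have hAd : DifferentiableOn ℂ A U := by
    refine (differentiable_riemannZeta₁.sub ((differentiable_id.sub_const 1).mul ?_)).differentiableOn
    exact Differentiable.fun_sum fun n _ => pw_diff n
  have hBd : DifferentiableOn ℂ B U := by
    intro s hs
    refine DifferentiableAt.differentiableWithinAt ?_
    refine DifferentiableAt.sub ?_ ((differentiableAt_id.mul (differentiableAt_id.sub_const 1)).mul (fM_diff hM hs))
    exact ((differentiableAt_const 1).sub differentiableAt_id).const_cpow (Or.inl hM0)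
  have hpre : IsPreconnected U := (convex_halfSpace_re_gt 0).isPreconnected
  have hev : A =ᶠ[nhds 2] B := by
    have : {s : ℂ | 1 < s.re} ∈ nhds (2:ℂ) := (isOpen_lt continuous_const Complex.continuous_re).mem_nhds (by simp)
    filter_upwards [this] with s hs
    have hs1 : s ≠ 1 := by rintro rfl; simp at hs
    have hs1' : s - 1 ≠ 0 := sub_ne_zero.2 hs1
    have h := zid1 hM hs
    rw [riemannZeta_eq_inv_sub_mul hs1] at h
    simp only [hA, hB]
    field_simp at h
    linear_combination h
  have heq := (hAd.analyticOnNhd hUo).eqOn_of_preconnected_of_eventuallyEq (hBd.analyticOnNhd hUo) hpre (by simp [hU] : (2:ℂ) ∈ U) hev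
  have h := heq hs
  simp only [hA, hB] at h
  rw [riemannZeta_eq_inv_sub_mul h1]
  have hs1' : s - 1 ≠ 0 := sub_ne_zero.2 h1
  field_simp
  linear_combination h

end LZ

namespace LZ
open scoped FourierTransform

noncomputable def fB (M : ℕ) (h : ℝ) (x : ℝ) : ℂ := fM M x - fM M (rexp (-h) * x)

lemma fB_norm (M : ℕ) (h x : ℝ) : ‖fB M h x‖ ≤ 1 := by
  unfold fB fM
  have e : ∀ a b : ℝ, 0 ≤ a → a ≤ 1 → 0 ≤ b → b ≤ 1 → ‖(a:ℂ) - b‖ ≤ 1 := by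
    intro a b h1 h2 h3 h4
    rw [← Complex.ofReal_sub, Complex.norm_real, Real.norm_eq_abs, abs_le]; constructor <;> linarith
  have f0 := fun y : ℝ => Int.fract_nonneg y
  have f1 := fun y : ℝ => (Int.fract_lt_one y).le
  split_ifs
  · exact e _ _ (f0 _) (f1 _) (f0 _) (f1 _)
  · have := e _ 0 (f0 x) (f1 x) le_rfl zero_le_one; simpa using this
  · have := e 0 _ le_rfl zero_le_one (f0 (rexp (-h) * x)) (f1 _); simpa using this
  · simp

lemma fB_bd {M : ℕ} (hM : 1 ≤ M) {T h x : ℝ} (hh0 : 0 < h) (hh : h * T ≤ 1/4) (hx : (M:ℝ) ≤ x) (hxT : x ≤ T) :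
    ‖fB M h x‖ ^ 2 ≤ x ^ 2 * h ^ 2 + ∑ n ∈ Icc M ⌊T⌋₊, if (n:ℝ) ≤ x ∧ x < n * rexp h then (1:ℝ) else 0 := by
  have hM1 : (1:ℝ) ≤ M := by exact_mod_cast hM
  have hx0 : 0 < x := by linarith
  set y := rexp (-h) * x with hy
  have hyx : y ≤ x := by
    rw [hy]; refine mul_le_of_le_one_left hx0.le (Real.exp_le_one_iff.2 (by linarith))
  have hxy : x - y ≤ x * h := by
    have := Real.add_one_le_exp (-h)
    rw [hy]; nlinarith
  have hsum0 : 0 ≤ ∑ n ∈ Icc M ⌊T⌋₊, if (n:ℝ) ≤ x ∧ x < n * rexp h then (1:ℝ) else 0 :=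
    Finset.sum_nonneg fun _ _ => by split_ifs <;> norm_num
  have hN : (⌊x⌋₊ : ℝ) ≤ x := Nat.floor_le hx0.le
  have hN' : x < ⌊x⌋₊ + 1 := Nat.lt_floor_add_one x
  have hMN : M ≤ ⌊x⌋₊ := Nat.le_floor hx
  by_cases hc : y < ⌊x⌋₊
  · have h1 : (1:ℝ) ≤ ∑ n ∈ Icc M ⌊T⌋₊, if (n:ℝ) ≤ x ∧ x < n * rexp h then (1:ℝ) else 0 := by
      have := Finset.single_le_sum (f := fun n : ℕ => if (n:ℝ) ≤ x ∧ x < n * rexp h then (1:ℝ) else 0) (s := Icc M ⌊T⌋₊)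
        (fun _ _ => by beta_reduce; split_ifs <;> norm_num) (Finset.mem_Icc.2 ⟨hMN, Nat.floor_le_floor hxT⟩)
      refine le_trans (le_of_eq ?_) this
      beta_reduce
      have hlt : x < ⌊x⌋₊ * rexp h := by
        have e : x = y * rexp h := by rw [hy, mul_right_comm, ← Real.exp_add]; simp
        have := mul_lt_mul_of_pos_right hc (Real.exp_pos h)
        linarith
      rw [if_pos ⟨hN, hlt⟩]
    have h2 := fB_norm M h x
    have : ‖fB M h x‖ ^ 2 ≤ 1 := pow_le_one₀ (norm_nonneg _) h2
    nlinarith [mul_nonneg (sq_nonneg x) (sq_nonneg h)]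
  · push Not at hc
    have hMy : (M:ℝ) ≤ y := le_trans (by exact_mod_cast hMN) hc
    have hy0 : 0 ≤ y := by linarith
    have e1 : fB M h x = ((x - y : ℝ) : ℂ) := by
      unfold fB fM
      rw [if_pos hx, if_pos hMy, ← hy, ← Complex.ofReal_sub]
      congr 1
      have f1 : ⌊x⌋ = ((⌊x⌋₊ : ℕ) : ℤ) := by rw [Int.floor_eq_iff]; exact ⟨by exact_mod_cast hN, by exact_mod_cast hN'⟩
      have f2 : ⌊y⌋ = ((⌊x⌋₊ : ℕ) : ℤ) := by rw [Int.floor_eq_iff]; exact ⟨by exact_mod_cast hc, by push_cast; linarith⟩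
      rw [Int.fract, Int.fract, f1, f2]; ring
    rw [e1, Complex.norm_real, Real.norm_of_nonneg (by linarith)]
    have : (x - y)^2 ≤ (x * h)^2 := pow_le_pow_left₀ (by linarith) hxy 2
    nlinarith

noncomputable def fphi (M : ℕ) (h σ : ℝ) (u : ℝ) : ℂ := (rexp (σ * u) : ℝ) * fB M h (rexp (-u))

lemma fB_zero {M : ℕ} (hM : 1 ≤ M) {h x : ℝ} (hh : 0 < h) (hx0 : 0 < x) (hx : x < M) : fB M h x = 0 := by
  unfold fB fM
  have : rexp (-h) * x ≤ x := mul_le_of_le_one_left hx0.le (Real.exp_le_one_iff.2 (by linarith))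
  rw [if_neg (by linarith), if_neg (by linarith), sub_zero]

lemma fphi_meas (M : ℕ) (h σ : ℝ) : Measurable (fphi M h σ) := by
  unfold fphi fB
  have := fM_meas M
  fun_prop

lemma fphi_int {M : ℕ} (hM : 1 ≤ M) {h σ : ℝ} (hh : 0 < h) (hσ : 0 < σ) : Integrable (fphi M h σ) := by
  have h1 : Integrable (Set.indicator (Set.Iic 0) (fun u : ℝ => rexp (σ * u))) :=
    (integrable_indicator_iff measurableSet_Iic).2 (integrableOn_exp_mul_Iic hσ 0)
  refine h1.mono' (fphi_meas M h σ).aestronglyMeasurable (ae_of_all _ fun u => ?_)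
  rw [fphi, norm_mul, Complex.norm_real, Real.norm_of_nonneg (Real.exp_pos _).le]
  by_cases hu : u ≤ 0
  · rw [Set.indicator_of_mem (by exact hu)]
    exact mul_le_of_le_one_right (Real.exp_pos _).le (fB_norm _ _ _)
  · push Not at hu
    rw [Set.indicator_of_notMem (by simpa using hu), fB_zero hM hh (Real.exp_pos _)]
    · simp
    · have : rexp (-u) < 1 := (by rw [← Real.exp_zero]; exact Real.exp_lt_exp.2 (by linarith))
      have hM1 : (1:ℝ) ≤ M := by exact_mod_cast hM
      linarith

lemma fphi_sq {M : ℕ} (hM : 1 ≤ M) {h σ T : ℝ} (hT : 1 ≤ T) (hh0 : 0 < h) (hh : h * T ≤ 1/4) (hσ : 1/2 ≤ σ) (hσ1 : σ < 1) :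
    Integrable (fun u => ‖fphi M h σ u‖ ^ 2) ∧ ∫ u, ‖fphi M h σ u‖ ^ 2 ≤
      T ^ (-(2*σ)) + h ^ 2 * (T ^ (2 - 2 * σ) / (2 - 2 * σ)) + h * ∑ n ∈ Icc M ⌊T⌋₊, (n:ℝ) ^ (-(2*σ)) := by
  have hT0 : 0 < T := by linarith
  have hM1 : (1:ℝ) ≤ M := by exact_mod_cast hM
  set g1 : ℝ → ℝ := Set.indicator (Set.Iic (-Real.log T)) (fun u : ℝ => rexp ((2*σ) * u)) with hg1
  set g2 : ℝ → ℝ := Set.indicator (Set.Ici (-Real.log T)) (fun u : ℝ => h^2 * rexp ((2*σ-2) * u)) with hg2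
  set g3 : ℕ → ℝ → ℝ := fun n => Set.indicator (Set.Ioc (-Real.log n - h) (-Real.log n)) (fun u : ℝ => (n:ℝ) ^ (-(2*σ))) with hg3
  have i1 : Integrable g1 := (integrable_indicator_iff measurableSet_Iic).2 (integrableOn_exp_mul_Iic (by linarith) _)
  have i2 : Integrable g2 := (integrable_indicator_iff measurableSet_Ici).2
    (((integrableOn_Ici_iff_integrableOn_Ioi (by finiteness)).2 (integrableOn_exp_mul_Ioi (by linarith) _)).const_mul _)
  have i3 : ∀ n, Integrable (g3 n) := fun n => (integrable_indicator_iff measurableSet_Ioc).2 (by simp)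
  have i3s : Integrable (fun u => ∑ n ∈ Icc M ⌊T⌋₊, g3 n u) := integrable_finset_sum _ fun n _ => i3 n
  have I1 : ∫ u, g1 u ≤ T ^ (-(2*σ)) := by
    rw [hg1, integral_indicator measurableSet_Iic, integral_exp_mul_Iic (by linarith), Real.rpow_def_of_pos hT0]
    rw [show 2 * σ * -Real.log T = Real.log T * -(2*σ) by ring]
    exact div_le_self (Real.exp_pos _).le (by linarith)
  have I2 : ∫ u, g2 u = h ^ 2 * (T ^ (2 - 2 * σ) / (2 - 2 * σ)) := by
    rw [hg2, integral_indicator measurableSet_Ici, integral_Ici_eq_integral_Ioi, integral_const_mul, integral_exp_mul_Ioi (by linarith), Real.rpow_def_of_pos hT0]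
    rw [show (2 * σ - 2) * -Real.log T = Real.log T * (2 - 2*σ) by ring, neg_div, ← div_neg, neg_sub]
  have I3 : ∀ n, ∫ u, g3 n u = h * (n:ℝ) ^ (-(2*σ)) := by
    intro n
    rw [hg3]
    beta_reduce
    rw [integral_indicator measurableSet_Ioc, setIntegral_const]
    simp only [Real.volume_real_Ioc, smul_eq_mul]
    rw [max_eq_left (by linarith)]; ring
  have hpos1 : ∀ u, 0 ≤ g1 u := fun u => Set.indicator_nonneg (fun _ _ => (Real.exp_pos _).le) u
  have hpos2 : ∀ u, 0 ≤ g2 u := fun u => Set.indicator_nonneg (fun _ _ => by positivity) u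
  have hpos3 : ∀ u, 0 ≤ ∑ n ∈ Icc M ⌊T⌋₊, g3 n u := fun u => Finset.sum_nonneg fun n _ => Set.indicator_nonneg (fun _ _ => by positivity) u
  have hbd : ∀ u, ‖fphi M h σ u‖ ^ 2 ≤ g1 u + g2 u + ∑ n ∈ Icc M ⌊T⌋₊, g3 n u := by
    intro u
    have e0 : ‖fphi M h σ u‖ ^ 2 = rexp ((2*σ) * u) * ‖fB M h (rexp (-u))‖ ^ 2 := by
      rw [fphi, norm_mul, Complex.norm_real, Real.norm_of_nonneg (Real.exp_pos _).le, mul_pow, ← Real.exp_nat_mul]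
      congr 2; push_cast; ring
    by_cases hu : u ≤ -Real.log T
    · have : ‖fphi M h σ u‖ ^ 2 ≤ g1 u := by
        rw [e0, hg1, Set.indicator_of_mem (by exact hu)]
        exact mul_le_of_le_one_right (Real.exp_pos _).le (pow_le_one₀ (norm_nonneg _) (fB_norm _ _ _))
      linarith [hpos2 u, hpos3 u]
    · push Not at hu
      by_cases hx : rexp (-u) < M
      · rw [e0, fB_zero hM hh0 (Real.exp_pos _) hx]
        simp only [norm_zero]
        have := hpos1 u; have := hpos2 u; have := hpos3 u
        simp only [ne_eq, OfNat.ofNat_ne_zero, not_false_eq_true, zero_pow, mul_zero]; linarith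
      · push Not at hx
        have hxT : rexp (-u) ≤ T := by
          rw [← Real.exp_log hT0]; exact Real.exp_le_exp.2 (by linarith)
        have hb := fB_bd hM hh0 hh hx hxT
        have hg2u : g2 u = h^2 * rexp ((2*σ-2) * u) := by rw [hg2, Set.indicator_of_mem (by exact hu.le)]
        have h3 : rexp ((2*σ) * u) * (∑ n ∈ Icc M ⌊T⌋₊, if (n:ℝ) ≤ rexp (-u) ∧ rexp (-u) < n * rexp h then (1:ℝ) else 0) ≤ ∑ n ∈ Icc M ⌊T⌋₊, g3 n u := by
          rw [Finset.mul_sum]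
          refine Finset.sum_le_sum fun n hn => ?_
          have hn0 : (0:ℝ) < n := by
            have := (Finset.mem_Icc.1 hn).1
            exact_mod_cast (by omega : 0 < n)
          split_ifs with hc
          · have q1 : Real.log n ≤ -u := by rw [Real.log_le_iff_le_exp hn0]; exact hc.1
            have q2 : -u < Real.log n + h := by
              rw [← Real.exp_lt_exp, Real.exp_add, Real.exp_log hn0]; exact hc.2
            rw [hg3]
            beta_reduce
            rw [Set.indicator_of_mem (by constructor <;> linarith), mul_one, Real.rpow_def_of_pos hn0]
            refine Real.exp_le_exp.2 ?_
            nlinarith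
          · rw [mul_zero]; exact Set.indicator_nonneg (fun _ _ => by positivity) u
        calc ‖fphi M h σ u‖ ^ 2 ≤ rexp ((2*σ) * u) * (rexp (-u) ^ 2 * h ^ 2 + _) := by rw [e0]; gcongr
          _ = h^2 * rexp ((2*σ-2) * u) + rexp ((2*σ) * u) * (∑ n ∈ Icc M ⌊T⌋₊, if (n:ℝ) ≤ rexp (-u) ∧ rexp (-u) < n * rexp h then (1:ℝ) else 0) := by
              rw [mul_add]; congr 1
              rw [← Real.exp_nat_mul, show (2*σ-2)*u = 2*σ*u + (2:ℕ)*(-u) by push_cast; ring, Real.exp_add]; ring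
          _ ≤ _ := by rw [← hg2u]; linarith [hpos1 u]
  have hi : Integrable (fun u => ‖fphi M h σ u‖ ^ 2) := by
    refine ((i1.add i2).add i3s).mono' ((fphi_meas M h σ).norm.pow_const 2).aestronglyMeasurable (ae_of_all _ fun u => ?_)
    rw [Real.norm_of_nonneg (by positivity)]
    exact hbd u
  refine ⟨hi, ?_⟩
  have h12 : Integrable (fun u => g1 u + g2 u) := i1.add i2
  calc ∫ u, ‖fphi M h σ u‖ ^ 2 ≤ ∫ u, (g1 u + g2 u + ∑ n ∈ Icc M ⌊T⌋₊, g3 n u) := integral_mono hi (h12.add i3s) hbd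
    _ = (∫ u, g1 u) + (∫ u, g2 u) + ∑ n ∈ Icc M ⌊T⌋₊, ∫ u, g3 n u := by
        rw [integral_add h12 i3s, integral_add i1 i2, integral_finset_sum _ fun n _ => i3 n]
    _ ≤ _ := by
        rw [I2, Finset.sum_congr rfl fun n _ => I3 n, Finset.mul_sum]; linarith

end LZ

namespace LZ
open scoped FourierTransform

lemma mell_four {M : ℕ} (hM : 1 ≤ M) {h : ℝ} (hh : 0 < h) {s : ℂ} (hs : 0 < s.re) :
    (1 - cexp (-(h * s))) * mellin (fM M) (-s) = 𝓕 (fphi M h s.re) (-s.im / (2 * π)) := by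
  have h1 := fM_conv hM hs
  have h2 := (MellinConvergent.comp_mul_left (f := fM M) (s := -s) (Real.exp_pos (-h))).2 h1
  have h3 := (hasMellin_sub h1 h2).2
  rw [mellin_comp_mul_left _ _ (Real.exp_pos (-h))] at h3
  have h4 : ((rexp (-h) : ℝ) : ℂ) ^ (- -s) = cexp (-(h * s)) := by
    rw [neg_neg, Complex.cpow_def_of_ne_zero (by exact_mod_cast (Real.exp_pos (-h)).ne'), ← Complex.ofReal_log (Real.exp_pos _).le, Real.log_exp]
    congr 1; push_cast; ring
  rw [h4, smul_eq_mul] at h3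
  rw [sub_mul, one_mul, ← h3, mellin_eq_fourier]
  simp only [neg_re, neg_im, neg_neg]
  rfl

lemma pole_bd {M : ℕ} (hM : 1 ≤ M) {σ β t : ℝ} (hσ : 0 ≤ σ) (hσ1 : 1/2 ≤ σ) (hσβ : σ ≤ β) (hβ : β < 1) :
    ‖(M:ℂ) ^ (1 - (σ + t * I : ℂ)) / ((σ + t * I : ℂ) - 1)‖ ^ 2 ≤ (M / (1 - β) ^ 2) * (1 + t ^ 2)⁻¹ := by
  have hM0 : (0:ℝ) < M := by exact_mod_cast hM
  have hM1 : (1:ℝ) ≤ M := by exact_mod_cast hM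
  have e1 : ‖(M:ℂ) ^ (1 - (σ + t * I : ℂ))‖ ^ 2 ≤ M := by
    rw [Complex.norm_natCast_cpow_of_pos (by omega)]
    rw [← Real.rpow_natCast, ← Real.rpow_mul hM0.le]
    calc _ ≤ (M:ℝ) ^ (1:ℝ) := Real.rpow_le_rpow_of_exponent_le hM1 (by simp; linarith)
      _ = M := Real.rpow_one _
  have e2 : ‖(σ + t * I : ℂ) - 1‖ ^ 2 = (1 - σ) ^ 2 + t ^ 2 := by
    rw [← Complex.normSq_eq_norm_sq, Complex.normSq_apply]; simp; ring
  rw [norm_div, div_pow, e2, ← div_eq_mul_inv, div_div]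
  have hb0 : 0 < 1 - β := by linarith
  refine div_le_div₀ hM0.le e1 (by positivity) ?_
  have : (1-β)^2 ≤ (1-σ)^2 := pow_le_pow_left₀ hb0.le (by linarith) 2
  have : (1-β)^2 ≤ 1 := pow_le_one₀ hb0.le (by linarith)
  nlinarith [sq_nonneg t]

lemma lhs_bd {M : ℕ} (hM : 1 ≤ M) {T : ℝ} (hT : 1 ≤ T) {σ t : ℝ} (hσ : 1/2 ≤ σ) (hσ1 : σ < 1) (ht : |t| ≤ T) :
    ‖(σ + t * I : ℂ) * mellin (fM M) (-(σ + t * I : ℂ))‖ ≤ 8 * T * ‖𝓕 (fphi M (1 / (4 * T)) σ) (-t / (2 * π))‖ := by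
  have hT0 : 0 < T := by linarith
  set h := 1 / (4 * T) with hh
  have hh0 : 0 < h := by positivity
  have hhT : h * T = 1/4 := by rw [hh]; field_simp
  set s : ℂ := σ + t * I with hs
  have hre : s.re = σ := by simp [hs]
  have him : s.im = t := by simp [hs]
  have e := mell_four hM hh0 (s := s) (by rw [hre]; linarith)
  rw [hre, him] at e
  have hsn : ‖s‖ ≤ 2 * T := by
    calc ‖s‖ ≤ |s.re| + |s.im| := Complex.norm_le_abs_re_add_abs_im s
      _ ≤ 2 * T := by rw [hre, him, abs_of_nonneg (by linarith)]; linarith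
  have hz : ‖-(h * s : ℂ)‖ = h * ‖s‖ := by
    rw [norm_neg, norm_mul, Complex.norm_real, Real.norm_of_nonneg hh0.le]
  have hz1 : h * ‖s‖ ≤ 1 / 2 := by nlinarith
  have q := Complex.norm_exp_sub_one_sub_id_le (x := -(h * s : ℂ)) (by rw [hz]; linarith)
  rw [hz] at q
  have q2 : h * ‖s‖ / 2 ≤ ‖1 - cexp (-(h * s))‖ := by
    have := norm_sub_norm_le (-(h * s : ℂ)) (-(cexp (-(h * s)) - 1 - -(h * s)))
    rw [norm_neg (cexp (-(h * s)) - 1 - -(h * s)), hz, show -(h * s : ℂ) - -(cexp (-(h * s)) - 1 - -(h * s)) = -(1 - cexp (-(h*s))) by ring, norm_neg] at this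
    have : 0 ≤ h * ‖s‖ := by positivity
    nlinarith
  rw [norm_mul, ← e, norm_mul]
  have hm := norm_nonneg (mellin (fM M) (-s))
  have : ‖s‖ ≤ 8 * T * ‖1 - cexp (-(h * s))‖ := by
    have : 8 * T * (h * ‖s‖ / 2) = ‖s‖ := by linear_combination (4 * ‖s‖) * hhT
    nlinarith
  nlinarith

noncomputable def EE (M : ℕ) (s : ℂ) : ℂ := riemannZeta s - ∑ n ∈ Icc 1 M, pw n s

lemma EE_cont (M : ℕ) {σ : ℝ} (hσ1 : σ < 1) : Continuous fun t : ℝ => EE M (σ + t * I) := by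
  unfold EE
  refine Continuous.sub ?_ ?_
  · refine continuous_iff_continuousAt.2 fun t => ?_
    have h1 : (σ + t * I : ℂ) ≠ 1 := by
      intro h; have := congrArg Complex.re h; simp at this; linarith
    exact ContinuousAt.comp (f := fun t : ℝ => (σ + t * I : ℂ)) (differentiableAt_riemannZeta h1).continuousAt (by fun_prop)
  · refine continuous_finset_sum _ fun n _ => (pw_cont n).comp (by fun_prop)

lemma mean_E {α β : ℝ} (hα : 1/2 < α) (hβ : β < 1) : ∃ C : ℝ, 0 < C ∧ ∀ M : ℕ, 1 ≤ M → ∀ B : ℝ,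
    (∀ N : ℕ, ∑ n ∈ Icc M N, (n:ℝ) ^ (-(2*α)) ≤ B) → ∀ σ, α ≤ σ → σ ≤ β → ∀ T : ℝ, 1 ≤ T →
    ∫ t in (-T)..T, ‖EE M (σ + t * I)‖ ^ 2 ≤ C * (M + T ^ (2 - 2 * α) + T * B) := by
  set b := 1 - β with hb
  have hb0 : 0 < b := by rw [hb]; linarith
  set C1 := 2 * π / b ^ 2 with hC1
  set C2 := 256 * π * rexp π with hC2
  refine ⟨C1 + C2 * (1 + 1 / b) , by positivity, ?_⟩
  intro M hM B hB σ hσα hσβ T hT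
  have hT0 : 0 < T := by linarith
  have hM0 : (0:ℝ) < M := by exact_mod_cast hM
  have hB0 : 0 ≤ B := le_trans (Finset.sum_nonneg fun _ _ => by positivity) (hB 0)
  set h := 1 / (4 * T) with hh
  have hh0 : 0 < h := by positivity
  have hhT : h * T = 1/4 := by rw [hh]; field_simp
  set F := 𝓕 (fphi M h σ) with hF
  have fi := fphi_int hM hh0 (σ := σ) (by linarith)
  have hFc : Continuous F := VectorFourier.fourierIntegral_continuous Real.continuous_fourierChar (by fun_prop) fi
  obtain ⟨fs, fb⟩ := fphi_sq hM hT hh0 hhT.le (σ := σ) (by linarith) (by linarith)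
  have pl := planch fi fs (R := T / (2 * π)) (by positivity)
  have hpt : ∀ t ∈ Set.Icc (-T) T, ‖EE M (σ + t * I)‖ ^ 2 ≤ (2 * (M / b ^ 2)) * (1 + t ^ 2)⁻¹ + 128 * T ^ 2 * ‖F (-t / (2 * π))‖ ^ 2 := by
    intro t ht
    have h1 : (σ + t * I : ℂ) ≠ 1 := by
      intro h; have := congrArg Complex.re h; simp at this; linarith
    have q1 := pole_bd hM (σ := σ) (β := β) (t := t) (by linarith) (by linarith) hσβ hβ
    have q2 := lhs_bd hM hT (σ := σ) (t := t) (by linarith) (by linarith) (abs_le.2 ht)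
    rw [EE, zid hM (by simp; linarith) h1]
    set A := (M:ℂ) ^ (1 - (σ + t * I : ℂ)) / ((σ + t * I : ℂ) - 1)
    set D := (σ + t * I : ℂ) * mellin (fM M) (-(σ + t * I : ℂ))
    have q3 := norm_sub_le A D
    have q4 : ‖D‖ ^ 2 ≤ (8 * T * ‖F (-t / (2 * π))‖) ^ 2 := pow_le_pow_left₀ (norm_nonneg _) q2 2
    have q5 : ‖A - D‖ ^ 2 ≤ (‖A‖ + ‖D‖) ^ 2 := pow_le_pow_left₀ (norm_nonneg _) q3 2
    nlinarith [sq_nonneg (‖A‖ - ‖D‖)]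
  have ic1 : Continuous fun t : ℝ => (2 * (M / b ^ 2)) * (1 + t ^ 2)⁻¹ := by
    refine continuous_const.mul (Continuous.inv₀ (by fun_prop) fun t => by positivity)
  have ic2 : Continuous fun t : ℝ => 128 * T ^ 2 * ‖F (-t / (2 * π))‖ ^ 2 := by
    have : Continuous fun t : ℝ => F (-t / (2 * π)) := hFc.comp (by fun_prop)
    fun_prop
  have I0 : ∫ t in (-T)..T, ‖EE M (σ + t * I)‖ ^ 2 ≤ ∫ t in (-T)..T, ((2 * (M / b ^ 2)) * (1 + t ^ 2)⁻¹ + 128 * T ^ 2 * ‖F (-t / (2 * π))‖ ^ 2) :=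
    intervalIntegral.integral_mono_on (by linarith) (((EE_cont M (by linarith)).norm.pow 2).intervalIntegrable _ _)
      ((ic1.add ic2).intervalIntegrable _ _) hpt
  rw [intervalIntegral.integral_add (ic1.intervalIntegrable _ _) (ic2.intervalIntegrable _ _), intervalIntegral.integral_const_mul, intervalIntegral.integral_const_mul] at I0
  have I1 : ∫ t in (-T)..T, (1 + t ^ 2)⁻¹ ≤ π := by
    rw [integral_inv_one_add_sq]
    have := Real.arctan_lt_pi_div_two T
    have := Real.neg_pi_div_two_lt_arctan (-T)
    linarith
  have I2 : ∫ t in (-T)..T, ‖F (-t / (2 * π))‖ ^ 2 = (2 * π) * ∫ ξ in (-(T / (2 * π)))..(T / (2 * π)), ‖F ξ‖ ^ 2 := by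
    have := intervalIntegral.integral_comp_mul_left (a := -T) (b := T) (fun x => ‖F x‖ ^ 2) (c := -(1 / (2 * π))) (neg_ne_zero.2 (by positivity))
    have e : ∀ t : ℝ, -t / (2 * π) = -(1 / (2 * π)) * t := fun t => by ring
    simp_rw [e]
    rw [this, smul_eq_mul, intervalIntegral.integral_symm]
    rw [show -(1 / (2 * π)) * -T = T / (2 * π) by ring, show -(1 / (2 * π)) * T = -(T / (2 * π)) by ring]
    rw [inv_neg, one_div, inv_inv]; ring
  rw [I2] at I0
  have hT2 : T ^ 2 * T ^ (-(2 * σ)) = T ^ (2 - 2 * σ) := by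
    rw [← Real.rpow_natCast, ← Real.rpow_add hT0]; norm_num; ring_nf
  have hTα : T ^ (2 - 2 * σ) ≤ T ^ (2 - 2 * α) := Real.rpow_le_rpow_of_exponent_le hT (by linarith)
  set X := T ^ (2 - 2 * α)
  have hX0 : 0 ≤ X := by positivity
  have hsumB : ∑ n ∈ Icc M ⌊T⌋₊, (n:ℝ) ^ (-(2*σ)) ≤ B := by
    refine le_trans (Finset.sum_le_sum fun n hn => ?_) (hB ⌊T⌋₊)
    refine Real.rpow_le_rpow_of_exponent_le ?_ (by linarith)
    exact_mod_cast hM.trans (Finset.mem_Icc.1 hn).1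
  have key : T ^ 2 * ∫ u, ‖fphi M h σ u‖ ^ 2 ≤ X * (1 + 1 / b) + T * B := by
    have hT2h : T ^ 2 * h ^ 2 = 1/16 := by rw [← mul_pow, mul_comm T h, hhT]; norm_num
    have k1 : T ^ (2 - 2 * σ) / (2 - 2 * σ) ≤ X / b :=
      div_le_div₀ hX0 hTα hb0 (by rw [hb]; linarith)
    calc T ^ 2 * ∫ u, ‖fphi M h σ u‖ ^ 2 ≤ T ^ 2 * (T ^ (-(2*σ)) + h ^ 2 * (T ^ (2 - 2 * σ) / (2 - 2 * σ)) + h * ∑ n ∈ Icc M ⌊T⌋₊, (n:ℝ) ^ (-(2*σ))) := by gcongr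
      _ = T ^ (2 - 2 * σ) + 1/16 * (T ^ (2 - 2 * σ) / (2 - 2 * σ)) + T / 4 * ∑ n ∈ Icc M ⌊T⌋₊, (n:ℝ) ^ (-(2*σ)) := by
          rw [← hT2, ← hT2h, ← show (h * T) * T = T / 4 by rw [hhT]; ring]; ring
      _ ≤ X + 1/16 * (X / b) + T / 4 * B := by gcongr
      _ ≤ X * (1 + 1 / b) + T * B := by
          have : 0 ≤ X / b := by positivity
          have : 0 ≤ T * B := by positivity
          rw [mul_add, mul_one_div]; linarith
  have pl2 : T ^ 2 * ∫ ξ in (-(T / (2 * π)))..(T / (2 * π)), ‖F ξ‖ ^ 2 ≤ rexp π * (X * (1 + 1 / b) + T * B) := by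
    calc _ ≤ T ^ 2 * (rexp π * ∫ u, ‖fphi M h σ u‖ ^ 2) := by gcongr
      _ = rexp π * (T ^ 2 * ∫ u, ‖fphi M h σ u‖ ^ 2) := by ring
      _ ≤ _ := by gcongr
  have hib : 0 ≤ 1 / b := by positivity
  have hTB : 0 ≤ T * B := by positivity
  calc _ ≤ _ := I0
    _ ≤ 2 * (M / b ^ 2) * π + 256 * π * (rexp π * (X * (1 + 1 / b) + T * B)) := by
        have a1 : 2 * (M / b ^ 2) * ∫ t in (-T)..T, (1 + t ^ 2)⁻¹ ≤ 2 * (M / b ^ 2) * π := by gcongr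
        have a2 := mul_le_mul_of_nonneg_left pl2 (show 0 ≤ 256 * π by positivity)
        linarith
    _ = C1 * M + C2 * (X * (1 + 1 / b) + T * B) := by rw [hC1, hC2]; ring
    _ ≤ _ := by
        have c1 : 0 ≤ C1 := by positivity
        have c2 : 0 ≤ C2 := by positivity
        have z1 : 0 ≤ C1 * (X + T * B) := by positivity
        have z2 : 0 ≤ C2 * (1 + 1 / b) * M := by positivity
        have z3 : 0 ≤ C2 * (1 / b) * (T * B) := by positivity
        nlinarith

end LZ

namespace LZ

noncomputable def ZS (S : Finset ℕ) (M : ℕ) (s : ℂ) : ℂ :=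
  ∑ n ∈ (Icc 1 M).filter (fun n => ∀ p ∈ S, ¬ p ∣ n), pw n s

noncomputable def ES (S : Finset ℕ) (M : ℕ) (s : ℂ) : ℂ :=
  riemannZeta s * ∏ p ∈ S, (1 - pw p s) - ZS S M s

lemma pw_mul {m n : ℕ} (hm : 1 ≤ m) (hn : 1 ≤ n) (s : ℂ) : pw (m * n) s = pw m s * pw n s := by
  have h1 : (m:ℝ) ≠ 0 := by exact_mod_cast (by omega : m ≠ 0)
  have h2 : (n:ℝ) ≠ 0 := by exact_mod_cast (by omega : n ≠ 0)
  unfold pw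
  rw [← Complex.exp_add]; congr 1
  rw [show Real.log ((m * n : ℕ) : ℝ) = Real.log m + Real.log n by rw [Nat.cast_mul, Real.log_mul h1 h2], Complex.ofReal_add]
  ring

lemma ZS_insert {S : Finset ℕ} (hS : ∀ q ∈ S, q.Prime) {p : ℕ} (hp : p.Prime) (hpS : p ∉ S) (M : ℕ) (s : ℂ) :
    ZS (insert p S) M s = ZS S M s - pw p s * ZS S (M / p) s := by
  unfold ZS
  have hp0 := hp.pos
  rw [eq_sub_iff_add_eq, Finset.mul_sum]
  rw [← Finset.sum_filter_add_sum_filter_not ((Icc 1 M).filter (fun n => ∀ q ∈ S, ¬ q ∣ n)) (fun n => ¬ p ∣ n)]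
  congr 1
  · refine Finset.sum_congr ?_ fun _ _ => rfl
    ext n; simp only [Finset.mem_filter, Finset.mem_insert, forall_eq_or_imp]; tauto
  · refine Finset.sum_bij (fun m _ => p * m) ?_ ?_ ?_ ?_
    · intro m hm
      simp only [Finset.mem_filter, Finset.mem_Icc] at hm ⊢
      obtain ⟨⟨h1, h2⟩, h3⟩ := hm
      refine ⟨⟨⟨Nat.mul_pos hp0 h1, ?_⟩, ?_⟩, by simp⟩
      · rw [mul_comm]; exact (Nat.le_div_iff_mul_le hp0).1 h2
      · intro q hq hd
        rcases (hS q hq).dvd_mul.1 hd with h | h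
        · exact hpS (((Nat.prime_dvd_prime_iff_eq (hS q hq) hp).1 h) ▸ hq)
        · exact h3 q hq h
    · intro m1 _ m2 _ h; exact Nat.eq_of_mul_eq_mul_left hp0 h
    · intro n hn
      simp only [Finset.mem_filter, Finset.mem_Icc, not_not] at hn
      obtain ⟨⟨⟨h1, h2⟩, h3⟩, m, rfl⟩ := hn
      refine ⟨m, ?_, rfl⟩
      simp only [Finset.mem_filter, Finset.mem_Icc]
      refine ⟨⟨Nat.pos_of_mul_pos_left h1, ?_⟩, fun q hq hd => h3 q hq (hd.mul_left p)⟩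
      exact (Nat.le_div_iff_mul_le hp0).2 (by rw [mul_comm]; exact h2)
    · intro m hm
      simp only [Finset.mem_filter, Finset.mem_Icc] at hm
      rw [pw_mul hp0 hm.1.1]

lemma ES_insert {S : Finset ℕ} (hS : ∀ q ∈ S, q.Prime) {p : ℕ} (hp : p.Prime) (hpS : p ∉ S) (M : ℕ) (s : ℂ) :
    ES (insert p S) M s = ES S M s - pw p s * ES S (M / p) s := by
  unfold ES
  rw [ZS_insert hS hp hpS, Finset.prod_insert hpS]; ring

lemma ES_empty (M : ℕ) (s : ℂ) : ES ∅ M s = EE M s := by simp [ES, ZS, EE]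

lemma zeta_cont {s : ℂ} (hs : s.re < 1) : Continuous fun t : ℝ => riemannZeta (s + t * I) := by
  refine continuous_iff_continuousAt.2 fun t => ?_
  have h1 : (s + t * I : ℂ) ≠ 1 := by
    intro h; have := congrArg Complex.re h; simp at this; linarith
  exact ContinuousAt.comp (f := fun t : ℝ => (s + t * I : ℂ)) (differentiableAt_riemannZeta h1).continuousAt (by fun_prop)

lemma ZS_cont (S : Finset ℕ) (M : ℕ) : Continuous (ZS S M) :=
  continuous_finset_sum _ fun n _ => pw_cont n

lemma ES_cont (S : Finset ℕ) (M : ℕ) {s : ℂ} (hs : s.re < 1) : Continuous fun t : ℝ => ES S M (s + t * I) := by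
  unfold ES
  refine Continuous.sub ((zeta_cont hs).mul ?_) ((ZS_cont S M).comp (by fun_prop))
  refine continuous_finset_prod _ fun p _ => continuous_const.sub ((pw_cont p).comp (by fun_prop))

lemma tail_small {α : ℝ} (hα : 1/2 < α) {δ : ℝ} (hδ : 0 < δ) : ∃ M0 : ℕ, 1 ≤ M0 ∧ ∀ M, M0 ≤ M → ∀ N : ℕ, ∑ n ∈ Icc M N, (n:ℝ) ^ (-(2*α)) ≤ δ := by
  have hs : Summable fun n : ℕ => (n:ℝ) ^ (-(2*α)) := Real.summable_nat_rpow.2 (by linarith)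
  obtain ⟨s, hs⟩ := summable_iff_vanishing_norm.1 hs δ hδ
  refine ⟨s.sup id + 1, by omega, fun M hM N => ?_⟩
  have hd : Disjoint (Icc M N) s := by
    rw [Finset.disjoint_left]; intro n hn hns
    have : n ≤ s.sup id := Finset.le_sup (f := id) hns
    have := (Finset.mem_Icc.1 hn).1; omega
  exact (le_abs_self _).trans (hs _ hd).le

lemma mean_base {α β H : ℝ} (hα : 1/2 < α) (hβ : β < 1) (hH : 0 ≤ H) {η : ℝ} (hη : 0 < η) :
    ∃ M0 : ℕ, ∀ M, M0 ≤ M → ∀ᶠ T : ℝ in atTop, ∀ s ∈ Rect α β H, ∫ t in (-T)..T, ‖EE M (s + t * I)‖ ^ 2 ≤ η * T := by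
  obtain ⟨C, hC, hE⟩ := mean_E hα hβ
  set δ := η / (6 * C) with hδ
  have hδ0 : 0 < δ := by positivity
  obtain ⟨M0, hM0, ht⟩ := tail_small hα hδ0
  refine ⟨M0, fun M hM => ?_⟩
  have e1 : ∀ᶠ T : ℝ in atTop, T ^ (2 - 2 * α) ≤ δ * T := by
    have := (tendsto_rpow_neg_atTop (y := 2 * α - 1) (by linarith)).eventually (eventually_le_nhds hδ0)
    filter_upwards [this, eventually_ge_atTop 1] with T h1 h2
    have : T ^ (2 - 2 * α) = T ^ (-(2 * α - 1)) * T := by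
      rw [← Real.rpow_add_one (by linarith)]; congr 1; ring
    rw [this]; gcongr
  have e2 : ∀ᶠ T : ℝ in atTop, (M:ℝ) ≤ δ * T := (tendsto_id.const_mul_atTop hδ0).eventually_ge_atTop _
  have e3 := (e1.and e2)
  have e4 := (tendsto_atTop_add_const_right atTop H tendsto_id).eventually e3
  filter_upwards [e4, eventually_ge_atTop 1, eventually_ge_atTop H] with T h1 h2 h3 s hs
  simp only [id] at h1
  have hc : ∀ t : ℝ, s + t * I = (s.re : ℂ) + ((s.im + t : ℝ) : ℂ) * I := by
    intro t; apply Complex.ext <;> simp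
  simp_rw [hc]
  rw [intervalIntegral.integral_comp_add_left (fun x : ℝ => ‖EE M ((s.re : ℂ) + (x : ℂ) * I)‖ ^ 2)]
  have hcc : Continuous (fun x : ℝ => ‖EE M ((s.re : ℂ) + (x : ℂ) * I)‖ ^ 2) := (EE_cont M (by linarith [hs.2.1])).norm.pow 2
  have h4 := hE M (hM0.trans hM) δ (ht M hM) s.re hs.1 hs.2.1 (T + H) (by linarith)
  have h5 : ∫ x in (s.im + -T)..(s.im + T), ‖EE M ((s.re : ℂ) + (x : ℂ) * I)‖ ^ 2 ≤ ∫ x in (-(T+H))..(T+H), ‖EE M ((s.re : ℂ) + (x : ℂ) * I)‖ ^ 2 := by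
    refine intervalIntegral.integral_mono_interval (by linarith [hs.2.2.1]) (by linarith) (by linarith [hs.2.2.2]) (ae_of_all _ fun x => by positivity) (hcc.intervalIntegrable _ _)
  refine h5.trans (h4.trans ?_)
  have : C * (M + (T + H) ^ (2 - 2 * α) + (T + H) * δ) ≤ C * (6 * δ * T) := by
    gcongr
    nlinarith
  refine this.trans (le_of_eq ?_)
  rw [hδ]; field_simp

lemma mean_S {α β H : ℝ} (hα : 1/2 < α) (hβ : β < 1) (hH : 0 ≤ H) (S : Finset ℕ) (hS : ∀ q ∈ S, q.Prime) :
    ∀ η : ℝ, 0 < η →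
    ∃ M0 : ℕ, ∀ M, M0 ≤ M → ∀ᶠ T : ℝ in atTop, ∀ s ∈ Rect α β H, ∫ t in (-T)..T, ‖ES S M (s + t * I)‖ ^ 2 ≤ η * T := by
  induction S using Finset.induction_on with
  | empty =>
    intro η hη
    simp_rw [ES_empty]
    exact mean_base hα hβ hH hη
  | insert p S hpS ih =>
    intro η hη
    have hp := hS p (Finset.mem_insert_self _ _)
    have hS' : ∀ q ∈ S, q.Prime := fun q hq => hS q (Finset.mem_insert_of_mem hq)
    obtain ⟨M0, hM0⟩ := ih hS' (η / 4) (by positivity)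
    refine ⟨p * M0, fun M hM => ?_⟩
    have hM1 : M0 ≤ M := le_trans (Nat.le_mul_of_pos_left _ hp.pos) hM
    have hM2 : M0 ≤ M / p := (Nat.le_div_iff_mul_le hp.pos).2 (by rw [mul_comm]; exact hM)
    filter_upwards [hM0 M hM1, hM0 _ hM2, eventually_ge_atTop 0] with T h1 h2 h3 s hs
    have c0 := ((ES_cont (insert p S) M (s := s) (by linarith [hs.2.1])).norm.pow 2)
    have c1 : Continuous (fun t : ℝ => 2 * ‖ES S M (s + t * I)‖ ^ 2) := ((ES_cont S M (s := s) (by linarith [hs.2.1])).norm.pow 2).const_mul 2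
    have c2 : Continuous (fun t : ℝ => 2 * ‖ES S (M/p) (s + t * I)‖ ^ 2) := ((ES_cont S (M/p) (s := s) (by linarith [hs.2.1])).norm.pow 2).const_mul 2
    calc _ ≤ ∫ t in (-T)..T, (2 * ‖ES S M (s + t * I)‖ ^ 2 + 2 * ‖ES S (M/p) (s + t * I)‖ ^ 2) := by
          refine intervalIntegral.integral_mono_on (by linarith) (c0.intervalIntegrable _ _) ((c1.add c2).intervalIntegrable _ _) fun t _ => ?_
          rw [ES_insert hS' hp hpS]
          set A := ES S M (s + t * I)
          set B := ES S (M/p) (s + t * I)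
          have hpw : ‖pw p (s + t * I)‖ ≤ 1 := (pw_lt hp.two_le (by simp; linarith [hs.1])).trans (by norm_num)
          have : ‖A - pw p (s + t * I) * B‖ ≤ ‖A‖ + ‖B‖ := by
            refine (norm_sub_le _ _).trans ?_
            rw [norm_mul]
            have := mul_le_mul_of_nonneg_right hpw (norm_nonneg B)
            linarith
          have : ‖A - pw p (s + t * I) * B‖ ^ 2 ≤ (‖A‖ + ‖B‖) ^ 2 := pow_le_pow_left₀ (norm_nonneg _) this 2
          nlinarith [sq_nonneg (‖A‖ - ‖B‖)]
      _ = 2 * (∫ t in (-T)..T, ‖ES S M (s + t * I)‖ ^ 2) + 2 * ∫ t in (-T)..T, ‖ES S (M/p) (s + t * I)‖ ^ 2 := by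
          rw [intervalIntegral.integral_add (c1.intervalIntegrable _ _) (c2.intervalIntegrable _ _), intervalIntegral.integral_const_mul, intervalIntegral.integral_const_mul]
      _ ≤ η * T := by
          have := h1 s hs; have := h2 s hs; linarith

lemma mean_Sa {α β H : ℝ} (hα : 1/2 < α) (hβ : β < 1) (hH : 0 ≤ H) (S : Finset ℕ) (hS : ∀ q ∈ S, q.Prime)
    {a : ℝ} (ha : a ≠ 0) {η : ℝ} (hη : 0 < η) :
    ∃ M0 : ℕ, ∀ M, M0 ≤ M → ∀ᶠ T : ℝ in atTop, ∀ s ∈ Rect α β H, ∫ t in (0:ℝ)..T, ‖ES S M (s + (a * t : ℝ) * I)‖ ^ 2 ≤ η * T := by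
  obtain ⟨M0, h⟩ := mean_S hα hβ hH S hS η hη
  refine ⟨M0, fun M hM => ?_⟩
  have ha0 : 0 < |a| := abs_pos.2 ha
  have := (tendsto_id.const_mul_atTop ha0).eventually (h M hM)
  filter_upwards [this, eventually_ge_atTop 0] with T h1 h2 s hs
  simp only [id] at h1
  have hc : Continuous (fun x : ℝ => ‖ES S M (s + x * I)‖ ^ 2) := (ES_cont S M (s := s) (by linarith [hs.2.1])).norm.pow 2
  have hc2 : Continuous (fun x : ℝ => ‖ES S M (s + (a * x : ℝ) * I)‖ ^ 2) := hc.comp (g := fun x : ℝ => ‖ES S M (s + x * I)‖ ^ 2) (f := fun x : ℝ => a * x) (by fun_prop)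
  have e1 : ∫ t in (0:ℝ)..T, ‖ES S M (s + (a * t : ℝ) * I)‖ ^ 2 ≤ ∫ t in (-T)..T, ‖ES S M (s + (a * t : ℝ) * I)‖ ^ 2 :=
    intervalIntegral.integral_mono_interval (by linarith) h2 le_rfl (ae_of_all _ fun x => by positivity) (hc2.intervalIntegrable _ _)
  have e2 : ∫ t in (-T)..T, ‖ES S M (s + (a * t : ℝ) * I)‖ ^ 2 = |a|⁻¹ * ∫ t in (-(|a| * T))..(|a| * T), ‖ES S M (s + t * I)‖ ^ 2 := by
    rw [intervalIntegral.integral_comp_mul_left (fun x : ℝ => ‖ES S M (s + x * I)‖ ^ 2) ha, smul_eq_mul]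
    rcases lt_or_gt_of_ne ha with h | h
    · rw [abs_of_neg h, intervalIntegral.integral_symm, inv_neg]
      rw [show a * -T = -a * T by ring, show -(-a * T) = a * T by ring]; ring
    · rw [abs_of_pos h, mul_neg]
  rw [e2] at e1
  refine e1.trans ?_
  have := h1 s hs
  calc _ ≤ |a|⁻¹ * (η * (|a| * T)) := by gcongr
    _ = η * T := by field_simp

end LZ

namespace LZ

lemma mv {ι : Type*} [DecidableEq ι] (J : Finset ι) (lam : ι → ℝ) (hinj : Set.InjOn lam J) :
    ∃ C : ℝ, 0 ≤ C ∧ ∀ c : ι → ℂ, (∀ i ∈ J, ‖c i‖ ≤ 1) → ∀ T : ℝ, 0 ≤ T →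
      |(∫ τ in (0:ℝ)..T, ‖∑ i ∈ J, c i * cexp (-((lam i : ℝ) * (τ * I)))‖ ^ 2) - T * ∑ i ∈ J, ‖c i‖ ^ 2| ≤ C := by
  refine ⟨∑ i ∈ J, ∑ j ∈ J, if i = j then 0 else 2 / |lam i - lam j|, ?_, ?_⟩
  · exact Finset.sum_nonneg fun i _ => Finset.sum_nonneg fun j _ => by split_ifs <;> positivity
  intro c hc T hT
  have hpt : ∀ τ : ℝ, ((‖∑ i ∈ J, c i * cexp (-((lam i : ℝ) * (τ * I)))‖ ^ 2 : ℝ) : ℂ) =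
      ∑ i ∈ J, ∑ j ∈ J, (c i * (starRingEnd ℂ) (c j)) * cexp ((-((lam i - lam j : ℝ) * I)) * τ) := by
    intro τ
    push_cast
    rw [← Complex.mul_conj', map_sum, Finset.sum_mul_sum]
    refine Finset.sum_congr rfl fun i _ => Finset.sum_congr rfl fun j _ => ?_
    rw [map_mul, ← Complex.exp_conj]
    rw [show c i * cexp (-((lam i : ℝ) * (τ * I))) * ((starRingEnd ℂ) (c j) * cexp ((starRingEnd ℂ) (-((lam j : ℝ) * (τ * I)))))
      = (c i * (starRingEnd ℂ) (c j)) * (cexp (-((lam i : ℝ) * (τ * I))) * cexp ((starRingEnd ℂ) (-((lam j : ℝ) * (τ * I))))) by ring, ← Complex.exp_add]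
    congr 2
    simp only [map_neg, map_mul, conj_ofReal, conj_I]
    push_cast; ring
  have hcont : ∀ w : ℂ, IntervalIntegrable (fun τ : ℝ => cexp (w * τ)) volume 0 T := fun w =>
    (by fun_prop : Continuous fun τ : ℝ => cexp (w * τ)).intervalIntegrable _ _
  have hI : ((∫ τ in (0:ℝ)..T, ‖∑ i ∈ J, c i * cexp (-((lam i : ℝ) * (τ * I)))‖ ^ 2 : ℝ) : ℂ) =
      ∑ i ∈ J, ∑ j ∈ J, (c i * (starRingEnd ℂ) (c j)) * ∫ τ in (0:ℝ)..T, cexp ((-((lam i - lam j : ℝ) * I)) * τ) := by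
    rw [← intervalIntegral.integral_ofReal]
    simp_rw [hpt]
    rw [intervalIntegral.integral_finset_sum]
    · refine Finset.sum_congr rfl fun i _ => ?_
      rw [intervalIntegral.integral_finset_sum]
      · exact Finset.sum_congr rfl fun j _ => intervalIntegral.integral_const_mul _ _
      · exact fun j _ => (hcont _).const_mul _
    · exact fun i _ => (by fun_prop : Continuous fun τ : ℝ => ∑ j ∈ J, (c i * (starRingEnd ℂ) (c j)) * cexp ((-((lam i - lam j : ℝ) * I)) * τ)).intervalIntegrable _ _
  have hD : ((T * ∑ i ∈ J, ‖c i‖ ^ 2 : ℝ) : ℂ) = ∑ i ∈ J, ∑ j ∈ J, if i = j then (T:ℂ) * ‖c i‖ ^ 2 else 0 := by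
    push_cast
    rw [Finset.mul_sum]
    refine Finset.sum_congr rfl fun i hi => ?_
    rw [Finset.sum_ite_eq, if_pos hi]
  rw [← Real.norm_eq_abs, ← Complex.norm_real, Complex.ofReal_sub, hI, hD, ← Finset.sum_sub_distrib]
  refine norm_sum_le_of_le _ fun i hi => ?_
  rw [← Finset.sum_sub_distrib]
  refine norm_sum_le_of_le _ fun j hj => ?_
  split_ifs with hij
  · subst hij
    rw [Complex.mul_conj']
    simp [mul_comm]
  · have hne : lam i - lam j ≠ 0 := sub_ne_zero.2 fun h => hij (hinj hi hj h)
    have hw : -((lam i - lam j : ℝ) * I : ℂ) ≠ 0 := by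
      simp only [ne_eq, neg_eq_zero, mul_eq_zero, I_ne_zero, or_false]; exact_mod_cast hne
    rw [sub_zero, integral_exp_mul_complex hw, norm_mul, norm_mul, norm_div, RCLike.norm_conj]
    have n1 : ‖-((lam i - lam j : ℝ) * I : ℂ)‖ = |lam i - lam j| := by
      rw [norm_neg, norm_mul, Complex.norm_real, Complex.norm_I, mul_one, Real.norm_eq_abs]
    rw [n1]
    have n2 : ∀ x : ℝ, ‖cexp (-((lam i - lam j : ℝ) * I : ℂ) * x)‖ = 1 := by
      intro x
      rw [Complex.norm_exp]; simp
    have n3 : ‖cexp (-((lam i - lam j : ℝ) * I : ℂ) * T) - cexp (-((lam i - lam j : ℝ) * I : ℂ) * (0:ℝ))‖ ≤ 2 := by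
      refine (norm_sub_le _ _).trans ?_
      rw [n2, n2]; norm_num
    calc _ ≤ 1 * (2 / |lam i - lam j|) := by
          gcongr
          exact mul_le_one₀ (hc i hi) (norm_nonneg _) (hc j hj)
      _ = _ := one_mul _

noncomputable def cc (y : ℕ → ℂ) (n : ℕ) : ℂ := n.factorization.prod fun p k => y p ^ k

lemma cc_mul (y : ℕ → ℂ) {m n : ℕ} (hm : m ≠ 0) (hn : n ≠ 0) : cc y (m * n) = cc y m * cc y n := by
  unfold cc
  rw [Nat.factorization_mul hm hn, Finsupp.prod_add_index' (by simp) (by intros; rw [pow_add])]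

lemma cc_pow (y : ℕ → ℂ) {p : ℕ} (hp : p.Prime) (k : ℕ) : cc y (p ^ k) = y p ^ k := by
  unfold cc
  rw [hp.factorization_pow, Finsupp.prod_single_index (by simp)]

lemma cc_norm {y : ℕ → ℂ} (hy : ∀ p, ‖y p‖ = 1) (n : ℕ) : ‖cc y n‖ = 1 := by
  unfold cc Finsupp.prod
  rw [norm_prod]
  exact Finset.prod_eq_one fun p _ => by rw [norm_pow, hy, one_pow]

lemma pw_pow {p : ℕ} (hp : 1 ≤ p) (k : ℕ) (s : ℂ) : pw (p ^ k) s = pw p s ^ k := by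
  induction k with
  | zero => simp [pw]
  | succ k ih => rw [pow_succ, pw_mul (Nat.one_le_pow _ _ hp) hp, ih, pow_succ]

noncomputable def DD (L : ℕ) (S : Finset ℕ) (y : ℕ → ℂ) (τ : ℝ) : ℂ :=
  ∏ p ∈ S, ∑ k ∈ range L, (y p * pw p (τ * I)) ^ k

lemma DD_rep (L : ℕ) (S : Finset ℕ) (hS : ∀ q ∈ S, q.Prime) :
    ∃ N : Finset ℕ, (∀ n ∈ N, 1 ≤ n ∧ ∀ q : ℕ, q.Prime → q ∣ n → q ∈ S) ∧ N.card = L ^ S.card ∧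
      ∀ (y : ℕ → ℂ) (τ : ℝ), DD L S y τ = ∑ n ∈ N, cc y n * pw n (τ * I) := by
  induction S using Finset.induction_on with
  | empty =>
    refine ⟨{1}, ?_, by simp, ?_⟩
    · intro n hn
      rw [Finset.mem_singleton] at hn; subst hn
      refine ⟨le_rfl, fun q hq hd => absurd (Nat.dvd_one.1 hd) hq.one_lt.ne'⟩
    · intro y τ; simp [DD, cc, pw]
  | insert p S hpS ih =>
    have hp := hS p (Finset.mem_insert_self _ _)
    obtain ⟨N, h1, h2, h3⟩ := ih fun q hq => hS q (Finset.mem_insert_of_mem hq)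
    have hpn : ∀ n ∈ N, ∀ k, Nat.Coprime (p ^ k) n := by
      intro n hn k
      exact Nat.Coprime.pow_left k ((Nat.Prime.coprime_iff_not_dvd hp).2 fun hd => hpS ((h1 n hn).2 p hp hd))
    have hinj : Set.InjOn (fun x : ℕ × ℕ => x.1 * p ^ x.2) (N ×ˢ range L : Finset (ℕ × ℕ)) := by
      rintro ⟨n, k⟩ hx ⟨n', k'⟩ hx' h
      simp only [Finset.coe_product, Set.mem_prod, Finset.mem_coe] at hx hx' h
      have d1 : p ^ k ∣ p ^ k' := (hpn n' hx'.1 k).dvd_of_dvd_mul_left (h ▸ Dvd.intro_left n rfl)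
      have d2 : p ^ k' ∣ p ^ k := (hpn n hx.1 k').dvd_of_dvd_mul_left (h ▸ Dvd.intro_left n' rfl)
      have e := Nat.dvd_antisymm d1 d2
      have ek : k = k' := Nat.pow_right_injective hp.two_le e
      subst ek
      have : n = n' := Nat.eq_of_mul_eq_mul_right (pow_pos hp.pos k) h
      rw [this]
    refine ⟨(N ×ˢ range L).image (fun x : ℕ × ℕ => x.1 * p ^ x.2), ?_, ?_, ?_⟩
    · intro m hm
      obtain ⟨⟨n, k⟩, hx, rfl⟩ := Finset.mem_image.1 hm
      rw [Finset.mem_product] at hx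
      refine ⟨Nat.mul_pos (h1 n hx.1).1 (pow_pos hp.pos k), fun q hq hd => ?_⟩
      rcases hq.dvd_mul.1 hd with h | h
      · exact Finset.mem_insert_of_mem ((h1 n hx.1).2 q hq h)
      · rw [(Nat.prime_dvd_prime_iff_eq hq hp).1 (hq.dvd_of_dvd_pow h)]; exact Finset.mem_insert_self _ _
    · rw [Finset.card_image_of_injOn hinj, Finset.card_product, h2, Finset.card_range, Finset.card_insert_of_notMem hpS, pow_succ]
    · intro y τ
      rw [Finset.sum_image hinj, Finset.sum_product, DD, Finset.prod_insert hpS]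
      have := h3 y τ
      rw [DD] at this
      rw [this, mul_comm, Finset.sum_mul_sum]
      refine Finset.sum_congr rfl fun n hn => Finset.sum_congr rfl fun k hk => ?_
      have hn1 := (h1 n hn).1
      rw [cc_mul y (by omega) (pow_pos hp.pos k).ne', cc_pow y hp, pw_mul hn1 (Nat.one_le_pow _ _ hp.pos), pw_pow hp.pos, mul_pow]
      ring

lemma DD_cont (L : ℕ) (S : Finset ℕ) (y : ℕ → ℂ) : Continuous (DD L S y) := by
  unfold DD
  refine continuous_finset_prod _ fun p _ => continuous_finset_sum _ fun k _ => ?_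
  have : Continuous fun τ : ℝ => pw p (τ * I) := (pw_cont p).comp (by fun_prop)
  fun_prop

lemma log_inj {N : Finset ℕ} (hN : ∀ n ∈ N, 1 ≤ n) : Set.InjOn (fun n : ℕ => Real.log n) N := by
  intro m hm n hn h
  have h1 : (0:ℝ) < m := by exact_mod_cast hN m hm
  have h2 : (0:ℝ) < n := by exact_mod_cast hN n hn
  have := Real.log_injOn_pos h1 h2 h
  exact_mod_cast this

lemma pw_one_norm {p : ℕ} (hp : 1 ≤ p) (τ : ℝ) : ‖pw p (τ * I)‖ = 1 := by rw [pw_norm hp]; simp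

lemma DD_le (L : ℕ) (S : Finset ℕ) (hS : ∀ q ∈ S, q.Prime) {y : ℕ → ℂ} (hy : ∀ p, ‖y p‖ = 1) (τ : ℝ) :
    ‖DD L S y τ‖ ≤ (L:ℝ) ^ S.card := by
  unfold DD
  rw [norm_prod, ← Finset.prod_const]
  refine Finset.prod_le_prod (fun _ _ => norm_nonneg _) fun p hp => ?_
  refine (norm_sum_le _ _).trans ?_
  rw [Finset.sum_congr rfl (g := fun _ => (1:ℝ))]
  · simp
  · intro k _; rw [norm_pow, norm_mul, hy, pw_one_norm (hS p hp).one_le, one_mul, one_pow]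

lemma DD_mean (L : ℕ) (S : Finset ℕ) (hS : ∀ q ∈ S, q.Prime) {y : ℕ → ℂ} (hy : ∀ p, ‖y p‖ = 1) :
    ∃ C : ℝ, 0 ≤ C ∧ ∀ T : ℝ, 0 ≤ T → |(∫ τ in (0:ℝ)..T, ‖DD L S y τ‖ ^ 2) - T * (L:ℝ) ^ S.card| ≤ C := by
  obtain ⟨N, h1, h2, h3⟩ := DD_rep L S hS
  obtain ⟨C, hC, h⟩ := mv N (fun n => Real.log n) (log_inj fun n hn => (h1 n hn).1)
  refine ⟨C, hC, fun T hT => ?_⟩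
  have := h (cc y) (fun n _ => (cc_norm hy n).le) T hT
  simp_rw [h3]
  simp only [cc_norm hy, one_pow, Finset.sum_const, h2, nsmul_eq_mul, mul_one] at this
  exact_mod_cast this

lemma DD_one (L : ℕ) (S : Finset ℕ) (hS : ∀ q ∈ S, q.Prime) {y : ℕ → ℂ} (hy : ∀ p, ‖y p‖ = 1) {p : ℕ} (hp : p ∈ S) (τ : ℝ) :
    ‖DD L S y τ‖ ^ 2 * ‖1 - y p * pw p (τ * I)‖ ^ 2 ≤ 4 * ‖DD L (S.erase p) y τ‖ ^ 2 := by
  have e : DD L S y τ * (1 - y p * pw p (τ * I)) = (1 - (y p * pw p (τ * I)) ^ L) * DD L (S.erase p) y τ := by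
    unfold DD
    rw [← Finset.mul_prod_erase S _ hp]
    have := geom_sum_mul_neg (y p * pw p (τ * I)) L
    rw [← this]; ring
  rw [← mul_pow, ← norm_mul, e, norm_mul, mul_pow]
  have : ‖1 - (y p * pw p (τ * I)) ^ L‖ ≤ 2 := by
    refine (norm_sub_le _ _).trans ?_
    rw [norm_pow, norm_mul, hy, pw_one_norm (hS p hp).one_le]; norm_num
  have : ‖1 - (y p * pw p (τ * I)) ^ L‖ ^ 2 ≤ 4 := by
    calc _ ≤ (2:ℝ)^2 := pow_le_pow_left₀ (norm_nonneg _) this 2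
      _ = 4 := by norm_num
  gcongr

lemma mixed_inj {S N Mm : Finset ℕ} (hN : ∀ n ∈ N, 1 ≤ n ∧ ∀ q : ℕ, q.Prime → q ∣ n → q ∈ S)
    (hM : ∀ m ∈ Mm, 1 ≤ m ∧ ∀ q ∈ S, ¬ q ∣ m) {a : ℤ} (ha : a ≠ 0) :
    Set.InjOn (fun x : ℕ × ℕ => Real.log x.1 + a * Real.log x.2) (N ×ˢ Mm : Finset (ℕ × ℕ)) := by
  have cop : ∀ n ∈ N, ∀ m ∈ Mm, ∀ k, Nat.Coprime n (m ^ k) := by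
    intro n hn m hm k
    refine Nat.Coprime.pow_right k (Nat.Coprime.symm (Nat.coprime_of_dvd fun q hq h1 h2 => ?_))
    exact (hM m hm).2 q ((hN n hn).2 q hq h2) h1
  -- core
  have core : ∀ n ∈ N, ∀ n' ∈ N, ∀ m ∈ Mm, ∀ m' ∈ Mm, ∀ k : ℕ, k ≠ 0 → n * m ^ k = n' * m' ^ k → n = n' ∧ m = m' := by
    intro n hn n' hn' m hm m' hm' k hk h
    have d1 : n ∣ n' := (cop n hn m' hm' k).dvd_of_dvd_mul_right (h ▸ Dvd.intro _ rfl)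
    have d2 : n' ∣ n := (cop n' hn' m hm k).dvd_of_dvd_mul_right (h ▸ Dvd.intro _ rfl)
    have e := Nat.dvd_antisymm d1 d2
    subst e
    refine ⟨rfl, ?_⟩
    have := Nat.eq_of_mul_eq_mul_left (hN n hn).1 h
    exact Nat.pow_left_injective hk this
  have lg : ∀ n : ℕ, 1 ≤ n → ∀ m : ℕ, 1 ≤ m → ∀ n' : ℕ, 1 ≤ n' → ∀ m' : ℕ, 1 ≤ m' → ∀ k : ℕ,
      Real.log n + k * Real.log m = Real.log n' + k * Real.log m' → n * m ^ k = n' * m' ^ k := by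
    intro n hn m hm n' hn' m' hm' k h
    have p1 : (0:ℝ) < n := by exact_mod_cast hn
    have p2 : (0:ℝ) < m := by exact_mod_cast hm
    have p3 : (0:ℝ) < n' := by exact_mod_cast hn'
    have p4 : (0:ℝ) < m' := by exact_mod_cast hm'
    rw [← Real.log_pow, ← Real.log_pow, ← Real.log_mul p1.ne' (by positivity), ← Real.log_mul p3.ne' (by positivity)] at h
    have := Real.log_injOn_pos (show (n:ℝ) * m ^ k ∈ Set.Ioi 0 by simp; positivity) (show (n':ℝ) * m' ^ k ∈ Set.Ioi 0 by simp; positivity) h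
    exact_mod_cast this
  rintro ⟨n, m⟩ hx ⟨n', m'⟩ hx' h
  simp only [Finset.coe_product, Set.mem_prod, Finset.mem_coe] at hx hx' h
  obtain ⟨k, hk | hk⟩ := Int.eq_nat_or_neg a
  · have hk0 : k ≠ 0 := by rintro rfl; simp at hk; exact ha hk
    subst hk
    have := core n hx.1 n' hx'.1 m hx.2 m' hx'.2 k hk0 (lg n (hN n hx.1).1 m (hM m hx.2).1 n' (hN n' hx'.1).1 m' (hM m' hx'.2).1 k (by exact_mod_cast h))
    rw [this.1, this.2]
  · have hk0 : k ≠ 0 := by rintro rfl; simp at hk; exact ha hk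
    subst hk
    push_cast at h
    have := core n hx.1 n' hx'.1 m' hx'.2 m hx.2 k hk0 (lg n (hN n hx.1).1 m' (hM m' hx'.2).1 n' (hN n' hx'.1).1 m (hM m hx.2).1 k (by linarith))
    rw [this.1, this.2]

end LZ

namespace LZ

def PS (Y : ℕ) : Finset ℕ := (range Y).filter Nat.Prime

lemma PS_prime {Y q : ℕ} (h : q ∈ PS Y) : q.Prime := (Finset.mem_filter.1 h).2

noncomputable def VV (S : Finset ℕ) (s : ℂ) : ℂ := riemannZeta s * ∏ p ∈ S, (1 - pw p s) - 1

lemma DW_mean (Y L M : ℕ) (hM : 1 ≤ M) {y : ℕ → ℂ} (hy : ∀ p, ‖y p‖ = 1) {a : ℤ} (ha : a ≠ 0) {α B : ℝ} (hα : 1/2 < α)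
    (hB : ∀ N : ℕ, ∑ n ∈ Icc Y N, (n:ℝ) ^ (-(2*α)) ≤ B) :
    ∃ C : ℝ, 0 ≤ C ∧ ∀ s : ℂ, α ≤ s.re → ∀ T : ℝ, 0 ≤ T →
      ∫ τ in (0:ℝ)..T, ‖DD L (PS Y) y τ * (ZS (PS Y) M (s + (a * τ : ℝ) * I) - 1)‖ ^ 2 ≤ T * ((L:ℝ) ^ (PS Y).card * B) + C := by
  set S := PS Y with hS
  obtain ⟨N, h1, h2, h3⟩ := DD_rep L S (fun q hq => PS_prime hq)
  set Mm := (Icc 2 M).filter (fun n => ∀ p ∈ S, ¬ p ∣ n) with hMm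
  have hM1 : ∀ m ∈ Mm, 1 ≤ m ∧ ∀ q ∈ S, ¬ q ∣ m := fun m hm => by
    rw [hMm, Finset.mem_filter, Finset.mem_Icc] at hm; exact ⟨by omega, hm.2⟩
  have hMY : Mm ⊆ Icc Y M := by
    intro m hm
    have hm' := hm
    rw [hMm, Finset.mem_filter, Finset.mem_Icc] at hm'
    rw [Finset.mem_Icc]
    refine ⟨?_, hm'.1.2⟩
    by_contra hlt
    push Not at hlt
    have hq := Nat.minFac_prime (n := m) (by omega)
    have hd := Nat.minFac_dvd m
    refine hm'.2 m.minFac ?_ hd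
    rw [hS, PS, Finset.mem_filter, Finset.mem_range]
    exact ⟨lt_of_le_of_lt (Nat.le_of_dvd (by omega) hd) hlt, hq⟩
  have hZ : ∀ s, ZS S M s - 1 = ∑ m ∈ Mm, pw m s := by
    intro s
    have e : (Icc 1 M).filter (fun n => ∀ p ∈ S, ¬ p ∣ n) = insert 1 Mm := by
      ext m
      simp only [hMm, Finset.mem_filter, Finset.mem_Icc, Finset.mem_insert]
      constructor
      · rintro ⟨⟨u, v⟩, w⟩
        by_cases hm : m = 1
        · exact Or.inl hm
        · exact Or.inr ⟨⟨by omega, v⟩, w⟩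
      · rintro (rfl | ⟨⟨u, v⟩, w⟩)
        · refine ⟨⟨le_rfl, hM⟩, fun p hp hd => ?_⟩
          exact (PS_prime hp).one_lt.ne' (Nat.dvd_one.1 hd)
        · exact ⟨⟨by omega, v⟩, w⟩
    rw [ZS, e, Finset.sum_insert (by simp [hMm])]
    simp [pw]
  obtain ⟨C, hC, h⟩ := mv (N ×ˢ Mm) (fun x : ℕ × ℕ => Real.log x.1 + a * Real.log x.2) (mixed_inj h1 hM1 ha)
  refine ⟨C, hC, fun s hs T hT => ?_⟩
  have hpt : ∀ τ : ℝ, DD L S y τ * (ZS S M (s + (a * τ : ℝ) * I) - 1) =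
      ∑ x ∈ N ×ˢ Mm, (cc y x.1 * pw x.2 s) * cexp (-((Real.log x.1 + a * Real.log x.2 : ℝ) * (τ * I))) := by
    intro τ
    rw [h3, hZ, Finset.sum_mul_sum, Finset.sum_product]
    refine Finset.sum_congr rfl fun n _ => Finset.sum_congr rfl fun m _ => ?_
    unfold pw
    rw [mul_assoc, mul_assoc, ← Complex.exp_add, ← Complex.exp_add]
    congr 2
    push_cast; ring
  simp_rw [hpt]
  have hn : ∀ x ∈ N ×ˢ Mm, ‖cc y x.1 * pw x.2 s‖ ≤ 1 := by
    intro x hx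
    have := (hM1 x.2 (Finset.mem_product.1 hx).2).1
    rw [norm_mul, cc_norm hy, one_mul, pw_norm this]
    exact Real.rpow_le_one_of_one_le_of_nonpos (by exact_mod_cast this) (by linarith)
  have q := (abs_le.1 (h (fun x => cc y x.1 * pw x.2 s) hn T hT)).2
  have q2 : ∑ x ∈ N ×ˢ Mm, ‖cc y x.1 * pw x.2 s‖ ^ 2 ≤ (L:ℝ) ^ S.card * B := by
    rw [Finset.sum_product]
    calc _ ≤ ∑ n ∈ N, B := by
          refine Finset.sum_le_sum fun n _ => le_trans ?_ (hB M)
          refine (Finset.sum_le_sum fun m hm => ?_).trans (Finset.sum_le_sum_of_subset_of_nonneg hMY fun _ _ _ => by positivity)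
          have hm1 := (hM1 m hm).1
          have hm0 : (0:ℝ) < m := by exact_mod_cast hm1
          rw [norm_mul, cc_norm hy, one_mul, pw_norm hm1, ← Real.rpow_natCast, ← Real.rpow_mul hm0.le]
          exact Real.rpow_le_rpow_of_exponent_le (by exact_mod_cast hm1) (by push_cast; linarith)
      _ = _ := by rw [Finset.sum_const, h2, nsmul_eq_mul]; push_cast; ring
  have := mul_le_mul_of_nonneg_left q2 hT
  beta_reduce at q
  linarith

lemma VV_cont (S : Finset ℕ) {s : ℂ} (hs : s.re < 1) : Continuous fun t : ℝ => VV S (s + t * I) := by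
  unfold VV
  refine Continuous.sub ((zeta_cont hs).mul ?_) continuous_const
  refine continuous_finset_prod _ fun p _ => continuous_const.sub ((pw_cont p).comp (by fun_prop))

lemma DV_mean (Y L : ℕ) (hL : 1 ≤ L) {y : ℕ → ℂ} (hy : ∀ p, ‖y p‖ = 1) {a : ℤ} (ha : a ≠ 0) {α β H B : ℝ} (hα : 1/2 < α)
    (hβ : β < 1) (hH : 0 ≤ H) (hB0 : 0 < B)
    (hB : ∀ N : ℕ, ∑ n ∈ Icc Y N, (n:ℝ) ^ (-(2*α)) ≤ B) :
    ∀ᶠ T : ℝ in atTop, ∀ s ∈ Rect α β H,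
      ∫ τ in (0:ℝ)..T, ‖DD L (PS Y) y τ‖ ^ 2 * ‖VV (PS Y) (s + (a * τ : ℝ) * I)‖ ^ 2 ≤ 5 * ((L:ℝ) ^ (PS Y).card * B) * T := by
  set S := PS Y with hS
  have hSp : ∀ q ∈ S, q.Prime := fun q hq => PS_prime hq
  set X : ℝ := (L:ℝ) ^ S.card with hX
  have hX0 : 0 < X := pow_pos (by exact_mod_cast hL) _
  obtain ⟨M0, hM0⟩ := mean_Sa hα hβ hH S hSp (a := (a:ℝ)) (by exact_mod_cast ha) (η := B / X) (by positivity)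
  set M := M0 + 1
  obtain ⟨C, hC, hW⟩ := DW_mean Y L M (by omega) hy ha hα hB
  have eT : ∀ᶠ T : ℝ in atTop, 2 * C ≤ (X * B) * T := (tendsto_id.const_mul_atTop (by positivity)).eventually_ge_atTop _
  filter_upwards [hM0 M (by omega), eT, eventually_ge_atTop 0] with T h1 h2 h3 s hs
  have hsr : s.re < 1 := by linarith [hs.2.1]
  have cD := DD_cont L S y
  have ca : Continuous fun τ : ℝ => (a * τ : ℝ) := by fun_prop
  have cV : Continuous fun τ : ℝ => VV S (s + (a * τ : ℝ) * I) := (VV_cont S hsr).comp ca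
  have cE : Continuous fun τ : ℝ => ES S M (s + (a * τ : ℝ) * I) := (ES_cont S M hsr).comp ca
  have cW : Continuous fun τ : ℝ => DD L S y τ * (ZS S M (s + (a * τ : ℝ) * I) - 1) :=
    cD.mul (((ZS_cont S M).comp (by fun_prop)).sub continuous_const)
  have c0 : Continuous fun τ : ℝ => ‖DD L S y τ‖ ^ 2 * ‖VV S (s + (a * τ : ℝ) * I)‖ ^ 2 := by fun_prop
  have c1 : Continuous fun τ : ℝ => 2 * ‖DD L S y τ * (ZS S M (s + (a * τ : ℝ) * I) - 1)‖ ^ 2 := by fun_prop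
  have c2 : Continuous fun τ : ℝ => (2 * X ^ 2) * ‖ES S M (s + (a * τ : ℝ) * I)‖ ^ 2 := by fun_prop
  calc _ ≤ ∫ τ in (0:ℝ)..T, (2 * ‖DD L S y τ * (ZS S M (s + (a * τ : ℝ) * I) - 1)‖ ^ 2 + (2 * X ^ 2) * ‖ES S M (s + (a * τ : ℝ) * I)‖ ^ 2) := by
        refine intervalIntegral.integral_mono_on h3 (c0.intervalIntegrable _ _) ((c1.add c2).intervalIntegrable _ _) fun τ _ => ?_
        have e : VV S (s + (a * τ : ℝ) * I) = (ZS S M (s + (a * τ : ℝ) * I) - 1) + ES S M (s + (a * τ : ℝ) * I) := by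
          unfold VV ES; ring
        rw [e]
        set P := ZS S M (s + (a * τ : ℝ) * I) - 1
        set Q := ES S M (s + (a * τ : ℝ) * I)
        have hD := DD_le L S hSp hy τ
        have hD2 : ‖DD L S y τ‖ ^ 2 ≤ X ^ 2 := pow_le_pow_left₀ (norm_nonneg _) hD 2
        have hpq : ‖P + Q‖ ^ 2 ≤ 2 * ‖P‖ ^ 2 + 2 * ‖Q‖ ^ 2 := by
          have : ‖P + Q‖ ^ 2 ≤ (‖P‖ + ‖Q‖) ^ 2 := pow_le_pow_left₀ (norm_nonneg _) (norm_add_le _ _) 2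
          nlinarith [sq_nonneg (‖P‖ - ‖Q‖)]
        rw [norm_mul, mul_pow]
        have := mul_le_mul_of_nonneg_left hpq (sq_nonneg ‖DD L S y τ‖)
        have := mul_le_mul_of_nonneg_right hD2 (sq_nonneg ‖Q‖)
        linarith
    _ = 2 * (∫ τ in (0:ℝ)..T, ‖DD L S y τ * (ZS S M (s + (a * τ : ℝ) * I) - 1)‖ ^ 2) + (2 * X ^ 2) * ∫ τ in (0:ℝ)..T, ‖ES S M (s + (a * τ : ℝ) * I)‖ ^ 2 := by
        rw [intervalIntegral.integral_add (c1.intervalIntegrable _ _) (c2.intervalIntegrable _ _), intervalIntegral.integral_const_mul, intervalIntegral.integral_const_mul]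
    _ ≤ 2 * (T * (X * B) + C) + (2 * X ^ 2) * (B / X * T) := by
        gcongr
        · exact hW s hs.1 T h3
        · exact h1 s hs
    _ ≤ _ := by
        have : (2 * X ^ 2) * (B / X * T) = 2 * (X * B * T) := by field_simp
        rw [this]; nlinarith

noncomputable def gc (α β H t : ℝ) : ℂ := gam α β H (max 0 (min 4 t))

lemma gc_cont (α β H : ℝ) : Continuous (gc α β H) := (gam_cont α β H).comp (by fun_prop)

lemma gc_mem {α β H : ℝ} (hab : α ≤ β) (hH : 0 ≤ H) (t : ℝ) : gc α β H t ∈ Rect α β H :=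
  gam_mem hab hH ⟨le_max_left _ _, max_le (by norm_num) (min_le_left _ _)⟩

lemma gc_eq {α β H t : ℝ} (ht : t ∈ Set.Icc (0:ℝ) 4) : gc α β H t = gam α β H t := by
  unfold gc; rw [min_eq_right ht.2, max_eq_right ht.1]

noncomputable def JJ (α β H : ℝ) (S : Finset ℕ) (a : ℤ) (τ : ℝ) : ℝ :=
  ∫ t in (0:ℝ)..4, ‖VV S (gc α β H t + (a * τ : ℝ) * I)‖ ^ 2

lemma JJ_cont2 {α β H : ℝ} (hab : α ≤ β) (hβ : β < 1) (hH : 0 ≤ H) (S : Finset ℕ) (a : ℤ) :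
    Continuous fun x : ℝ × ℝ => VV S (gc α β H x.2 + (a * x.1 : ℝ) * I) := by
  have hg : Continuous fun x : ℝ × ℝ => gc α β H x.2 + (a * x.1 : ℝ) * I := by
    have := gc_cont α β H
    fun_prop
  unfold VV
  refine Continuous.sub (Continuous.mul ?_ ?_) continuous_const
  · refine continuous_iff_continuousAt.2 fun x => ?_
    have h1 : gc α β H x.2 + (a * x.1 : ℝ) * I ≠ 1 := by
      intro h; have := congrArg Complex.re h
      have h2 := (gc_mem hab hH x.2).2.1
      simp at this; linarith
    exact ContinuousAt.comp (f := fun x : ℝ × ℝ => gc α β H x.2 + (a * x.1 : ℝ) * I) (differentiableAt_riemannZeta h1).continuousAt hg.continuousAt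
  · exact continuous_finset_prod _ fun p _ => continuous_const.sub ((pw_cont p).comp hg)

lemma JJ_cont {α β H : ℝ} (hab : α ≤ β) (hβ : β < 1) (hH : 0 ≤ H) (S : Finset ℕ) (a : ℤ) :
    Continuous (JJ α β H S a) := by
  unfold JJ
  have hc : Continuous fun x : ℝ × ℝ => ‖VV S (gc α β H x.2 + (a * x.1 : ℝ) * I)‖ ^ 2 := (JJ_cont2 hab hβ hH S a).norm.pow 2
  exact intervalIntegral.continuous_parametric_intervalIntegral_of_continuous' (f := fun τ t => ‖VV S (gc α β H t + (a * τ : ℝ) * I)‖ ^ 2) hc 0 4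

lemma swap_bd {F : ℝ → ℝ → ℝ} (hF : Continuous (Function.uncurry F)) {T X : ℝ} (h : ∀ t, ∫ τ in (0:ℝ)..T, F τ t ≤ X) :
    ∫ τ in (0:ℝ)..T, ∫ t in (0:ℝ)..4, F τ t ≤ 4 * X := by
  rw [intervalIntegral_intervalIntegral_swap]
  · have hc' : Continuous (Function.uncurry fun t τ : ℝ => F τ t) := hF.comp continuous_swap
    have c3 := intervalIntegral.continuous_parametric_intervalIntegral_of_continuous' (μ := volume) hc' 0 T
    calc _ ≤ ∫ t in (0:ℝ)..4, X :=
          intervalIntegral.integral_mono_on (by norm_num) (c3.intervalIntegrable _ _) (by simp) fun t _ => h t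
      _ = 4 * X := by simp
  · exact (hF.continuousOn.integrableOn_compact (isCompact_uIcc.prod isCompact_uIcc)).mono_set (Set.prod_mono Set.uIoc_subset_uIcc Set.uIoc_subset_uIcc)

lemma DJ_mean {Y L : ℕ} {y : ℕ → ℂ} {a : ℤ} {α β H X T : ℝ} (hab : α ≤ β) (hβ : β < 1) (hH : 0 ≤ H)
    (h : ∀ s ∈ Rect α β H, ∫ τ in (0:ℝ)..T, ‖DD L (PS Y) y τ‖ ^ 2 * ‖VV (PS Y) (s + (a * τ : ℝ) * I)‖ ^ 2 ≤ X) :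
    ∫ τ in (0:ℝ)..T, ‖DD L (PS Y) y τ‖ ^ 2 * JJ α β H (PS Y) a τ ≤ 4 * X := by
  unfold JJ
  simp_rw [← intervalIntegral.integral_const_mul]
  refine swap_bd (F := fun τ t => ‖DD L (PS Y) y τ‖ ^ 2 * ‖VV (PS Y) (gc α β H t + (a * τ : ℝ) * I)‖ ^ 2) ?_ fun t => h _ (gc_mem hab hH t)
  have c1 : Continuous fun x : ℝ × ℝ => ‖VV (PS Y) (gc α β H x.2 + (a * x.1 : ℝ) * I)‖ ^ 2 := (JJ_cont2 hab hβ hH (PS Y) a).norm.pow 2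
  have c2 : Continuous fun x : ℝ × ℝ => ‖DD L (PS Y) y x.1‖ ^ 2 := ((DD_cont L (PS Y) y).comp continuous_fst).norm.pow 2
  exact c2.mul c1

end LZ

namespace LZ

lemma JJ_nonneg (α β H : ℝ) (S : Finset ℕ) (a : ℤ) (τ : ℝ) : 0 ≤ JJ α β H S a τ :=
  intervalIntegral.integral_nonneg (by norm_num) fun t _ => by positivity

lemma good_set {α β H : ℝ} (hα : 1/2 < α) (hab : α ≤ β) (hβ : β < 1) (hH : 0 ≤ H) {a b : ℤ} (ha : a ≠ 0) (hb : b ≠ 0)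
    {δ : ℝ} (hδ : 0 < δ) : ∃ Y0 : ℕ, ∀ Y, Y0 ≤ Y → ∀ χ : ℕ → ℂ, (∀ p, ‖χ p‖ = 1) → ∀ δ' : ℝ, 0 < δ' →
    ∃ κ : ℝ, 0 < κ ∧ ∀ᶠ T : ℝ in atTop, κ * T ≤ (volume ({τ : ℝ | (∀ p ∈ PS Y, ‖pw p (τ * I) - χ p‖ < δ') ∧
      JJ α β H (PS Y) a τ < δ ∧ JJ α β H (PS Y) b τ < δ} ∩ Set.Ioc 0 T)).toReal := by
  set B := δ / 160 with hBd
  have hB0 : 0 < B := by positivity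
  obtain ⟨Y0, _, hY0⟩ := tail_small hα hB0
  refine ⟨Y0, fun Y hY χ hχ δ' hδ' => ?_⟩
  have hB := hY0 Y hY
  set S := PS Y with hS
  have hSp : ∀ q ∈ S, q.Prime := fun q hq => PS_prime hq
  set y : ℕ → ℂ := fun p => (starRingEnd ℂ) (χ p) with hyd
  have hy : ∀ p, ‖y p‖ = 1 := fun p => by rw [hyd]; simp [hχ]
  have hyχ : ∀ p (w : ℂ), ‖1 - y p * w‖ = ‖w - χ p‖ := by
    intro p w
    have e : χ p * y p = 1 := by rw [hyd]; simp only; rw [Complex.mul_conj', hχ]; simp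
    rw [← one_mul ‖1 - y p * w‖, ← hχ p, ← norm_mul, mul_sub, ← mul_assoc, e, mul_one, one_mul, norm_sub_rev]
  set A := 1 / δ' ^ 2 with hA
  have hA0 : 0 < A := by positivity
  obtain ⟨L, hL⟩ := exists_nat_ge (16 * A * S.card + 1)
  have hL1 : (1:ℝ) ≤ L := le_trans (by have : 0 ≤ 16 * A * S.card := by positivity
                                       linarith) hL
  have hLn : 1 ≤ L := by exact_mod_cast hL1
  set X : ℝ := (L:ℝ) ^ S.card with hX
  have hX0 : 0 < X := by positivity
  set Q : ℝ → ℝ := fun τ => A * ∑ p ∈ S, ‖1 - y p * pw p (τ * I)‖ ^ 2 + (1/δ) * (JJ α β H S a τ + JJ α β H S b τ) with hQ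
  have cJa := JJ_cont hab hβ hH S a
  have cJb := JJ_cont hab hβ hH S b
  have cD := DD_cont L S y
  have cQ : Continuous Q := by
    have : ∀ p, Continuous fun τ : ℝ => pw p (τ * I) := fun p => (pw_cont p).comp (by fun_prop)
    fun_prop
  set G : Set ℝ := {τ | Q τ < 1} with hG
  have hGo : IsOpen G := isOpen_lt cQ continuous_const
  set G0 : Set ℝ := {τ : ℝ | (∀ p ∈ S, ‖pw p (τ * I) - χ p‖ < δ') ∧ JJ α β H S a τ < δ ∧ JJ α β H S b τ < δ} with hG0
  have hQ0 : ∀ τ, 0 ≤ Q τ := fun τ => by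
    have := JJ_nonneg α β H S a τ; have := JJ_nonneg α β H S b τ
    have : 0 ≤ ∑ p ∈ S, ‖1 - y p * pw p (τ * I)‖ ^ 2 := Finset.sum_nonneg fun _ _ => by positivity
    rw [hQ]; positivity
  have hGG : G ⊆ G0 := by
    intro τ hτ
    have hτ' : A * ∑ p ∈ S, ‖1 - y p * pw p (τ * I)‖ ^ 2 + (1/δ) * (JJ α β H S a τ + JJ α β H S b τ) < 1 := hτ
    have j1 := JJ_nonneg α β H S a τ
    have j2 := JJ_nonneg α β H S b τ
    have j3 : 0 ≤ ∑ p ∈ S, ‖1 - y p * pw p (τ * I)‖ ^ 2 := Finset.sum_nonneg fun _ _ => by positivity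
    have j4 : (1/δ) * (JJ α β H S a τ + JJ α β H S b τ) < 1 := by
      have : 0 ≤ A * ∑ p ∈ S, ‖1 - y p * pw p (τ * I)‖ ^ 2 := by positivity
      linarith
    have j5 : JJ α β H S a τ + JJ α β H S b τ < δ := by
      rw [one_div, inv_mul_lt_iff₀ hδ] at j4; linarith
    refine ⟨fun p hp => ?_, by linarith, by linarith⟩
    have k1 : A * ∑ p ∈ S, ‖1 - y p * pw p (τ * I)‖ ^ 2 < 1 := by
      have : 0 ≤ (1/δ) * (JJ α β H S a τ + JJ α β H S b τ) := by positivity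
      linarith
    have k2 : ∑ p ∈ S, ‖1 - y p * pw p (τ * I)‖ ^ 2 < δ' ^ 2 := by
      rw [hA, one_div, inv_mul_lt_iff₀ (by positivity)] at k1; linarith
    have k3 := Finset.single_le_sum (f := fun p => ‖1 - y p * pw p (τ * I)‖ ^ 2) (fun _ _ => by positivity) hp
    simp only [hyχ] at k2 k3
    exact lt_of_pow_lt_pow_left₀ 2 hδ'.le (lt_of_le_of_lt k3 k2)
  -- mean values
  obtain ⟨C, hC, hmean⟩ := DD_mean L S hSp hy
  have hme : ∀ p, ∃ C : ℝ, 0 ≤ C ∧ ∀ T : ℝ, 0 ≤ T → |(∫ τ in (0:ℝ)..T, ‖DD L (S.erase p) y τ‖ ^ 2) - T * (L:ℝ) ^ (S.erase p).card| ≤ C :=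
    fun p => DD_mean L (S.erase p) (fun q hq => hSp q (Finset.mem_of_mem_erase hq)) hy
  choose Cp hCp hmp using hme
  set C' := C + A * ∑ p ∈ S, 4 * Cp p with hC'
  refine ⟨1 / (4 * X), by positivity, ?_⟩
  have eT : ∀ᶠ T : ℝ in atTop, C' ≤ (X / 4) * T := (tendsto_id.const_mul_atTop (by positivity)).eventually_ge_atTop _
  filter_upwards [DV_mean Y L hLn hy ha hα hβ hH hB0 hB, DV_mean Y L hLn hy hb hα hβ hH hB0 hB, eT, eventually_ge_atTop 0] with T h1 h2 h3 h4
  have m1 := DJ_mean hab hβ hH h1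
  have m2 := DJ_mean hab hβ hH h2
  rw [← hS, ← hX] at m1 m2
  set R : ℝ → ℝ := fun τ => ‖DD L S y τ‖ ^ 2 - A * ∑ p ∈ S, 4 * ‖DD L (S.erase p) y τ‖ ^ 2 - (1/δ) * (‖DD L S y τ‖ ^ 2 * JJ α β H S a τ) - (1/δ) * (‖DD L S y τ‖ ^ 2 * JJ α β H S b τ) with hR
  have cDp : ∀ p, Continuous (DD L (S.erase p) y) := fun p => DD_cont L (S.erase p) y
  have r1 : Continuous fun τ => ‖DD L S y τ‖ ^ 2 := by fun_prop
  have r2 : Continuous fun τ => A * ∑ p ∈ S, 4 * ‖DD L (S.erase p) y τ‖ ^ 2 := by fun_prop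
  have r3 : Continuous fun τ => (1/δ) * (‖DD L S y τ‖ ^ 2 * JJ α β H S a τ) := by fun_prop
  have r4 : Continuous fun τ => (1/δ) * (‖DD L S y τ‖ ^ 2 * JJ α β H S b τ) := by fun_prop
  have cR : Continuous R := ((r1.sub r2).sub r3).sub r4
  have hRle : ∀ τ, R τ ≤ G.indicator (fun _ => X ^ 2) τ := by
    intro τ
    have b1 : R τ ≤ ‖DD L S y τ‖ ^ 2 * (1 - Q τ) := by
      have : ‖DD L S y τ‖ ^ 2 * ∑ p ∈ S, ‖1 - y p * pw p (τ * I)‖ ^ 2 ≤ ∑ p ∈ S, 4 * ‖DD L (S.erase p) y τ‖ ^ 2 := by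
        rw [Finset.mul_sum]
        exact Finset.sum_le_sum fun p hp => DD_one L S hSp hy hp τ
      have := mul_le_mul_of_nonneg_left this hA0.le
      simp only [hR, hQ]
      nlinarith
    refine b1.trans ?_
    by_cases hg : τ ∈ G
    · rw [Set.indicator_of_mem hg]
      have hD2 : ‖DD L S y τ‖ ^ 2 ≤ X ^ 2 := pow_le_pow_left₀ (norm_nonneg _) (DD_le L S hSp hy τ) 2
      have := hQ0 τ
      have := sq_nonneg ‖DD L S y τ‖
      nlinarith
    · rw [Set.indicator_of_notMem hg]
      have : 1 ≤ Q τ := not_lt.1 hg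
      exact mul_nonpos_of_nonneg_of_nonpos (by positivity) (by linarith)
  have lower : (X / 4) * T ≤ ∫ τ in (0:ℝ)..T, R τ := by
    have e : ∫ τ in (0:ℝ)..T, R τ = (∫ τ in (0:ℝ)..T, ‖DD L S y τ‖ ^ 2) - (A * ∑ p ∈ S, 4 * ∫ τ in (0:ℝ)..T, ‖DD L (S.erase p) y τ‖ ^ 2)
        - (1/δ) * (∫ τ in (0:ℝ)..T, ‖DD L S y τ‖ ^ 2 * JJ α β H S a τ) - (1/δ) * (∫ τ in (0:ℝ)..T, ‖DD L S y τ‖ ^ 2 * JJ α β H S b τ) := by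
      have r12 : Continuous fun τ => ‖DD L S y τ‖ ^ 2 - A * ∑ p ∈ S, 4 * ‖DD L (S.erase p) y τ‖ ^ 2 := r1.sub r2
      have r123 : Continuous fun τ => ‖DD L S y τ‖ ^ 2 - A * ∑ p ∈ S, 4 * ‖DD L (S.erase p) y τ‖ ^ 2 - (1/δ) * (‖DD L S y τ‖ ^ 2 * JJ α β H S a τ) := r12.sub r3
      simp only [hR]
      rw [intervalIntegral.integral_sub (r123.intervalIntegrable _ _) (r4.intervalIntegrable _ _),
        intervalIntegral.integral_sub (r12.intervalIntegrable _ _) (r3.intervalIntegrable _ _),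
        intervalIntegral.integral_sub (r1.intervalIntegrable _ _) (r2.intervalIntegrable _ _),
        intervalIntegral.integral_const_mul, intervalIntegral.integral_const_mul, intervalIntegral.integral_const_mul,
        intervalIntegral.integral_finset_sum]
      · congr 3
        congr 1
        exact Finset.sum_congr rfl fun p _ => by rw [intervalIntegral.integral_const_mul]
      · intro p _
        have : Continuous fun τ => 4 * ‖DD L (S.erase p) y τ‖ ^ 2 := by have := cDp p; fun_prop
        exact this.intervalIntegrable _ _
    rw [e]
    have l1 := (abs_le.1 (hmean T h4)).1
    have l2 : A * ∑ p ∈ S, 4 * ∫ τ in (0:ℝ)..T, ‖DD L (S.erase p) y τ‖ ^ 2 ≤ X / 4 * T + A * ∑ p ∈ S, 4 * Cp p := by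
      have s1 : ∑ p ∈ S, 4 * ∫ τ in (0:ℝ)..T, ‖DD L (S.erase p) y τ‖ ^ 2 ≤ ∑ p ∈ S, (4 * (T * (X / L)) + 4 * Cp p) := by
        refine Finset.sum_le_sum fun p hp => ?_
        have := (abs_le.1 (hmp p T h4)).2
        have ex : (L:ℝ) ^ (S.erase p).card = X / L := by
          rw [eq_div_iff (by positivity), hX, ← pow_succ, Finset.card_erase_add_one hp]
        rw [ex] at this
        linarith
      rw [Finset.sum_add_distrib, Finset.sum_const, nsmul_eq_mul] at s1
      have s2 := mul_le_mul_of_nonneg_left s1 hA0.le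
      have s3 : A * (S.card * (4 * (T * (X / L)))) ≤ X / 4 * T := by
        have : 16 * A * S.card / L ≤ 1 := by rw [div_le_one (by positivity)]; linarith
        have := mul_le_mul_of_nonneg_right this (show 0 ≤ X / 4 * T by positivity)
        calc _ = 16 * A * S.card / L * (X / 4 * T) := by field_simp; ring
          _ ≤ _ := by linarith
      linarith
    have d1 : ∀ m, m ≤ 4 * (5 * (X * B) * T) → (1/δ) * m ≤ X / 8 * T := by
      intro m hm
      calc (1/δ) * m ≤ (1/δ) * (4 * (5 * (X * B) * T)) := by gcongr
        _ = X / 8 * T := by 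
            have : 1/δ*δ = 1 := by field_simp
            rw [hBd]; linear_combination (X*T/8) * this
    have l3 := d1 _ m1
    have l4 := d1 _ m2
    rw [hC'] at h3
    linarith
  have upper : ∫ τ in (0:ℝ)..T, R τ ≤ X ^ 2 * (volume (G ∩ Set.Ioc 0 T)).toReal := by
    rw [intervalIntegral.integral_of_le h4]
    have hfin : volume (Set.Ioc 0 T) ≠ ⊤ := by simp
    calc _ ≤ ∫ τ in Set.Ioc 0 T, G.indicator (fun _ => X ^ 2) τ := by
          refine setIntegral_mono (cR.integrableOn_Ioc) ?_ hRle
          exact (integrableOn_const hfin).indicator hGo.measurableSet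
      _ = _ := by
          rw [integral_indicator hGo.measurableSet, setIntegral_const, Measure.real, Measure.restrict_apply hGo.measurableSet, smul_eq_mul, mul_comm]
  have fin : (volume (G ∩ Set.Ioc 0 T)).toReal ≤ (volume (G0 ∩ Set.Ioc 0 T)).toReal := by
    refine ENNReal.toReal_mono ?_ (measure_mono (Set.inter_subset_inter_left _ hGG))
    exact ne_top_of_le_ne_top (by simp) (measure_mono (Set.inter_subset_right) : _ ≤ volume (Set.Ioc 0 T))
  refine le_trans ?_ fin
  have := lower.trans upper
  rw [div_mul_eq_mul_div, one_mul, div_le_iff₀ (by positivity)]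
  have e : X * T ≤ X * ((volume (G ∩ Set.Ioc 0 T)).toReal * (4 * X)) := by nlinarith
  exact le_of_mul_le_mul_left e hX0

end LZ

namespace LZ

lemma pos_re {c z : ℂ} (hc : ‖c‖ = 1) (hz : ‖z‖ ≤ 3/4) : 1/4 ≤ (1 - c * z).re := by
  have : (c * z).re ≤ 3/4 := (Complex.re_le_norm _).trans (by rw [norm_mul, hc, one_mul]; exact hz)
  rw [Complex.sub_re, Complex.one_re]; linarith

lemma pos_norm {c z : ℂ} (hc : ‖c‖ = 1) (hz : ‖z‖ ≤ 3/4) : 1/4 ≤ ‖1 - c * z‖ :=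
  (pos_re hc hz).trans (Complex.re_le_norm _)

lemma pos_ne {c z : ℂ} (hc : ‖c‖ = 1) (hz : ‖z‖ ≤ 3/4) : 1 - c * z ≠ 0 := by
  intro h; have := pos_norm hc hz; rw [h, norm_zero] at this; linarith

lemma log_close {η : ℝ} (h0 : 0 < η) (h8 : η ≤ 1/8) (S : Finset ℕ) (h2 : 2 ∉ S) (x c z : ℕ → ℂ)
    (hx : ∀ p, ‖x p‖ = 1) (hc : ∀ p, ‖c p‖ = 1) (hz : ∀ p ∈ insert 2 S, ‖z p‖ ≤ 3/4) (Z : ℂ)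
    (hv : ‖Z * ∏ p ∈ insert 2 S, (1 - x p * z p) - 1‖ ≤ η)
    (hE : ‖∑ p ∈ S, -Complex.log (1 - c p * z p)‖ ≤ η)
    (hxc : ∑ p ∈ insert 2 S, 3 * ‖x p - c p‖ ≤ η) :
    ‖Complex.log Z - Complex.log (1 - c 2 * z 2)⁻¹‖ ≤ 6 * η := by
  set v := Z * ∏ p ∈ insert 2 S, (1 - x p * z p) - 1 with hvd
  set E := ∑ p ∈ S, -Complex.log (1 - c p * z p) with hEd
  set f : ℕ → ℂ := fun p => (x p - c p) * z p / (1 - x p * z p) with hf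
  set R := ∏ p ∈ insert 2 S, (1 + f p) with hR
  set g := (1 - c 2 * z 2)⁻¹ with hg
  have n2 := pos_ne (hc 2) (hz 2 (by simp))
  have hR1 : ‖R - 1‖ ≤ 2 * η := by
    have s1 : ∑ p ∈ insert 2 S, ‖f p‖ ≤ η := by
      refine le_trans (Finset.sum_le_sum fun p hp => ?_) hxc
      have := pos_norm (hx p) (hz p hp)
      rw [hf]; simp only
      rw [norm_div, norm_mul, div_le_iff₀ (by linarith)]
      have := hz p hp
      have := norm_nonneg (x p - c p)
      nlinarith
    have s0 : 0 ≤ ∑ p ∈ insert 2 S, ‖f p‖ := Finset.sum_nonneg fun _ _ => norm_nonneg _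
    have := Finset.norm_prod_one_add_sub_one_le (insert 2 S) f
    have e1 := Real.abs_exp_sub_one_le (x := ∑ p ∈ insert 2 S, ‖f p‖) (by rw [abs_of_nonneg s0]; linarith)
    rw [abs_of_nonneg s0] at e1
    have := le_abs_self (Real.exp (∑ p ∈ insert 2 S, ‖f p‖) - 1)
    linarith
  have hRf : ∀ p ∈ insert 2 S, (1 + f p) * (1 - x p * z p) = 1 - c p * z p := by
    intro p hp
    have := pos_ne (hx p) (hz p hp)
    rw [hf]; simp only; field_simp; ring
  have hRp : R * ∏ p ∈ insert 2 S, (1 - x p * z p) = (1 - c 2 * z 2) * ∏ p ∈ S, (1 - c p * z p) := by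
    rw [hR, ← Finset.prod_mul_distrib, Finset.prod_congr rfl hRf, Finset.prod_insert h2]
  have hEe : Complex.exp E * ∏ p ∈ S, (1 - c p * z p) = 1 := by
    rw [hEd, Complex.exp_sum, ← Finset.prod_mul_distrib]
    refine Finset.prod_eq_one fun p hp => ?_
    have := pos_ne (hc p) (hz p (by simp [hp]))
    rw [Complex.exp_neg, Complex.exp_log this, inv_mul_cancel₀ this]
  have hPx : ∏ p ∈ insert 2 S, (1 - x p * z p) ≠ 0 := Finset.prod_ne_zero_iff.2 fun p hp => pos_ne (hx p) (hz p hp)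
  have hl1 := Complex.norm_log_one_add_half_le_self (z := v) (by linarith)
  have hl2 := Complex.norm_log_one_add_half_le_self (z := R - 1) (by linarith)
  have eR : 1 + (R - 1) = R := by ring
  rw [eR] at hl2
  have nv : 1 + v ≠ 0 := by
    intro h
    have : v = -1 := by linear_combination h
    rw [this] at hv; simp at hv; linarith
  have nR : R ≠ 0 := by
    intro h
    rw [h] at hR1; simp at hR1; linarith
  have ng : g ≠ 0 := inv_ne_zero n2
  set W := Complex.log g + (Complex.log (1 + v) + Complex.log R + E) with hW
  have hWn : ‖Complex.log (1 + v) + Complex.log R + E‖ ≤ 6 * η := by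
    refine (norm_add₃_le).trans ?_
    linarith
  have hexp : Complex.exp W = Z := by
    rw [hW, Complex.exp_add, Complex.exp_add, Complex.exp_add, Complex.exp_log ng, Complex.exp_log nv, Complex.exp_log nR]
    have hv1 : 1 + v = Z * ∏ p ∈ insert 2 S, (1 - x p * z p) := by rw [hvd]; ring
    have hgm : g * (1 - c 2 * z 2) = 1 := inv_mul_cancel₀ n2
    rw [hv1]
    calc _ = Z * Complex.exp E * g * (R * ∏ p ∈ insert 2 S, (1 - x p * z p)) := by ring
      _ = Z * (g * (1 - c 2 * z 2)) * (Complex.exp E * ∏ p ∈ S, (1 - c p * z p)) := by rw [hRp]; ring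
      _ = Z := by rw [hgm, hEe]; ring
  have harg : |(Complex.log g).im| < π / 2 := by
    rw [Complex.log_im, Complex.abs_arg_lt_pi_div_two_iff]
    left
    rw [hg, Complex.inv_re]
    have := pos_re (hc 2) (hz 2 (by simp))
    exact div_pos (by linarith) (Complex.normSq_pos.2 n2)
  have him := (Complex.abs_im_le_norm (Complex.log (1 + v) + Complex.log R + E)).trans hWn
  have hWi : W.im = (Complex.log g).im + (Complex.log (1 + v) + Complex.log R + E).im := by rw [hW, Complex.add_im]
  have hpi := Real.pi_gt_three
  have hlog : Complex.log Z = W := by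
    rw [← hexp]
    rw [abs_lt] at harg
    rw [abs_le] at him
    exact Complex.log_exp (by rw [hWi]; linarith) (by rw [hWi]; linarith)
  rw [hlog, hW, add_sub_cancel_left]
  exact hWn

lemma zpow_close {x c : ℂ} (hx : ‖x‖ = 1) (hc : ‖c‖ = 1) (a : ℤ) : ‖x ^ a - c ^ a‖ ≤ |(a:ℝ)| * ‖x - c‖ := by
  have hn : ∀ n : ℕ, ‖x ^ n - c ^ n‖ ≤ n * ‖x - c‖ := by
    intro n
    induction n with
    | zero => simp
    | succ k ih =>
      have : x ^ (k+1) - c ^ (k+1) = x * (x ^ k - c ^ k) + (x - c) * c ^ k := by ring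
      rw [this]
      refine (norm_add_le _ _).trans ?_
      rw [norm_mul, norm_mul, norm_pow, hx, hc]; push_cast; simp; linarith
  have x0 : x ≠ 0 := by intro h; rw [h] at hx; simp at hx
  have c0 : c ≠ 0 := by intro h; rw [h] at hc; simp at hc
  obtain ⟨n, rfl | rfl⟩ := a.eq_nat_or_neg
  · simpa using hn n
  · have e : x ^ (-(n:ℤ)) - c ^ (-(n:ℤ)) = -(x ^ n - c ^ n) / (x ^ n * c ^ n) := by
      rw [zpow_neg, zpow_neg, zpow_natCast, zpow_natCast]; field_simp; ring
    rw [e, norm_div, norm_neg, norm_mul, norm_pow, norm_pow, hx, hc]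
    simpa using hn n

lemma pw_tau {p : ℕ} (s : ℂ) (a : ℤ) (τ : ℝ) : pw p (s + (((a:ℝ) * τ : ℝ) : ℂ) * I) = (pw p (τ * I)) ^ a * pw p s := by
  unfold pw
  rw [← Complex.exp_int_mul, ← Complex.exp_add]
  congr 1; push_cast; ring

end LZ

namespace LZ

lemma pwI (p : ℕ) (τ : ℝ) : ‖pw p (τ * I)‖ = 1 := by
  unfold pw
  rw [show -((Real.log p : ℂ) * (τ * I)) = ((-(Real.log p * τ) : ℝ) : ℂ) * I by push_cast; ring, Complex.norm_exp_ofReal_mul_I]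

lemma K_rect {K : Set ℂ} (hK : IsCompact K) (hKD : K ⊆ strip) :
    ∃ α β H : ℝ, 1/2 < α ∧ β < 1 ∧ α ≤ β ∧ 0 ≤ H ∧ K ⊆ Rect α β H := by
  rcases K.eq_empty_or_nonempty with rfl | hne
  · exact ⟨3/4, 3/4, 0, by norm_num, by norm_num, by norm_num, by norm_num, by simp⟩
  · obtain ⟨s1, m1, h1⟩ := hK.exists_isMinOn hne Complex.continuous_re.continuousOn
    obtain ⟨s2, m2, h2⟩ := hK.exists_isMaxOn hne Complex.continuous_re.continuousOn
    obtain ⟨s3, m3, h3⟩ := hK.exists_isMaxOn hne continuous_norm.continuousOn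
    refine ⟨s1.re, s2.re, ‖s3‖, (hKD m1).1, (hKD m2).2, h1 m2, norm_nonneg _, fun s hs => ?_⟩
    have a1 := h1 hs
    have a2 := h2 hs
    have a3 : ‖s‖ ≤ ‖s3‖ := h3 hs
    have := abs_le.1 ((Complex.abs_im_le_norm s).trans a3)
    exact ⟨a1, a2, this.1, this.2⟩

lemma zetaZ_two (a b c : ℤ) (s : ℂ) : zetaZ a b c 2 s = (1 - (omegaP a b 2) ^ c * pw 2 s)⁻¹ := by
  have : primesUpTo 2 = {2} := by
    unfold primesUpTo
    have : ⌊(2:ℝ)⌋₊ = 2 := by norm_num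
    rw [this]; decide
  rw [zetaZ, this, Finset.prod_singleton, pw_eq (by norm_num)]

lemma omega_pow {a b : ℤ} (h : a - b ≠ 0) : (omegaP a b 2) ^ (a - b) = 1 := by
  have h' : ((a:ℂ) - (b:ℂ)) ≠ 0 := by exact_mod_cast h
  have hc : Nat.count Nat.Prime 2 = 0 := by decide
  rw [omegaP, hc, ← Complex.exp_int_mul, Complex.exp_eq_one_iff]
  exact ⟨1, by push_cast; field_simp; simp⟩

lemma PS_insert {Y : ℕ} (hY : 3 ≤ Y) : PS Y = insert 2 ((Ico 3 Y).filter Nat.Prime) := by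
  ext p
  simp only [PS, Finset.mem_filter, Finset.mem_range, Finset.mem_insert, Finset.mem_Ico]
  constructor
  · rintro ⟨h1, h2⟩
    have := h2.two_le
    rcases this.eq_or_lt with h | h
    · left; exact h.symm
    · right; exact ⟨⟨h, h1⟩, h2⟩
  · rintro (rfl | ⟨⟨h1, h2⟩, h3⟩)
    · exact ⟨by omega, Nat.prime_two⟩
    · exact ⟨h2, h3⟩

lemma norm_of_zpow {z : ℂ} {n : ℤ} (hn : n ≠ 0) (h : z ^ n = 1) : ‖z‖ = 1 := by
  have : ‖z‖ ^ n = 1 := by rw [← norm_zpow, h, norm_one]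
  rcases (zpow_eq_one_iff_of_ne_zero₀ hn).1 this with h | h
  · exact h
  · have := norm_nonneg z; linarith [h.1]

lemma VV_diff {S : Finset ℕ} {α β H : ℝ} (hβ : β < 1) (r : ℝ) :
    DifferentiableOn ℂ (fun s => VV S (s + (r:ℂ) * I)) (Rect α β H) := by
  intro s hs
  refine DifferentiableAt.differentiableWithinAt ?_
  have hne : s + (r:ℂ) * I ≠ 1 := by
    intro h
    have := congrArg Complex.re h
    simp at this
    linarith [hs.2.1]
  have d1 : DifferentiableAt ℂ (fun s : ℂ => s + (r:ℂ) * I) s := by fun_prop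
  unfold VV
  refine DifferentiableAt.sub_const (DifferentiableAt.mul ?_ ?_) _
  · exact (differentiableAt_riemannZeta hne).comp s d1
  · refine DifferentiableAt.fun_finset_prod fun p _ => ?_
    exact ((pw_diff p).differentiableAt.comp s d1).const_sub 1

lemma dens_pos {S : Set ℝ} {κ : ℝ} (hκ : 0 < κ) (h : ∀ᶠ T : ℝ in atTop, κ * T ≤ (volume (S ∩ Set.Ioc 0 T)).toReal) :
    0 < lowerDens S := by
  refine lt_of_lt_of_le hκ ?_
  unfold lowerDens
  have fin : ∀ T : ℝ, volume (Set.Icc 0 T) ≠ ⊤ := fun T => by simp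
  refine le_liminf_of_le ?_ ?_
  · refine IsBoundedUnder.isCoboundedUnder_ge ⟨1, ?_⟩
    rw [Filter.eventually_map]
    filter_upwards [eventually_gt_atTop 0] with T hT
    rw [div_le_one hT]
    have := ENNReal.toReal_mono (fin T) (measure_mono (Set.inter_subset_right (s := S)))
    simpa [hT.le] using this
  · filter_upwards [h, eventually_gt_atTop 0] with T h1 hT
    rw [le_div_iff₀ hT]
    refine h1.trans (ENNReal.toReal_mono ?_ (measure_mono (Set.inter_subset_inter_right _ Set.Ioc_subset_Icc_self)))
    exact ne_top_of_le_ne_top (fin T) (measure_mono Set.inter_subset_right)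

lemma sup_lt {K : Set ℂ} {f : ℂ → ℂ} {ε : ℝ} (hε : 0 < ε) (h : ∀ s ∈ K, ‖f s‖ ≤ ε / 2) : supNorm K f < ENNReal.ofReal ε := by
  refine lt_of_le_of_lt (b := ENNReal.ofReal (ε/2)) ?_ ((ENNReal.ofReal_lt_ofReal_iff hε).2 (by linarith))
  refine iSup₂_le fun s hs => ?_
  change ‖f s‖ₑ ≤ _
  rw [← ofReal_norm]
  exact ENNReal.ofReal_le_ofReal (h s hs)

theorem main (a b : ℤ) (hab : IsCoprime a b)
    (h2 : 2 ≤ |a - b|) (K : Set ℂ) (hK : IsCompact K) (hKD : K ⊆ strip) (ε : ℝ) (hε : 0 < ε) :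
    ∃ z : ℝ, 2 ≤ z ∧ 0 < lowerDens {τ : ℝ | 0 < τ ∧
      supNorm K (fun s => Complex.log (riemannZeta (s + ((a : ℝ) * τ : ℝ) * Complex.I))
        - Complex.log (zetaZ a b a z s)) < ENNReal.ofReal ε ∧
      supNorm K (fun s => Complex.log (riemannZeta (s + ((b : ℝ) * τ : ℝ) * Complex.I))
        - Complex.log (zetaZ a b b z s)) < ENNReal.ofReal ε} := by
  refine ⟨2, le_rfl, ?_⟩
  have hn0 : a - b ≠ 0 := by intro h; rw [h] at h2; simp at h2
  have ha : a ≠ 0 := by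
    rintro rfl
    rw [isCoprime_zero_left, Int.isUnit_iff] at hab
    rcases hab with rfl | rfl <;> norm_num at h2
  have hb : b ≠ 0 := by
    rintro rfl
    rw [isCoprime_zero_right, Int.isUnit_iff] at hab
    rcases hab with rfl | rfl <;> norm_num at h2
  obtain ⟨α', β', H', k1, k2, k3, k4, hKR⟩ := K_rect hK hKD
  set α := (1/2 + α') / 2 with hα
  set β := (β' + 1) / 2 with hβ
  set H := H' + 1 with hH
  have c1 : 1/2 < α := by rw [hα]; linarith
  have c2 : α < α' := by rw [hα]; linarith
  have c3 : β' < β := by rw [hβ]; linarith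
  have c4 : β < 1 := by rw [hβ]; linarith
  have c5 : H' < H := by rw [hH]; linarith
  have c6 : α ≤ β := by linarith
  have c7 : 0 ≤ H := by linarith
  obtain ⟨C, hC, hsup⟩ := sup_bound c2 c3 c5 c6 c7
  set η := min (ε / 12) (1/8) with hη
  have hη0 : 0 < η := lt_min (by positivity) (by norm_num)
  have hη8 : η ≤ 1/8 := min_le_right _ _
  have hηε : η ≤ ε/12 := min_le_left _ _
  obtain ⟨Y0, hgood⟩ := good_set c1 c6 c4 c7 ha hb (δ := η^2 / C) (by positivity)
  have hnn : 2 ≤ (a - b).natAbs := by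
    have := Int.natCast_natAbs (a - b); omega
  obtain ⟨Y, hYM, ζ, hζ, hdens⟩ := dens_A hnn c1 c4 c2 c3 c5 c6 c7 η hη0 (max Y0 3)
  have hY0 : Y0 ≤ Y := (le_max_left _ _).trans hYM
  have hY3 : 3 ≤ Y := (le_max_right _ _).trans hYM
  have hζ1 : ∀ p, (ζ p) ^ (a - b) = 1 := by
    intro p
    rcases Int.natAbs_eq (a - b) with h | h
    · rw [h, zpow_natCast]; exact hζ p
    · rw [h, zpow_neg, zpow_natCast, hζ p, inv_one]
  have hζn : ∀ p, ‖ζ p‖ = 1 := fun p => norm_of_zpow hn0 (hζ1 p)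
  have hζ0 : ∀ p, ζ p ≠ 0 := fun p h => by have := hζn p; rw [h] at this; simp at this
  have hω := omega_pow hn0
  have hωn := norm_of_zpow hn0 hω
  have hcop : IsCoprime a (a - b) := by
    obtain ⟨u, v, h⟩ := hab
    exact ⟨u + v, -v, by linear_combination h⟩
  obtain ⟨k, m, hkm⟩ := hcop
  set χ : ℕ → ℂ := fun p => if p = 2 then omegaP a b 2 else (ζ p) ^ k with hχd
  have hχ2 : χ 2 = omegaP a b 2 := by simp [hχd]
  have hχp : ∀ p, p ≠ 2 → χ p = ζ p ^ k := fun p hp => by simp [hχd, hp]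
  have hχn : ∀ p, ‖χ p‖ = 1 := by
    intro p
    by_cases hp : p = 2
    · rw [hp, hχ2, hωn]
    · rw [hχp p hp, norm_zpow, hζn, one_zpow]
  have hχa : ∀ p, p ≠ 2 → χ p ^ a = ζ p := by
    intro p hp
    rw [hχp p hp, ← zpow_mul, show k * a = 1 + (a - b) * (-m) by linear_combination hkm, zpow_add₀ (hζ0 p), zpow_mul, hζ1]
    simp
  have hχb : ∀ p, p ≠ 2 → χ p ^ b = ζ p := by
    intro p hp
    rw [hχp p hp, ← zpow_mul, show k * b = 1 + (a - b) * (-m - k) by linear_combination hkm, zpow_add₀ (hζ0 p), zpow_mul, hζ1]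
    simp
  set N : ℝ := |(a:ℝ)| + |(b:ℝ)| + 1 with hN
  have hN0 : 0 < N := by positivity
  obtain ⟨κ, hκ, hev⟩ := hgood Y hY0 χ hχn (η / (3 * N * Y)) (by
    have : (0:ℝ) < Y := by exact_mod_cast (by omega : 0 < Y)
    positivity)
  have key : ∀ e : ℤ, |(e:ℝ)| ≤ N → (∀ p, p ≠ 2 → χ p ^ e = ζ p) → ∀ τ : ℝ,
      (∀ p ∈ PS Y, ‖pw p (τ * I) - χ p‖ < η / (3 * N * Y)) → JJ α β H (PS Y) e τ < η^2 / C →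
      supNorm K (fun s => Complex.log (riemannZeta (s + ((e : ℝ) * τ : ℝ) * Complex.I))
        - Complex.log (zetaZ a b e 2 s)) < ENNReal.ofReal ε := by
    intro e he hχe τ hτ hJ
    refine sup_lt hε fun s hs => ?_
    have hsR := hKR hs
    have hsD := hKD hs
    rw [zetaZ_two]
    have hv : ‖VV (PS Y) (s + ((e : ℝ) * τ : ℝ) * Complex.I)‖ ≤ η := by
      have := hsup _ (VV_diff (S := PS Y) c4 ((e:ℝ) * τ)) s hsR
      have e1 : ∫ t in (0:ℝ)..4, ‖VV (PS Y) (gam α β H t + (((e:ℝ) * τ : ℝ) : ℂ) * I)‖ ^ 2 = JJ α β H (PS Y) e τ := by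
        unfold JJ
        refine intervalIntegral.integral_congr fun t ht => ?_
        rw [Set.uIcc_of_le (by norm_num)] at ht
        simp only [gc_eq ht]
      rw [e1] at this
      have h3 : C * JJ α β H (PS Y) e τ ≤ η ^ 2 := by
        rw [lt_div_iff₀ hC] at hJ; linarith
      exact (pow_le_pow_iff_left₀ (norm_nonneg _) hη0.le two_ne_zero).1 (this.trans h3)
    have hx1 : ∀ p, ‖pw p (τ * I) ^ e‖ = 1 := by
      intro p
      rw [norm_zpow]
      have : ‖pw p (τ * I)‖ = 1 := pwI p τ
      rw [this, one_zpow]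
    have hx0 : ∀ p, ‖pw p (τ * I)‖ = 1 := fun p => pwI p τ
    have := log_close hη0 hη8 ((Ico 3 Y).filter Nat.Prime) (by simp) (fun p => pw p (τ * I) ^ e) (fun p => χ p ^ e) (fun p => pw p s)
      hx1 (fun p => by rw [norm_zpow, hχn, one_zpow]) (fun p hp => ?_) (riemannZeta (s + ((e : ℝ) * τ : ℝ) * Complex.I)) ?_ ?_ ?_
    · simp only [hχ2] at this
      exact this.trans (by linarith)
    · rw [← PS_insert hY3] at hp
      exact pw_lt (PS_prime hp).two_le hsD.1.le
    · rw [← PS_insert hY3]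
      unfold VV at hv
      simp only [pw_tau] at hv
      exact hv
    · refine le_trans (le_of_eq ?_) (hdens s hsR)
      congr 1
      refine Finset.sum_congr rfl fun p hp => ?_
      have : 3 ≤ p := (Finset.mem_Ico.1 (Finset.mem_filter.1 hp).1).1
      simp only [hχe p (by omega)]
    · rw [← PS_insert hY3]
      have hYp : (0:ℝ) < Y := by exact_mod_cast (by omega : 0 < Y)
      calc _ ≤ ∑ p ∈ PS Y, η / Y := by
            refine Finset.sum_le_sum fun p hp => ?_
            have z1 := zpow_close (hx0 p) (hχn p) e
            have z2 := (hτ p hp).le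
            calc _ ≤ 3 * (N * (η / (3 * N * Y))) := by
                  refine mul_le_mul_of_nonneg_left (z1.trans ?_) (by norm_num)
                  exact mul_le_mul he z2 (norm_nonneg _) hN0.le
              _ = _ := by field_simp
        _ = (PS Y).card * (η / Y) := by rw [Finset.sum_const, nsmul_eq_mul]
        _ ≤ Y * (η / Y) := by
            have : (PS Y).card ≤ Y := (Finset.card_filter_le _ _).trans (by simp)
            have : ((PS Y).card : ℝ) ≤ Y := by exact_mod_cast this
            gcongr
        _ = η := by field_simp
  refine dens_pos hκ ?_
  filter_upwards [hev] with T hT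
  refine hT.trans (ENNReal.toReal_mono ?_ (measure_mono ?_))
  · exact ne_top_of_le_ne_top (by simp) (measure_mono (Set.inter_subset_right) : _ ≤ volume (Set.Ioc 0 T))
  · rintro τ ⟨⟨t1, t2, t3⟩, t4⟩
    refine ⟨⟨t4.1, ?_, ?_⟩, t4⟩
    · exact key a (by rw [hN]; have := abs_nonneg (b:ℝ); linarith) hχa τ t1 t2
    · exact key b (by rw [hN]; have := abs_nonneg (a:ℝ); linarith) hχb τ t1 t3

end LZ

theorem log_zeta_approx_by_finite_product (a b : ℤ) (hab : IsCoprime a b)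
    (h2 : 2 ≤ |a - b|) (K : Set ℂ) (hK : IsCompact K) (hKD : K ⊆ strip)
    (hKc : IsConnected Kᶜ) (ε : ℝ) (hε : 0 < ε) :
    ∃ z : ℝ, 2 ≤ z ∧ 0 < lowerDens {τ : ℝ | 0 < τ ∧
      supNorm K (fun s => Complex.log (riemannZeta (s + ((a : ℝ) * τ : ℝ) * Complex.I))
        - Complex.log (zetaZ a b a z s)) < ENNReal.ofReal ε ∧
      supNorm K (fun s => Complex.log (riemannZeta (s + ((b : ℝ) * τ : ℝ) * Complex.I))
        - Complex.log (zetaZ a b b z s)) < ENNReal.ofReal ε} := by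
  exact LZ.main a b hab h2 K hK hKD ε hε
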